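/- Let k ≥ 3 and ℓ ∈ [k−1] with (k,ℓ) ≠ (3,1), and set t = ⌊k/(k−ℓ)⌋·(k−ℓ). There exists n₀ such that for every n ≥ n₀ with n divisible by k−ℓ, every n-vertex k-graph G with no isolated vertices and minimum supported co-degree δ*(G) ≥ (1 − 1/t)·n − (k−3) contains a Hamilton ℓ-cycle. -/

import Mathlib

open Finset

/-- A Hamilton ℓ-cycle in the `k`-graph with edge set `E` on vertex set `Fin n`:
a cyclic ordering `f` of the vertices such that every window of `k` consecutive
vertices starting at a position divisible by `k - l` (indices taken cyclically
modulo `n`) forms an edge. -/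
def HamCycle {n : ℕ} (k l : ℕ) (E : Finset (Finset (Fin n))) : Prop :=
  ∃ f : ZMod n → Fin n, Function.Bijective f ∧
    ∀ i : ℕ,
      (Finset.image (fun j : Fin k => f (((i * (k - l) + (j : ℕ)) : ℕ) : ZMod n))
        Finset.univ) ∈ E

/-- The sum of `g` over all lists of length `M` with entries in `W`. -/
noncomputable def isum {V : Type*} (W : Finset V) : ℕ → (List V → ℝ) → ℝ
  | 0, g => g []
  | M + 1, g => ∑ v ∈ W, isum W M (fun l => g (v :: l))

open Classical in
/-- The real-valued indicator of a predicate on lists. -/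
noncomputable def ind {V : Type*} (R : List V → Prop) : List V → ℝ := fun l => if R l then 1 else 0

section isum
variable {V : Type*} {W : Finset V}

theorem ind_nonneg (R : List V → Prop) (l : List V) : 0 ≤ ind R l := by
  unfold ind; split_ifs <;> norm_num

theorem ind_le_one (R : List V → Prop) (l : List V) : ind R l ≤ 1 := by
  unfold ind; split_ifs <;> norm_num

theorem ind_of {R : List V → Prop} {l : List V} (h : R l) : ind R l = 1 := if_pos h

theorem ind_of_not {R : List V → Prop} {l : List V} (h : ¬ R l) : ind R l = 0 := if_neg h

theorem isum_mono : ∀ (M : ℕ) {f g : List V → ℝ},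
    (∀ l : List V, l.length = M → (∀ v ∈ l, v ∈ W) → f l ≤ g l) → isum W M f ≤ isum W M g
  | 0, f, g, h => h [] rfl (by simp)
  | M + 1, f, g, h => by
    refine Finset.sum_le_sum fun v hv => isum_mono M fun l hl hlW => h _ (by simp [hl]) ?_
    intro x hx
    rcases List.mem_cons.1 hx with rfl | hx
    · exact hv
    · exact hlW x hx

theorem isum_const : ∀ (M : ℕ) (c : ℝ), isum W M (fun _ => c) = c * (W.card : ℝ) ^ M
  | 0, c => by simp [isum]
  | M + 1, c => by simp [isum, isum_const M c]; ring

theorem isum_add : ∀ (M : ℕ) (f g : List V → ℝ),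
    isum W M (fun l => f l + g l) = isum W M f + isum W M g
  | 0, f, g => rfl
  | M + 1, f, g => by simp [isum, isum_add M, Finset.sum_add_distrib]

theorem isum_mul : ∀ (M : ℕ) (c : ℝ) (f : List V → ℝ),
    isum W M (fun l => c * f l) = c * isum W M f
  | 0, c, f => rfl
  | M + 1, c, f => by simp [isum, isum_mul M, Finset.mul_sum]

theorem isum_sum {ι : Type*} (T : Finset ι) : ∀ (M : ℕ) (f : ι → List V → ℝ),
    isum W M (fun l => ∑ i ∈ T, f i l) = ∑ i ∈ T, isum W M (f i)
  | 0, f => rfl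
  | M + 1, f => by simp only [isum, isum_sum T M]; rw [Finset.sum_comm]

theorem isum_nonneg (M : ℕ) {f : List V → ℝ} (h : ∀ l, 0 ≤ f l) : 0 ≤ isum W M f := by
  have := isum_mono (W := W) M (f := fun _ => 0) (g := f) fun l _ _ => h l
  simpa [isum_const] using this

/-- Sequential choice: if every admissible prefix has at least `q` admissible one-step extensions
then there are at least `q ^ M` admissible lists. -/
theorem pow_le_isum_ind [DecidableEq V] {P : List V → Prop} {q : ℝ} (hq : 0 ≤ q) (M₀ : ℕ)
    (hstep : ∀ l : List V, l.length < M₀ → (∀ v ∈ l, v ∈ W) → P l →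
      ∃ T : Finset V, T ⊆ W ∧ q ≤ T.card ∧ ∀ v ∈ T, P (l ++ [v])) :
    ∀ (M : ℕ) (pre : List V), pre.length + M = M₀ → (∀ v ∈ pre, v ∈ W) → P pre →
      q ^ M ≤ isum W M (fun l => ind P (pre ++ l))
  | 0, pre, _, _, hP => by simp [isum, ind_of hP]
  | M + 1, pre, hl, hW, hP => by
    obtain ⟨T, hTW, hTq, hT⟩ := hstep pre (by omega) hW hP
    have h1 : ∀ v ∈ T, q ^ M ≤ isum W M (fun l => ind P (pre ++ v :: l)) := by
      intro v hv
      have := pow_le_isum_ind hq M₀ hstep M (pre ++ [v]) (by simp; omega) (by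
        intro x hx
        rcases List.mem_append.1 hx with hx | hx
        · exact hW x hx
        · rw [List.mem_singleton.1 hx]; exact hTW hv) (hT v hv)
      simpa using this
    calc q ^ (M + 1) = q * q ^ M := by ring
      _ ≤ T.card * q ^ M := by gcongr
      _ = ∑ v ∈ T, q ^ M := by simp
      _ ≤ ∑ v ∈ T, isum W M (fun l => ind P (pre ++ v :: l)) := Finset.sum_le_sum h1
      _ ≤ ∑ v ∈ W, isum W M (fun l => ind P (pre ++ v :: l)) :=
        Finset.sum_le_sum_of_subset_of_nonneg hTW fun v _ _ => isum_nonneg M fun l => ind_nonneg _ _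

/-- A dense family of `M`-lists contains a complete `M`-partite subfamily with parts of size `b`. -/
theorem exists_blowup (b : ℕ) (hb : 1 ≤ b) : ∀ (M : ℕ) (c : ℝ), 0 < c → ∃ s₀ : ℕ,
    ∀ (n : ℕ) (W : Finset (Fin n)) (R : List (Fin n) → Prop), s₀ ≤ W.card →
      c * (W.card : ℝ) ^ M ≤ isum W M (ind R) →
      ∃ B : List (Finset (Fin n)), B.length = M ∧ (∀ X ∈ B, X ⊆ W ∧ X.card = b) ∧
        ∀ y : List (Fin n), List.Forall₂ (fun v X => v ∈ X) y B → R y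
  | 0, c, hc => ⟨0, fun n W R _ h => ⟨[], rfl, by simp, fun y hy => by
      cases hy
      by_contra hR
      simp only [isum, ind_of_not hR] at h
      simp at h
      linarith⟩⟩
  | M + 1, c, hc => by
    obtain ⟨K, hK⟩ : ∃ K : ℕ, 4 * b / c ≤ K := exists_nat_ge _
    have hb' : (1 : ℝ) ≤ b := by exact_mod_cast hb
    have hKpos : (0 : ℝ) < K := lt_of_lt_of_le (by positivity) hK
    have hK2 : 4 * b ≤ K * c := by rwa [div_le_iff₀ hc] at hK
    obtain ⟨s₁, hs₁⟩ := exists_blowup b hb M ((b : ℝ) / K / 2 ^ K) (by positivity)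
    obtain ⟨s₂, hs₂⟩ : ∃ s : ℕ, 2 * K / c ≤ s := exists_nat_ge _
    refine ⟨max (max s₁ s₂) 1, fun n W R hW h => ?_⟩
    classical
    have hW1 : s₁ ≤ W.card := by omega
    have hW2 : (s₂ : ℝ) ≤ W.card := by exact_mod_cast (by omega : s₂ ≤ W.card)
    have hW3 : (1 : ℝ) ≤ W.card := by exact_mod_cast (by omega : 1 ≤ W.card)
    set s : ℝ := (W.card : ℝ) with hs
    have hsM : (0 : ℝ) < s ^ M := by positivity
    let f : Fin n → ℝ := fun v => isum W M (fun l => ind R (v :: l))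
    have hf : ∀ v, f v ≤ s ^ M := fun v => by
      have := isum_mono (W := W) M (f := fun l => ind R (v :: l)) (g := fun _ => 1)
        fun l _ _ => ind_le_one _ _
      simpa [isum_const] using this
    let G := W.filter fun v => c / 2 * s ^ M ≤ f v
    have hG : c / 2 * s ≤ G.card := by
      have h1 : isum W (M + 1) (ind R) = ∑ v ∈ W, f v := rfl
      have h2 : ∑ v ∈ W, f v = ∑ v ∈ G, f v + ∑ v ∈ W.filter (fun v => ¬ c / 2 * s ^ M ≤ f v), f v :=
        (Finset.sum_filter_add_sum_filter_not _ _ _).symm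
      have h3 : ∑ v ∈ G, f v ≤ G.card * s ^ M := by
        rw [← nsmul_eq_mul]; exact Finset.sum_le_card_nsmul _ _ _ fun v _ => hf v
      have h4 : ∑ v ∈ W.filter (fun v => ¬ c / 2 * s ^ M ≤ f v), f v ≤ s * (c / 2 * s ^ M) := by
        calc _ ≤ (W.filter (fun v => ¬ c / 2 * s ^ M ≤ f v)).card • (c / 2 * s ^ M) :=
              Finset.sum_le_card_nsmul _ _ _ fun v hv => (not_le.1 (Finset.mem_filter.1 hv).2).le
          _ ≤ _ := by
              rw [nsmul_eq_mul]
              have : ((W.filter (fun v => ¬ c / 2 * s ^ M ≤ f v)).card : ℝ) ≤ s := by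
                exact Nat.cast_le.2 (Finset.card_le_card (Finset.filter_subset _ W))
              gcongr
      rw [h1, h2] at h
      have : c / 2 * s * s ^ M ≤ G.card * s ^ M := by
        have : c * s ^ (M + 1) = c * s * s ^ M := by ring
        nlinarith
      exact le_of_mul_le_mul_right this hsM
    have hKG : K ≤ G.card := by
      have : (K : ℝ) ≤ G.card := by
        refine le_trans ?_ hG
        have : 2 * K / c ≤ s := hs₂.trans hW2
        rw [div_le_iff₀ hc] at this
        linarith
      exact_mod_cast this
    obtain ⟨T, hTG, hTK⟩ := Finset.exists_subset_card_eq hKG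
    let cnt : List (Fin n) → Finset (Fin n) := fun l => T.filter fun v => R (v :: l)
    have h5 : 2 * b * s ^ M ≤ isum W M (fun l => ((cnt l).card : ℝ)) := by
      have e1 : isum W M (fun l => ((cnt l).card : ℝ)) = ∑ v ∈ T, f v := by
        rw [← isum_sum]
        congr 1
        funext l
        simp [cnt, ind, Finset.sum_boole]
      rw [e1]
      calc 2 * b * s ^ M ≤ (K * c / 2) * s ^ M := by gcongr; linarith
        _ = T.card • (c / 2 * s ^ M) := by rw [hTK, nsmul_eq_mul]; ring
        _ ≤ _ := Finset.card_nsmul_le_sum _ _ _ fun v hv => (Finset.mem_filter.1 (hTG hv)).2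
    let Q : Finset (Fin n) → List (Fin n) → Prop := fun T' l => ∀ v ∈ T', R (v :: l)
    have h6 : isum W M (fun l => ((cnt l).card : ℝ)) ≤
        b * s ^ M + K * ∑ T' ∈ T.powersetCard b, isum W M (ind (Q T')) := by
      rw [← isum_sum, ← isum_mul, ← isum_const, ← isum_add]
      refine isum_mono M fun l _ _ => ?_
      by_cases hc' : b ≤ (cnt l).card
      · obtain ⟨T', hT', hT'b⟩ := Finset.exists_subset_card_eq hc'
        have h7 : (1 : ℝ) ≤ ∑ T' ∈ T.powersetCard b, ind (Q T') l := by
          have hmem : T' ∈ T.powersetCard b :=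
            Finset.mem_powersetCard.2 ⟨hT'.trans (Finset.filter_subset _ _), hT'b⟩
          refine le_trans (b := ind (Q T') l) ?_
            (Finset.single_le_sum (f := fun T' => ind (Q T') l) (fun i _ => ind_nonneg _ _) hmem)
          rw [ind_of]
          intro v hv
          exact (Finset.mem_filter.1 (hT' hv)).2
        have h8 : ((cnt l).card : ℝ) ≤ K := by
          exact_mod_cast hTK ▸ Finset.card_le_card (Finset.filter_subset _ _)
        nlinarith
      · have h7 : (0 : ℝ) ≤ ∑ T' ∈ T.powersetCard b, ind (Q T') l :=
          Finset.sum_nonneg fun i _ => ind_nonneg _ _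
        have h8 : ((cnt l).card : ℝ) ≤ b := by exact_mod_cast (not_le.1 hc').le
        nlinarith
    have h9 : ∃ T' ∈ T.powersetCard b, (b : ℝ) / K / 2 ^ K * s ^ M ≤ isum W M (ind (Q T')) := by
      by_contra! hcon
      have h10 : ∑ T' ∈ T.powersetCard b, isum W M (ind (Q T')) < b / K * s ^ M := by
        have hne : (T.powersetCard b).Nonempty := by
          rw [Finset.powersetCard_nonempty, hTK]
          have hc1 : c ≤ 1 := by
            have h11 : isum W (M + 1) (ind R) ≤ s ^ (M + 1) := by
              have := isum_mono (W := W) (M + 1) (f := ind R) (g := fun _ => 1)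
                fun l _ _ => ind_le_one _ _
              simpa [isum_const] using this
            have h12 : (0 : ℝ) < s ^ (M + 1) := by positivity
            nlinarith
          have : (b : ℝ) ≤ K := by nlinarith
          exact_mod_cast this
        calc _ < (T.powersetCard b).card • ((b : ℝ) / K / 2 ^ K * s ^ M) := by
              rw [← Finset.sum_const]
              exact Finset.sum_lt_sum_of_nonempty hne hcon
          _ ≤ 2 ^ K * ((b : ℝ) / K / 2 ^ K * s ^ M) := by
              rw [nsmul_eq_mul]
              gcongr
              have : (T.powersetCard b).card ≤ 2 ^ K := by
                rw [← hTK, ← Finset.card_powerset]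
                exact Finset.card_le_card fun x hx =>
                  Finset.mem_powerset.2 (Finset.mem_powersetCard.1 hx).1
              exact_mod_cast this
          _ = b / K * s ^ M := by field_simp
      have h13 : K * ∑ T' ∈ T.powersetCard b, isum W M (ind (Q T')) < b * s ^ M := by
        calc _ < K * (b / K * s ^ M) := by gcongr
          _ = _ := by field_simp
      linarith
    obtain ⟨T', hT', hT'2⟩ := h9
    obtain ⟨B, hBl, hBW, hB⟩ := hs₁ n W (Q T') hW1 hT'2
    have hT'3 := Finset.mem_powersetCard.1 hT'
    refine ⟨T' :: B, by simp [hBl], ?_, ?_⟩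
    · intro X hX
      rcases List.mem_cons.1 hX with rfl | hX
      · exact ⟨(hT'3.1.trans hTG).trans (Finset.filter_subset _ _), hT'3.2⟩
      · exact hBW X hX
    · intro y hy
      cases hy with
      | cons hv hy => exact hB _ hy _ hv
end isum

/-- Realising words: in a dense family `R` of lists without repetition, a word `w` over the letters
`0, …, M - 1` can be realised by distinct vertices such that positions with distinct letters
belong to a common member of the family. -/
theorem exists_word (M len : ℕ) (w : ℕ → ℕ) (hw : ∀ j < len, w j < M) (c : ℝ) (hc : 0 < c) :
    ∃ s₀ : ℕ, ∀ (n : ℕ) (W : Finset (Fin n)), s₀ ≤ W.card → ∀ R : List (Fin n) → Prop,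
      (∀ l, R l → l.Nodup) → c * (W.card : ℝ) ^ M ≤ isum W M (ind R) →
      ∃ p : ℕ → Fin n, (∀ j < len, p j ∈ W) ∧ Set.InjOn p {j | j < len} ∧
        ∀ J : Finset ℕ, (∀ j ∈ J, j < len) → Set.InjOn w J →
          ∃ y : List (Fin n), y.length = M ∧ R y ∧ (∀ v ∈ y, v ∈ W) ∧
            ∀ j ∈ J, y[w j]? = some (p j) := by
  classical
  obtain ⟨s₀, hs⟩ := exists_blowup (len + 1) (by omega) M c hc
  refine ⟨max s₀ 1, fun n W hW R hR hd => ?_⟩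
  obtain ⟨B, hBl, hB, hBR⟩ := hs n W R (by omega) hd
  obtain ⟨v₀, -⟩ : W.Nonempty := Finset.card_pos.1 (by omega)
  have hex : ∀ X : Finset (Fin n), ∃ e : ℕ → Fin n, X.card = len + 1 →
      (∀ j, e j ∈ X) ∧ Set.InjOn e {j | j < len + 1} := by
    intro X
    by_cases hX : X.card = len + 1
    · refine ⟨fun j => X.orderEmbOfFin hX (Fin.ofNat (len + 1) j), fun _ =>
        ⟨fun j => Finset.orderEmbOfFin_mem _ _ _, fun a ha b hb h => ?_⟩⟩
      have h1 := (X.orderEmbOfFin hX).injective h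
      have h2 := congrArg Fin.val h1
      simp only [Set.mem_ofPred_eq] at ha hb
      simpa [Fin.ofNat, Nat.mod_eq_of_lt ha, Nat.mod_eq_of_lt hb] using h2
    · exact ⟨fun _ => v₀, fun h => absurd h hX⟩
  choose e he using hex
  let BB : ℕ → Finset (Fin n) := fun i => B.getD i ∅
  have hBB : ∀ i < M, BB i ⊆ W ∧ (BB i).card = len + 1 := by
    intro i hi
    have : BB i = B[i]'(hBl ▸ hi) := by
      simp only [BB]
      exact List.getD_eq_getElem _ _ _
    rw [this]
    exact hB _ (List.getElem_mem _)
  have hy : ∀ y : ℕ → Fin n, (∀ i < M, y i ∈ BB i) → R (List.ofFn fun i : Fin M => y i) := by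
    intro y hy
    apply hBR
    rw [List.forall₂_iff_get]
    refine ⟨by simp [hBl], fun i h1 h2 => ?_⟩
    have h3 : i < M := hBl ▸ h2
    have := hy i h3
    simp only [BB, List.getD_eq_getElem _ _ h2] at this
    simpa using this
  have hdisj : ∀ i < M, ∀ i' < M, i ≠ i' → ∀ x, x ∈ BB i → x ∉ BB i' := by
    intro i hi i' hi' hne x hx hx'
    have h1 := hR _ (hy (fun a => if a = i ∨ a = i' then x else e (BB a) 0) (by
      intro a ha
      by_cases h : a = i ∨ a = i'
      · simp only [h, if_true]
        rcases h with rfl | rfl <;> assumption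
      · simp only [h, if_false]
        exact (he _ (hBB a ha).2).1 0))
    rw [List.nodup_ofFn] at h1
    have := @h1 ⟨i, hi⟩ ⟨i', hi'⟩ (by simp)
    simp at this
    exact hne this
  refine ⟨fun j => e (BB (w j)) j, fun j hj => (hBB _ (hw j hj)).1 ((he _ (hBB _ (hw j hj)).2).1 j),
    ?_, fun J hJ hJw => ?_⟩
  · intro a ha b hb hab
    simp only [Set.mem_ofPred_eq] at ha hb hab
    by_cases h : w a = w b
    · rw [h] at hab
      exact (he _ (hBB _ (hw b hb)).2).2 (by simp; omega) (by simp; omega) hab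
    · exact absurd (hab ▸ (he _ (hBB _ (hw b hb)).2).1 b)
        (hdisj _ (hw a ha) _ (hw b hb) h _ ((he _ (hBB _ (hw a ha)).2).1 a))
  · let y : ℕ → Fin n := fun i => if h : ∃ j ∈ J, w j = i then e (BB i) h.choose else e (BB i) 0
    have hyB : ∀ i < M, y i ∈ BB i := by
      intro i hi
      simp only [y]
      split_ifs
      · exact (he _ (hBB i hi).2).1 _
      · exact (he _ (hBB i hi).2).1 _
    refine ⟨List.ofFn fun i : Fin M => y i, by simp, hy y hyB, ?_, ?_⟩
    · intro v hv
      obtain ⟨i, rfl⟩ := (List.mem_ofFn' _ _).1 hv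
      exact (hBB _ i.2).1 (hyB _ i.2)
    · intro j hj
      have h1 : ∃ j' ∈ J, w j' = w j := ⟨j, hj, rfl⟩
      have h2 : h1.choose = j := hJw h1.choose_spec.1 hj h1.choose_spec.2
      have h3 := hw j (hJ j hj)
      rw [List.getElem?_ofFn]
      simp only [h3, dif_pos, y]
      rw [dif_pos h1, h2]

theorem exists_ge_of_isum {V : Type*} {W : Finset V} (hW : W.Nonempty) (c : ℝ) :
    ∀ (M : ℕ) (f : List V → ℝ), c * (W.card : ℝ) ^ M ≤ isum W M f →
      ∃ y : List V, y.length = M ∧ (∀ v ∈ y, v ∈ W) ∧ c ≤ f y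
  | 0, f, h => ⟨[], rfl, by simp, by simpa [isum] using h⟩
  | M + 1, f, h => by
    obtain ⟨v, hv, h1⟩ : ∃ v ∈ W, c * (W.card : ℝ) ^ M ≤ isum W M (fun l => f (v :: l)) := by
      apply Finset.exists_le_of_sum_le hW
      rw [Finset.sum_const, nsmul_eq_mul]
      refine le_trans (le_of_eq ?_) h
      ring
    obtain ⟨y, h2, h3, h4⟩ := exists_ge_of_isum hW c M _ h1
    exact ⟨v :: y, by simp [h2], by simpa [hv] using h3, h4⟩

section basics
variable {n : ℕ}

/-- A vertex set is a face (supported) if some edge contains it. -/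
def Face (E : Finset (Finset (Fin n))) (σ : Finset (Fin n)) : Prop := ∃ e ∈ E, σ ⊆ e

open Classical in
/-- The vertices which do not extend `σ` to a face. -/
noncomputable def miss (E : Finset (Finset (Fin n))) (σ : Finset (Fin n)) : Finset (Fin n) :=
  Finset.univ.filter fun v => ¬ Face E (insert v σ)

/-- `k`-uniform, every vertex is covered and each face of size less than `k` is not extended by
at most `n / t - 2` vertices. -/
structure Good (k t : ℕ) (E : Finset (Finset (Fin n))) : Prop where
  card_eq : ∀ e ∈ E, e.card = k
  face_singleton : ∀ v, Face E {v}
  card_miss : ∀ σ, Face E σ → σ.card < k → t * ((miss E σ).card + 2) ≤ n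

variable {E : Finset (Finset (Fin n))} {k t d : ℕ}

theorem Face.mono {σ τ : Finset (Fin n)} (h : Face E τ) (hs : σ ⊆ τ) : Face E σ :=
  let ⟨e, he, h'⟩ := h; ⟨e, he, hs.trans h'⟩

theorem mem_miss {σ : Finset (Fin n)} {v : Fin n} : v ∈ miss E σ ↔ ¬ Face E (insert v σ) := by
  simp [miss]

theorem face_insert {σ : Finset (Fin n)} {v : Fin n} (h : v ∉ miss E σ) : Face E (insert v σ) := by
  rw [mem_miss] at h; tauto

theorem miss_mono {σ τ : Finset (Fin n)} (h : σ ⊆ τ) : miss E σ ⊆ miss E τ := fun v hv => by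
  rw [mem_miss] at *
  exact fun h' => hv (h'.mono (Finset.insert_subset_insert _ h))

theorem Face.mem (hE : ∀ e ∈ E, e.card = k) {σ : Finset (Fin n)} (h : Face E σ)
    (hc : k ≤ σ.card) : σ ∈ E := by
  obtain ⟨e, he, hs⟩ := h
  rwa [Finset.eq_of_subset_of_card_le hs (by rw [hE e he]; exact hc)]

theorem Face.exists_superset (hE : ∀ e ∈ E, e.card = k) {σ : Finset (Fin n)} (h : Face E σ)
    {j : ℕ} (hj : σ.card ≤ j) (hjk : j ≤ k) : ∃ τ, σ ⊆ τ ∧ τ.card = j ∧ Face E τ := by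
  obtain ⟨e, he, hs⟩ := h
  obtain ⟨τ, h1, h2, h3⟩ := Finset.exists_subsuperset_card_eq hs hj (by rw [hE e he]; exact hjk)
  exact ⟨τ, h1, h3, e, he, h2⟩

theorem good_of_codegree (hk : 3 ≤ k) (ht : 1 ≤ t) (hE : ∀ e ∈ E, e.card = k)
    (hv : ∀ v : Fin n, ∃ e ∈ E, v ∈ e)
    (hS : ∀ S : Finset (Fin n), S.card = k - 1 → (∃ e ∈ E, S ⊆ e) →
      (1 - 1 / (t : ℝ)) * (n : ℝ) - ((k : ℝ) - 3) ≤ ((E.filter fun e => S ⊆ e).card : ℝ)) :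
    Good k t E := by
  classical
  refine ⟨hE, fun v => ?_, fun σ hσ hσk => ?_⟩
  · obtain ⟨e, he, h⟩ := hv v
    exact ⟨e, he, by simpa using h⟩
  · obtain ⟨S, hσS, hSk, hSf⟩ := hσ.exists_superset hE (j := k - 1) (by omega) (by omega)
    have h1 := hS S hSk hSf
    have h2 : (miss E σ).card ≤ (miss E S).card := Finset.card_le_card (miss_mono hσS)
    have h3 : (E.filter fun e => S ⊆ e).card ≤
        (Finset.univ.filter fun v => v ∉ S ∧ Face E (insert v S)).card := by
      refine (Finset.card_le_card (t := (Finset.univ.filter fun v => v ∉ S ∧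
        Face E (insert v S)).image fun v => insert v S) ?_).trans Finset.card_image_le
      intro e he
      simp only [Finset.mem_filter, Finset.mem_image, Finset.mem_univ, true_and] at he ⊢
      obtain ⟨heE, hSe⟩ := he
      have : S.card < e.card := by rw [hE e heE, hSk]; omega
      obtain ⟨v, hve, hvS⟩ := Finset.exists_mem_notMem_of_card_lt_card this
      have hins : insert v S = e := Finset.eq_of_subset_of_card_le
        (Finset.insert_subset hve hSe) (by
          rw [Finset.card_insert_of_notMem hvS, hE e heE, hSk]; omega)
      exact ⟨v, ⟨hvS, by rw [hins]; exact ⟨e, heE, subset_rfl⟩⟩, hins⟩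
    have h4 : S.card + (Finset.univ.filter fun v => v ∉ S ∧ Face E (insert v S)).card
        + (miss E S).card ≤ n := by
      have hd1 : Disjoint S (Finset.univ.filter fun v => v ∉ S ∧ Face E (insert v S)) := by
        rw [Finset.disjoint_left]; intro v hv hv'; simp at hv'; exact hv'.1 hv
      have hd2 : Disjoint (S ∪ Finset.univ.filter fun v => v ∉ S ∧ Face E (insert v S))
          (miss E S) := by
        rw [Finset.disjoint_left]; intro v hv hv'
        rw [mem_miss] at hv'
        rcases Finset.mem_union.1 hv with hv | hv
        · rw [Finset.insert_eq_of_mem hv] at hv'; exact hv' hSf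
        · simp at hv; exact hv' hv.2
      rw [← Finset.card_union_of_disjoint hd1, ← Finset.card_union_of_disjoint hd2]
      exact (Finset.card_le_univ _).trans (by simp)
    have h5 : (k : ℝ) - 1 + ((E.filter fun e => S ⊆ e).card : ℝ) + ((miss E σ).card : ℝ) ≤ n := by
      have : (k - 1) + (E.filter fun e => S ⊆ e).card + (miss E σ).card ≤ n := by omega
      have h6 : ((k - 1 : ℕ) : ℝ) = k - 1 := by rw [Nat.cast_sub (by omega)]; simp
      rw [← h6]
      exact_mod_cast this
    have ht' : (0 : ℝ) < t := by exact_mod_cast ht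
    have h7 : ((miss E σ).card : ℝ) + 2 ≤ n / t := by
      have : (1 - 1 / (t : ℝ)) * (n : ℝ) = n - n / t := by ring
      linarith
    rw [le_div_iff₀ ht'] at h7
    have : (t : ℝ) * ((miss E σ).card + 2) ≤ n := by linarith
    exact_mod_cast this

theorem Good.face_empty (h : Good k t E) (hn : 0 < n) : Face E ∅ :=
  (h.face_singleton ⟨0, hn⟩).mono (by simp)

theorem Good.miss_le (h : Good k t E) (ht : 1 ≤ t) {σ : Finset (Fin n)} (hσ : Face E σ)
    (hk : σ.card < k) : ((miss E σ).card : ℝ) ≤ n / t - 2 := by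
  have h1 := h.card_miss σ hσ hk
  have ht' : (0 : ℝ) < t := by exact_mod_cast ht
  have h2 : (t : ℝ) * ((miss E σ).card + 2) ≤ n := by exact_mod_cast h1
  rw [le_sub_iff_add_le, le_div_iff₀ ht']
  linarith

/-- A list all of whose segments of length at most `k` are faces. -/
def FT (k : ℕ) (E : Finset (Finset (Fin n))) (l : List (Fin n)) : Prop :=
  ∀ w, w <:+: l → w.length ≤ k → Face E w.toFinset

/-- A list all of whose segments of length `k` starting at a multiple of `d` are edges. -/
def AW (d k : ℕ) (E : Finset (Finset (Fin n))) (l : List (Fin n)) : Prop :=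
  ∀ i, d ∣ i → i + k ≤ l.length → ((l.drop i).take k).toFinset ∈ E

/-- Every face of size less than `k` fails to be extended by at most `μ |W|` vertices of `W`. -/
def Rich (k : ℕ) (E : Finset (Finset (Fin n))) (W : Finset (Fin n)) (μ : ℝ) : Prop :=
  ∀ σ, Face E σ → σ.card < k → ((miss E σ ∩ W).card : ℝ) ≤ μ * W.card

theorem FT.of_isInfix {l l' : List (Fin n)} (h : FT k E l) (h' : l' <:+: l) : FT k E l' :=
  fun w hw hk => h w (hw.trans h') hk

theorem FT.left {a b : List (Fin n)} (h : FT k E (a ++ b)) : FT k E a :=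
  h.of_isInfix (List.prefix_append a b).isInfix

theorem FT.right {a b : List (Fin n)} (h : FT k E (a ++ b)) : FT k E b :=
  h.of_isInfix (List.suffix_append a b).isInfix

theorem FT.reverse {l : List (Fin n)} (h : FT k E l) : FT k E l.reverse := by
  intro w hw hk
  have := h w.reverse (by
    have := List.reverse_infix.2 hw
    simpa using this) (by simpa using hk)
  simpa using this

theorem FT.face {l : List (Fin n)} (h : FT k E l) (hk : l.length ≤ k) : Face E l.toFinset :=
  h l List.infix_rfl hk

theorem ft_iff {l : List (Fin n)} : FT k E l ↔ ∀ i, Face E ((l.drop i).take k).toFinset := by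
  constructor
  · intro h i
    exact h _ ((List.take_prefix _ _).isInfix.trans (List.drop_suffix _ _).isInfix)
      (by simp)
  · rintro h w ⟨a, b, rfl⟩ hk
    refine (h a.length).mono ?_
    intro v hv
    simp only [List.mem_toFinset] at *
    simp only [List.append_assoc, List.drop_left]
    rw [List.take_append]
    rw [List.take_of_length_le hk]
    simp [hv]

theorem face_ft {l : List (Fin n)} (h : Face E l.toFinset) : FT k E l := fun w hw _ =>
  h.mono fun v hv => by
    simp only [List.mem_toFinset] at *
    exact hw.subset hv

theorem FT.glue {a S b : List (Fin n)} (h1 : FT k E (a ++ S)) (h2 : FT k E (S ++ b))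
    (hS : k - 1 ≤ S.length) : FT k E (a ++ S ++ b) := by
  rw [ft_iff] at *
  intro i
  by_cases hi : a.length ≤ i
  · have := h2 (i - a.length)
    rw [List.append_assoc, List.drop_append, List.drop_of_length_le hi]
    simpa using this
  · have := h1 i
    rw [List.drop_append_of_le_length (by simp; omega), List.take_append_of_le_length (by simp; omega)]
    exact this

theorem AW.glue {a S b : List (Fin n)} (h1 : AW d k E (a ++ S)) (h2 : AW d k E (S ++ b))
    (hS : k - 1 ≤ S.length) (hd : d ∣ a.length) : AW d k E (a ++ S ++ b) := by
  intro i hdi hik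
  by_cases hi : a.length ≤ i
  · have := h2 (i - a.length) (Nat.dvd_sub hdi hd) (by simp at *; omega)
    rw [List.append_assoc, List.drop_append, List.drop_of_length_le hi]
    simpa using this
  · have := h1 i hdi (by simp at *; omega)
    rw [List.drop_append_of_le_length (by simp; omega), List.take_append_of_le_length (by simp; omega)]
    exact this

theorem FT.aw (hE : ∀ e ∈ E, e.card = k) {l : List (Fin n)} (h : FT k E l) (hn : l.Nodup) :
    AW d k E l := by
  intro i _ hik
  refine ((ft_iff.1 h) i).mem hE ?_
  have : ((l.drop i).take k).Nodup :=
    hn.sublist ((List.take_sublist _ _).trans (List.drop_sublist _ _))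
  rw [List.toFinset_card_of_nodup this]
  simp
  omega

theorem FT.snoc {l : List (Fin n)} {v : Fin n} (h : FT k E l) (hk : 1 ≤ k)
    (hv : v ∉ miss E (l.drop (l.length - (k - 1))).toFinset) : FT k E (l ++ [v]) := by
  have h2 : FT k E (l.drop (l.length - (k - 1)) ++ [v]) := by
    apply face_ft
    have := face_insert hv
    simpa [List.toFinset_append, Finset.union_comm] using this
  by_cases hl : k - 1 ≤ l.length
  · have h1 : FT k E (l.take (l.length - (k - 1)) ++ l.drop (l.length - (k - 1))) := by
      rwa [List.take_append_drop]
    have := h1.glue h2 (by simp; omega)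
    rwa [List.take_append_drop] at this
  · have : l.length - (k - 1) = 0 := by omega
    simpa [this] using h2

theorem FT.cons {l : List (Fin n)} {v : Fin n} (h : FT k E l) (hk : 1 ≤ k)
    (hv : v ∉ miss E (l.take (k - 1)).toFinset) : FT k E (v :: l) := by
  have h1 := h.reverse.snoc hk (v := v) (by
    rw [List.length_reverse, List.drop_reverse]
    by_cases hl : k - 1 ≤ l.length
    · have : l.length - (l.length - (k - 1)) = k - 1 := by omega
      simpa [this] using hv
    · have h3 : l.length - (l.length - (k - 1)) = l.length := by omega
      rw [List.take_of_length_le (by omega)] at hv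
      simpa [h3] using hv)
  simpa using h1.reverse

theorem card_rtake_lt (hk : 1 ≤ k) (l : List (Fin n)) :
    (l.drop (l.length - (k - 1))).toFinset.card < k := by
  have := List.toFinset_card_le (l.drop (l.length - (k - 1)))
  simp at this; omega

theorem card_take_lt (hk : 1 ≤ k) (l : List (Fin n)) :
    (l.take (k - 1)).toFinset.card < k := by
  have := List.toFinset_card_le (l.take (k - 1))
  simp at this; omega

theorem FT.face_rtake {l : List (Fin n)} (h : FT k E l) :
    Face E (l.drop (l.length - (k - 1))).toFinset :=
  h _ (List.drop_suffix _ _).isInfix (by simp; omega)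

theorem FT.face_take {l : List (Fin n)} (h : FT k E l) :
    Face E (l.take (k - 1)).toFinset :=
  h _ (List.take_prefix _ _).isInfix (by simp)

/-- Vertices of `W` avoiding up to two extension obstructions and a small list. -/
theorem Rich.exists_ext {W : Finset (Fin n)} {μ : ℝ} (h : Rich k E W μ) {σ τ : Finset (Fin n)}
    (hσ : Face E σ) (hσk : σ.card < k) (hτ : Face E τ) (hτk : τ.card < k) (l : List (Fin n))
    (q : ℝ) (hq : q + 2 * μ * W.card + l.length ≤ W.card) :
    ∃ T ⊆ W, q ≤ T.card ∧ ∀ v ∈ T, v ∉ miss E σ ∧ v ∉ miss E τ ∧ v ∉ l := by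
  classical
  refine ⟨W \ ((miss E σ ∩ W) ∪ (miss E τ ∩ W) ∪ l.toFinset), Finset.sdiff_subset, ?_, ?_⟩
  · have h1 := h σ hσ hσk
    have h2 := h τ hτ hτk
    have h3 : ((miss E σ ∩ W) ∪ (miss E τ ∩ W) ∪ l.toFinset).card ≤
        (miss E σ ∩ W).card + (miss E τ ∩ W).card + l.length :=
      (Finset.card_union_le _ _).trans (add_le_add (Finset.card_union_le _ _)
        (List.toFinset_card_le _))
    have h4 := Finset.le_card_sdiff ((miss E σ ∩ W) ∪ (miss E τ ∩ W) ∪ l.toFinset) W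
    have h5 : W.card ≤ (W \ ((miss E σ ∩ W) ∪ (miss E τ ∩ W) ∪ l.toFinset)).card +
      ((miss E σ ∩ W).card + (miss E τ ∩ W).card + l.length) := by omega
    have h6 : (W.card : ℝ) ≤ (W \ ((miss E σ ∩ W) ∪ (miss E τ ∩ W) ∪ l.toFinset)).card +
      ((miss E σ ∩ W).card + (miss E τ ∩ W).card + l.length) := by exact_mod_cast h5
    nlinarith
  · intro v hv
    simp only [Finset.mem_sdiff, Finset.mem_union, Finset.mem_inter, List.mem_toFinset] at hv
    tauto

end basics

section puzzle

theorem exists_star_word {m : ℕ} (ρ : Equiv.Perm (Fin (m + 1))) :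
    ∃ gs : List (Fin (m + 1)), (∀ g ∈ gs, g ≠ 0) ∧
      ρ = (gs.map fun g => Equiv.swap (0 : Fin (m + 1)) g).prod := by
  have hswap : ∀ x y : Fin (m + 1), x ≠ y → ∃ gs : List (Fin (m + 1)), (∀ g ∈ gs, g ≠ 0) ∧
      Equiv.swap x y = (gs.map fun g => Equiv.swap (0 : Fin (m + 1)) g).prod := by
    intro x y hxy
    by_cases hx : x = 0
    · subst hx
      exact ⟨[y], by simpa using hxy.symm, by simp⟩
    by_cases hy : y = 0
    · subst hy
      exact ⟨[x], by simpa using hx, by simp [Equiv.swap_comm]⟩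
    · refine ⟨[x, y, x], by simp [hx, hy], ?_⟩
      have := Equiv.swap_mul_swap_mul_swap (x := y) (y := 0) (z := x) hy (Ne.symm hxy)
      rw [Equiv.swap_comm y 0] at this
      simp only [List.map_cons, List.map_nil, List.prod_cons, List.prod_nil, mul_one, ← this,
        mul_assoc]
  induction ρ using Equiv.Perm.swap_induction_on with
  | one => exact ⟨[], by simp, by simp⟩
  | swap_mul f x y hxy ih =>
    obtain ⟨gs, h1, h2⟩ := ih
    obtain ⟨hs, h3, h4⟩ := hswap x y hxy
    refine ⟨hs ++ gs, ?_, by simp [← h2, ← h4]⟩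
    intro g hg
    rcases List.mem_append.1 hg with hg | hg
    · exact h3 g hg
    · exact h1 g hg


/-- A word over letters `0, …, m - 1` (to be kept) and fillers `m, m + 1, …` leading from the
letters in increasing order to the letters in decreasing order such that each window of length
`m + 1` uses distinct letters, all from one of the listed sets. -/
theorem exists_reversing_word (m d : ℕ) (hm : 1 ≤ m) (hd : 1 ≤ d) :
    ∃ (R len : ℕ) (i w : ℕ → ℕ), (∀ s < R, i s < m) ∧ d ∣ len ∧ 2 * m ≤ len ∧
      (∀ j < len, w j < m + 1 + R) ∧ (∀ j < m, w j = j) ∧ (∀ j < m, w (len - 1 - j) = j) ∧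
      ∀ j, j + (m + 1) ≤ len → Set.InjOn w (Set.Ico j (j + (m + 1))) ∧
        ((∃ s ≤ R, ∀ x ∈ Set.Ico j (j + (m + 1)), w x < m ∨ w x = m + s) ∨
         (∃ s < R, ∀ x ∈ Set.Ico j (j + (m + 1)), (w x < m ∧ w x ≠ i s) ∨ w x = m + s ∨
            w x = m + (s + 1))) := by
  obtain ⟨gs, hg0, hgs⟩ := exists_star_word (Equiv.subLeft (1 : Fin (m + 1)))
  set R := gs.length with hR
  let σ : ℕ → Equiv.Perm (Fin (m + 1)) := fun s =>
    ((gs.drop (R - s)).map fun g => Equiv.swap (0 : Fin (m + 1)) g).prod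
  have hg : ∃ g : ℕ → Fin (m + 1), ∀ s < R, g s ≠ 0 ∧ σ (s + 1) = Equiv.swap 0 (g s) * σ s := by
    refine ⟨fun s => gs.getD (R - (s + 1)) 0, fun s hs => ?_⟩
    have h1 : R - (s + 1) < gs.length := by omega
    simp only [List.getD_eq_getElem _ _ h1]
    refine ⟨hg0 _ (List.getElem_mem h1), ?_⟩
    simp only [σ]
    rw [List.drop_eq_getElem_cons h1, show R - (s + 1) + 1 = R - s by omega]
    simp
  obtain ⟨g, hg⟩ := hg
  have hσ0 : σ 0 = 1 := by
    simp only [σ, Nat.sub_zero, hR, List.drop_length, List.map_nil, List.prod_nil]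
  have hσR : σ R = Equiv.subLeft (1 : Fin (m + 1)) := by simp [σ, hgs]
  clear_value σ
  clear hgs hg0
  let L : Fin (m + 1) → ℕ → ℕ := fun lab s => if lab = 0 then m + s else lab.val - 1
  have hL0 : ∀ lab s, lab = 0 → L lab s = m + s := fun lab s h => by simp [L, h]
  have hL1 : ∀ lab s, lab ≠ 0 → L lab s = lab.val - 1 := fun lab s h => by simp [L, h]
  have hLm : ∀ (lab : Fin (m + 1)) (_ : ℕ), lab ≠ 0 → lab.val - 1 < m ∧ 1 ≤ lab.val := fun lab s h => by
    have : lab.val ≠ 0 := fun h' => h (Fin.ext h')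
    omega
  have hinj : ∀ s x y, L x s = L y s → x = y := by
    intro s x y h
    by_cases hx : x = 0 <;> by_cases hy : y = 0
    · rw [hx, hy]
    · rw [hL0 x s hx, hL1 y s hy] at h; have := hLm y s hy; omega
    · rw [hL0 y s hy, hL1 x s hx] at h; have := hLm x s hx; omega
    · rw [hL1 y s hy, hL1 x s hx] at h; have := hLm x s hx; have := hLm y s hy; ext; omega
  let tau : ℕ → Fin (m + 1) → ℕ := fun a x =>
    if a < 2 * R then (if a % 2 = 0 then L (σ (a / 2) x) (a / 2) else
      (if σ (a / 2) x = g (a / 2) then m + (a / 2 + 1) else L (σ (a / 2) x) (a / 2))) else L (σ R x) R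
  have tau_even : ∀ s ≤ R, ∀ x, tau (2 * s) x = L (σ s x) s := by
    intro s hs x
    simp only [tau]
    by_cases h1 : 2 * s < 2 * R
    · rw [if_pos h1, if_pos (by omega), show 2 * s / 2 = s by omega]
    · rw [if_neg h1, show s = R by omega]
  have tau_odd : ∀ s < R, ∀ x, tau (2 * s + 1) x =
      if σ s x = g s then m + (s + 1) else L (σ s x) s := by
    intro s hs x
    simp only [tau]
    rw [if_pos (by omega), if_neg (by omega), show (2 * s + 1) / 2 = s by omega]
  have tau_end : ∀ a, 2 * R ≤ a → ∀ x, tau a x = L (σ R x) R := by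
    intro a ha x
    simp only [tau]
    rw [if_neg (by omega)]
  clear_value tau
  have htau : ∀ a, Function.Injective (tau a) ∧
      ((∃ s ≤ R, ∀ x, tau a x < m ∨ tau a x = m + s) ∨
       (∃ s < R, ∀ x, (tau a x < m ∧ tau a x ≠ (g s).val - 1) ∨ tau a x = m + s ∨
          tau a x = m + (s + 1))) := by
    have key : ∀ s ≤ R, ∀ a, (∀ x, tau a x = L (σ s x) s) → Function.Injective (tau a) ∧
      ((∃ s ≤ R, ∀ x, tau a x < m ∨ tau a x = m + s) ∨
       (∃ s < R, ∀ x, (tau a x < m ∧ tau a x ≠ (g s).val - 1) ∨ tau a x = m + s ∨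
          tau a x = m + (s + 1))) := by
      intro s hs a ha
      refine ⟨fun x y h => ?_, Or.inl ⟨s, hs, fun x => ?_⟩⟩
      · rw [ha, ha] at h
        exact (σ s).injective (hinj _ _ _ h)
      · rw [ha]
        by_cases h : σ s x = 0
        · right; exact hL0 _ _ h
        · left; rw [hL1 _ _ h]; exact (hLm _ s h).1
    intro a
    by_cases ha : a < 2 * R
    · rcases Nat.even_or_odd' a with ⟨s, rfl | rfl⟩
      · exact key s (by omega) _ (tau_even s (by omega))
      · have hs : s < R := by omega
        have h0 := tau_odd s hs
        refine ⟨fun x y h => ?_, Or.inr ⟨s, hs, fun x => ?_⟩⟩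
        · rw [h0, h0] at h
          have hne : ∀ lab, L lab s ≠ m + (s + 1) := by
            intro lab
            by_cases hl : lab = 0
            · rw [hL0 _ _ hl]; omega
            · rw [hL1 _ _ hl]; have := hLm lab s hl; omega
          split_ifs at h with h1 h2 h2
          · exact (σ s).injective (h1.trans h2.symm)
          · exact absurd h.symm (hne _)
          · exact absurd h (hne _)
          · exact (σ s).injective (hinj _ _ _ h)
        · rw [h0]
          split_ifs with h1
          · right; right; rfl
          · by_cases hl : σ s x = 0
            · right; left; exact hL0 _ _ hl
            · left
              rw [hL1 _ _ hl]
              have := hLm _ s hl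
              have := hLm _ s (hg s hs).1
              refine ⟨by omega, fun h => h1 (Fin.ext ?_)⟩
              omega
    · exact key R le_rfl _ (tau_end a (by omega))
  have hstep : ∀ a, ∃ x₀, ∀ x ≠ x₀, tau (a + 1) x = tau a x := by
    intro a
    by_cases ha : a < 2 * R
    · rcases Nat.even_or_odd' a with ⟨s, rfl | rfl⟩
      · refine ⟨(σ s).symm (g s), fun x hx => ?_⟩
        rw [tau_odd s (by omega), tau_even s (by omega), if_neg]
        intro h
        exact hx (by rw [← h]; simp)
      · refine ⟨(σ s).symm 0, fun x hx => ?_⟩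
        have hs : s < R := by omega
        rw [tau_odd s hs, show 2 * s + 1 + 1 = 2 * (s + 1) by ring, tau_even (s + 1) (by omega),
          (hg s hs).2]
        have hx0 : σ s x ≠ 0 := fun h => hx (by rw [← h]; simp)
        simp only [Equiv.Perm.mul_apply]
        split_ifs with h
        · rw [h, Equiv.swap_apply_right, hL0 _ _ rfl]
        · rw [Equiv.swap_apply_of_ne_of_ne hx0 h, hL1 _ _ hx0, hL1 _ _ hx0]
    · exact ⟨0, fun x _ => by rw [tau_end _ (by omega), tau_end _ (by omega)]⟩
  have hmod : ∀ j, (j % (m + 1)) < m + 1 := fun j => Nat.mod_lt _ (by omega)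
  let w : ℕ → ℕ := fun j => tau ((j + 1) / (m + 1)) ⟨(j + 1) % (m + 1), hmod _⟩
  have hw : ∀ a b (hb : b < m + 1) j, j + 1 = (m + 1) * a + b → w j = tau a ⟨b, hb⟩ := by
    intro a b hb j hj
    simp only [w]
    have h1 : (j + 1) / (m + 1) = a := by
      rw [hj, Nat.mul_add_div (by omega), Nat.div_eq_of_lt hb]; rfl
    have h2 : (j + 1) % (m + 1) = b := by
      rw [hj, Nat.mul_add_mod, Nat.mod_eq_of_lt hb]
    congr 1
    ext
    exact h2
  refine ⟨R, (m + 1) * (d * (2 * R + 2)), fun s => (g s).val - 1, w, ?_, ?_, ?_, ?_, ?_, ?_, ?_⟩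
  · intro s hs
    exact (hLm _ s (hg s hs).1).1
  · exact ⟨(m + 1) * (2 * R + 2), by ring⟩
  · nlinarith [Nat.mul_le_mul hd (show 2 ≤ 2 * R + 2 by omega)]
  · intro j _
    rcases (htau ((j + 1) / (m + 1))).2 with ⟨s, hs, h⟩ | ⟨s, hs, h⟩
    · have := h ⟨(j + 1) % (m + 1), hmod _⟩
      simp only [w]
      omega
    · have := h ⟨(j + 1) % (m + 1), hmod _⟩
      simp only [w]
      omega
  · intro j hj
    rw [hw 0 (j + 1) (by omega) j (by simp)]
    have := tau_even 0 (by omega) ⟨j + 1, by omega⟩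
    simp only [mul_zero] at this
    rw [this, hσ0, hL1]
    · simp
    · simp [Fin.ext_iff]
  · intro j hj
    have hN : 2 * R + 2 ≤ d * (2 * R + 2) := Nat.le_mul_of_pos_left _ hd
    generalize d * (2 * R + 2) = N at hN
    obtain ⟨N, rfl⟩ : ∃ N', N = N' + 1 := ⟨N - 1, by omega⟩
    have h1m : ((1 : Fin (m + 1)) : ℕ) = 1 := by
      rw [Fin.val_one']; exact Nat.mod_eq_of_lt (by omega)
    by_cases hj0 : j = 0
    · rw [hw (N + 1) 0 (by omega) _ (by rw [mul_add]; omega), tau_end _ (by omega), hσR]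
      have : (Equiv.subLeft (1 : Fin (m + 1))) ⟨0, by omega⟩ = 1 := by
        simp [Equiv.subLeft]
      rw [this, hL1, h1m]
      · omega
      · intro h; have := congrArg Fin.val h; rw [h1m] at this; simp at this
    · rw [hw N (m + 1 - j) (by omega) _ (by rw [mul_add]; omega), tau_end _ (by omega), hσR]
      have : ((Equiv.subLeft (1 : Fin (m + 1))) ⟨m + 1 - j, by omega⟩ : Fin (m + 1)).val = j + 1 := by
        rw [Equiv.subLeft_apply, Fin.val_sub, h1m]
        rw [show m + 1 - (m + 1 - j) + 1 = j + 1 by omega]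
        exact Nat.mod_eq_of_lt (by omega)
      rw [hL1, this]
      · omega
      · intro h; rw [h] at this; simp at this
  · intro j hj
    set a := (j + 1) / (m + 1) with ha
    set b := (j + 1) % (m + 1) with hb
    have hbm : b < m + 1 := hmod _
    have hab : j + 1 = (m + 1) * a + b := (Nat.div_add_mod _ _).symm
    have hx : ∀ x ∈ Set.Ico j (j + (m + 1)), ∃ c, ∃ hc : c < m + 1,
        (b ≤ c ∧ x = j + (c - b) ∧ w x = tau a ⟨c, hc⟩) ∨
        (c < b ∧ x = j + (m + 1 + c - b) ∧ w x = tau (a + 1) ⟨c, hc⟩) := by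
      intro x hx
      simp only [Set.mem_Ico] at hx
      by_cases h : b + (x - j) < m + 1
      · refine ⟨b + (x - j), h, Or.inl ⟨by omega, by omega, hw _ _ _ _ (by omega)⟩⟩
      · refine ⟨b + (x - j) - (m + 1), by omega, Or.inr ⟨by omega, by omega, hw _ _ _ _ ?_⟩⟩
        rw [mul_add]
        omega
    obtain ⟨x₀, hx₀⟩ := hstep a
    obtain ⟨a', ha'⟩ : ∃ a', ∀ x ∈ Set.Ico j (j + (m + 1)), ∃ c, ∃ hc : c < m + 1,
        (x + b = j + c ∨ x + b = j + (m + 1 + c)) ∧ w x = tau a' ⟨c, hc⟩ := by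
      by_cases hxb : b ≤ x₀.val
      · refine ⟨a, fun x hxI => ?_⟩
        obtain ⟨c, hc, h | h⟩ := hx x hxI
        · exact ⟨c, hc, by omega, h.2.2⟩
        · refine ⟨c, hc, by omega, h.2.2.trans (hx₀ _ ?_)⟩
          intro h'
          rw [← h'] at hxb
          simp at hxb
          omega
      · refine ⟨a + 1, fun x hxI => ?_⟩
        obtain ⟨c, hc, h | h⟩ := hx x hxI
        · refine ⟨c, hc, by omega, h.2.2.trans (hx₀ _ ?_).symm⟩
          intro h'
          rw [← h'] at hxb
          simp at hxb
          omega
        · exact ⟨c, hc, by omega, h.2.2⟩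
    refine ⟨fun x hxI y hyI hxy => ?_, ?_⟩
    · obtain ⟨c, hc, h1, h2⟩ := ha' x hxI
      obtain ⟨c', hc', h1', h2'⟩ := ha' y hyI
      rw [h2, h2'] at hxy
      have := congrArg Fin.val ((htau a').1 hxy)
      simp only [Set.mem_Ico] at hxI hyI this
      omega
    · rcases (htau a').2 with ⟨s, hs, h⟩ | ⟨s, hs, h⟩
      · refine Or.inl ⟨s, hs, fun x hxI => ?_⟩
        obtain ⟨c, hc, h1, h2⟩ := ha' x hxI
        rw [h2]
        exact h _
      · refine Or.inr ⟨s, hs, fun x hxI => ?_⟩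
        obtain ⟨c, hc, h1, h2⟩ := ha' x hxI
        rw [h2]
        exact h _

end puzzle

section connector
variable {n : ℕ} {E : Finset (Finset (Fin n))} {k : ℕ}

theorem ft_map_range {len : ℕ} {p : ℕ → Fin n} (hlen : k ≤ len)
    (h : ∀ j, j + k ≤ len → Face E ((Finset.Ico j (j + k)).image p)) :
    FT k E ((List.range len).map p) := by
  rw [ft_iff]
  intro i
  refine (h (min i (len - k)) (by omega)).mono ?_
  intro v hv
  simp only [List.mem_toFinset, ← List.map_drop, ← List.map_take, List.mem_map] at hv
  obtain ⟨x, hx, rfl⟩ := hv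
  refine Finset.mem_image_of_mem _ ?_
  rw [List.mem_iff_getElem] at hx
  obtain ⟨j, hj, hx⟩ := hx
  simp at hj hx
  simp only [Finset.mem_Ico]
  omega

/-- Admissible tuples of letters for a connector between `S` and `Z`. -/
structure ConnTuple (k : ℕ) (E : Finset (Finset (Fin n))) (S Z : List (Fin n)) (R : ℕ) (i : ℕ → ℕ)
    (y : List (Fin n)) : Prop where
  nodup : y.Nodup
  left : FT k E (S ++ y.take (k - 1))
  right : FT k E ((y.take (k - 1)).reverse ++ Z)
  one : ∀ s v, y[k - 1 + s]? = some v → Face E (insert v (y.take (k - 1)).toFinset)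
  two : ∀ s < R, ∀ v v', y[k - 1 + s]? = some v → y[k - 1 + (s + 1)]? = some v' →
    Face E (insert v' (insert v ((y.take (k - 1)).eraseIdx (i s)).toFinset))

theorem ConnTuple.exists_ext (hk : 2 ≤ k) {S Z : List (Fin n)} {R : ℕ} {i : ℕ → ℕ}
    (hi : ∀ s < R, i s < k - 1) {W : Finset (Fin n)} (hW : Rich k E W (2 / 5))
    (hWc : 10 * (k + R) ≤ W.card) {y : List (Fin n)} (hyl : y.length < k + R)
    (hy : ConnTuple k E S Z R i y) :
    ∃ T ⊆ W, (1 / 10 : ℝ) * W.card ≤ T.card ∧ ∀ v ∈ T, ConnTuple k E S Z R i (y ++ [v]) := by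
  have hq : (1 / 10 : ℝ) * W.card + 2 * (2 / 5) * W.card + y.length ≤ W.card := by
    have h1 : (y.length : ℝ) ≤ k + R := by exact_mod_cast hyl.le
    have h2 : 10 * ((k : ℝ) + R) ≤ W.card := by exact_mod_cast hWc
    linarith
  have hnd : ∀ v, v ∉ y → (y ++ [v]).Nodup := fun v hv => by
    rw [List.nodup_append]
    refine ⟨hy.nodup, by simp, ?_⟩
    intro a ha b hb
    simp only [List.mem_singleton] at hb
    rintro rfl
    exact hv (hb ▸ ha)
  by_cases hm : y.length < k - 1
  · have ht : y.take (k - 1) = y := List.take_of_length_le hm.le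
    have h1 := hy.left
    have h2 := hy.right
    rw [ht] at h1 h2
    obtain ⟨T, hTW, hTc, hT⟩ := hW.exists_ext h1.face_rtake (card_rtake_lt (by omega) _)
      h2.face_take (card_take_lt (by omega) _) y _ hq
    refine ⟨T, hTW, hTc, fun v hv => ?_⟩
    obtain ⟨hv1, hv2, hv3⟩ := hT v hv
    have ht' : (y ++ [v]).take (k - 1) = y ++ [v] := List.take_of_length_le (by simp; omega)
    refine ⟨hnd v hv3, ?_, ?_, ?_, ?_⟩
    · rw [ht', ← List.append_assoc]
      exact h1.snoc (by omega) hv1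
    · rw [ht']
      simpa using h2.cons (by omega) hv2
    · intro s v' h
      rw [List.getElem?_eq_none (by simp; omega)] at h
      simp at h
    · intro s hs v' v'' h
      rw [List.getElem?_eq_none (by simp; omega)] at h
      simp at h
  · have hm' : k - 1 ≤ y.length := by omega
    have ht : ∀ v, (y ++ [v]).take (k - 1) = y.take (k - 1) := fun v =>
      List.take_append_of_le_length hm'
    have hσ : Face E (y.take (k - 1)).toFinset := hy.left.right.face (by simp)
    have hσk : (y.take (k - 1)).toFinset.card < k := card_take_lt (by omega) _
    obtain ⟨τ, hτ, hτk, hτe⟩ : ∃ τ, Face E τ ∧ τ.card < k ∧ ∀ s v, s < R → k - 1 + (s + 1) = y.length →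
        y[k - 1 + s]? = some v →
        τ = insert v ((y.take (k - 1)).eraseIdx (i s)).toFinset := by
      by_cases hl : ∃ s < R, k - 1 + (s + 1) = y.length
      · obtain ⟨s, hs, hsl⟩ := hl
        have hlt : k - 1 + s < y.length := by omega
        refine ⟨insert (y[k - 1 + s]) ((y.take (k - 1)).eraseIdx (i s)).toFinset, ?_, ?_, ?_⟩
        · refine (hy.one s _ (List.getElem?_eq_getElem hlt)).mono ?_
          refine Finset.insert_subset_insert _ fun x hx => ?_
          simp only [List.mem_toFinset] at *
          exact List.mem_of_mem_eraseIdx hx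
        · refine (Finset.card_insert_le _ _).trans_lt ?_
          have h1 := List.toFinset_card_le ((y.take (k - 1)).eraseIdx (i s))
          rw [List.length_eraseIdx_of_lt (by have := hi s hs; simp; omega)] at h1
          simp at h1
          omega
        · intro s' v _ hs' hv
          have : s' = s := by omega
          subst this
          rw [List.getElem?_eq_getElem hlt] at hv
          simp only [Option.some.injEq] at hv
          rw [hv]
      · exact ⟨_, hσ, hσk, fun s v h1 h2 => absurd ⟨s, h1, h2⟩ hl⟩
    obtain ⟨T, hTW, hTc, hT⟩ := hW.exists_ext hσ hσk hτ hτk y _ hq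
    refine ⟨T, hTW, hTc, fun v hv => ?_⟩
    obtain ⟨hv1, hv2, hv3⟩ := hT v hv
    have hlast : ∀ j x, (y ++ [v])[j]? = some x → y[j]? = some x ∨ (j = y.length ∧ x = v) := by
      intro j x h
      rcases lt_trichotomy j y.length with hj | hj | hj
      · left; rwa [List.getElem?_append_left hj] at h
      · right
        subst hj
        simp at h
        exact ⟨rfl, h.symm⟩
      · rw [List.getElem?_eq_none (by simp; omega)] at h
        simp at h
    refine ⟨hnd v hv3, ?_, ?_, ?_, ?_⟩
    · rw [ht]; exact hy.left
    · rw [ht]; exact hy.right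
    · intro s x hx
      rw [ht]
      rcases hlast _ _ hx with h | ⟨h, rfl⟩
      · exact hy.one s x h
      · exact face_insert hv1
    · intro s hs x x' hx hx'
      rw [ht]
      have hx1 : y[k - 1 + s]? = some x := by
        rcases hlast _ _ hx with h | ⟨h, rfl⟩
        · exact h
        · rw [List.getElem?_eq_none (by simp; omega)] at hx'
          simp at hx'
      rcases hlast _ _ hx' with h | ⟨h, rfl⟩
      · exact hy.two s hs x x' hx1 h
      · rw [← hτe s x hs h hx1]
        exact face_insert hv2

/-- Any two ordered faces of size `k - 1` are joined by a tight path of fixed length inside a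
rich set. -/
theorem exists_connector (k d : ℕ) (hk : 2 ≤ k) (hd : 1 ≤ d) : ∃ Lc s₀ : ℕ, d ∣ Lc ∧
    2 * (k - 1) ≤ Lc ∧ ∀ (n : ℕ) (E : Finset (Finset (Fin n))) (W : Finset (Fin n)), s₀ ≤ W.card →
      Rich k E W (2 / 5) → ∀ S Z : List (Fin n), S.length = k - 1 → Z.length = k - 1 →
      Face E S.toFinset → Face E Z.toFinset →
      ∃ C : List (Fin n), C.Nodup ∧ (∀ v ∈ C, v ∈ W) ∧ C.length = Lc ∧ FT k E (S ++ C ++ Z) := by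
  obtain ⟨R, len, i, w, hi, hdl, hlen, hw, hw1, hw2, hwin⟩ :=
    exists_reversing_word (k - 1) d (by omega) hd
  rw [show k - 1 + 1 = k by omega] at *
  obtain ⟨s₁, hs₁⟩ := exists_word (k + R) len w hw ((1 / 10) ^ (k + R)) (by positivity)
  refine ⟨len, max s₁ (10 * (k + R)), hdl, hlen, fun n E W hW hR S Z hS hZ hSf hZf => ?_⟩
  have hdens : (1 / 10 : ℝ) ^ (k + R) * (W.card : ℝ) ^ (k + R) ≤
      isum W (k + R) (ind (ConnTuple k E S Z R i)) := by
    have h0 : ConnTuple k E S Z R i [] := by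
      refine ⟨by simp, ?_, ?_, ?_, ?_⟩
      · simpa using face_ft hSf
      · simpa using face_ft hZf
      · simp
      · simp
    have := pow_le_isum_ind (W := W) (P := ConnTuple k E S Z R i) (q := 1 / 10 * W.card)
      (by positivity) (k + R) (fun l hl _ hP => ConnTuple.exists_ext hk hi hR (by omega) hl hP)
      (k + R) [] (by simp) (by simp) h0
    rw [mul_pow] at this
    simpa using this
  obtain ⟨p, hpW, hpinj, hp⟩ := hs₁ n W (by omega) _ (fun l h => h.nodup) hdens
  set C := (List.range len).map p with hC
  have hCl : C.length = len := by simp [hC]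
  have hFT : FT k E C := by
    refine ft_map_range (by omega) fun j hj => ?_
    obtain ⟨hinj, hsets⟩ := hwin j hj
    obtain ⟨y, hyl, hy, hyW, hyJ⟩ := hp (Finset.Ico j (j + k)) (fun x hx => by
      simp only [Finset.mem_Ico] at hx; omega) (by simpa using hinj)
    have hmem : ∀ x ∈ Finset.Ico j (j + k), w x < k - 1 → p x ∈ y.take (k - 1) := by
      intro x hx hwx
      rw [List.mem_iff_getElem?]
      exact ⟨w x, by rw [List.getElem?_take_of_lt hwx]; exact hyJ x hx⟩
    rcases hsets with ⟨s, hs, h⟩ | ⟨s, hs, h⟩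
    · have hlt : k - 1 + s < y.length := by omega
      refine (hy.one s _ (List.getElem?_eq_getElem hlt)).mono ?_
      intro v hv
      obtain ⟨x, hx, rfl⟩ := Finset.mem_image.1 hv
      simp only [Finset.mem_insert, List.mem_toFinset]
      rcases h x (by simpa using hx) with h | h
      · exact Or.inr (hmem x hx h)
      · left
        have := hyJ x hx
        rw [h, List.getElem?_eq_getElem hlt] at this
        simpa using this.symm
    · have hlt : k - 1 + s < y.length := by omega
      have hlt' : k - 1 + (s + 1) < y.length := by omega
      refine (hy.two s hs _ _ (List.getElem?_eq_getElem hlt)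
        (List.getElem?_eq_getElem hlt')).mono ?_
      intro v hv
      obtain ⟨x, hx, rfl⟩ := Finset.mem_image.1 hv
      simp only [Finset.mem_insert, List.mem_toFinset]
      rcases h x (by simpa using hx) with h | h | h
      · right; right
        rw [List.mem_eraseIdx_iff_getElem?]
        exact ⟨w x, h.2, by rw [List.getElem?_take_of_lt h.1]; exact hyJ x hx⟩
      · right; left
        have := hyJ x hx
        rw [h, List.getElem?_eq_getElem hlt] at this
        simpa using this.symm
      · left
        have := hyJ x hx
        rw [h, List.getElem?_eq_getElem hlt'] at this
        simpa using this.symm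
  have hleft : FT k E (S ++ C.take (k - 1)) := by
    obtain ⟨y, hyl, hy, hyW, hyJ⟩ := hp (Finset.range (k - 1)) (fun x hx => by
      simp only [Finset.mem_range] at hx; omega) (fun a ha b hb h => by
        simp only [Finset.coe_range, Set.mem_Iio] at ha hb
        rwa [hw1 a ha, hw1 b hb] at h)
    have : C.take (k - 1) = y.take (k - 1) := by
      apply List.ext_getElem?
      intro j
      by_cases hj : j < k - 1
      · rw [List.getElem?_take_of_lt hj, List.getElem?_take_of_lt hj]
        have := hyJ j (by simpa using hj)
        rw [hw1 j hj] at this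
        rw [this]
        simp [hC, show j < len by omega]
      · rw [List.getElem?_eq_none (by simp; omega), List.getElem?_eq_none (by simp; omega)]
    rw [this]
    exact hy.left
  have hright : FT k E (C.drop (len - (k - 1)) ++ Z) := by
    obtain ⟨y, hyl, hy, hyW, hyJ⟩ := hp (Finset.Ico (len - (k - 1)) len) (fun x hx => by
      simp only [Finset.mem_Ico] at hx; omega) (fun a ha b hb h => by
        simp only [Finset.coe_Ico, Set.mem_Ico] at ha hb
        have h1 := hw2 (len - 1 - a) (by omega)
        have h2 := hw2 (len - 1 - b) (by omega)
        rw [show len - 1 - (len - 1 - a) = a by omega] at h1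
        rw [show len - 1 - (len - 1 - b) = b by omega] at h2
        omega)
    have : C.drop (len - (k - 1)) = (y.take (k - 1)).reverse := by
      apply List.ext_getElem?
      intro j
      by_cases hj : j < k - 1
      · rw [List.getElem?_reverse (by simp; omega), List.getElem?_take_of_lt (by simp; omega)]
        have := hyJ (len - (k - 1) + j) (by simp; omega)
        have h2 := hw2 (k - 1 - 1 - j) (by omega)
        rw [show len - 1 - (k - 1 - 1 - j) = len - (k - 1) + j by omega] at h2
        rw [h2] at this
        have h3 : (y.take (k - 1)).length - 1 - j = k - 1 - 1 - j := by
          simp only [List.length_take]; omega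
        rw [h3, this]
        simp [hC, show len - (k - 1) + j < len by omega]
      · rw [List.getElem?_eq_none (by simp; omega), List.getElem?_eq_none (by simp; omega)]
    rw [this]
    exact hy.right
  refine ⟨C, ?_, ?_, hCl, ?_⟩
  · rw [hC]
    refine List.Nodup.map_on ?_ List.nodup_range
    intro a ha b hb h
    exact hpinj (by simpa using ha) (by simpa using hb) h
  · intro v hv
    obtain ⟨j, hj, rfl⟩ := List.mem_map.1 hv
    exact hpW j (by simpa using hj)
  · have h1 := hleft.glue (b := C.drop (k - 1)) (by rwa [List.take_append_drop]) (by simp; omega)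
    rw [List.append_assoc, List.take_append_drop] at h1
    have h2 := FT.glue (a := S ++ C.take (len - (k - 1))) (by
      rwa [List.append_assoc, List.take_append_drop]) hright (by simp; omega)
    rwa [List.append_assoc S, List.take_append_drop] at h2

end connector

section absorb
variable {n : ℕ} {E : Finset (Finset (Fin n))} {k t : ℕ}

theorem Good.rich (h : Good k t E) (ht : 3 ≤ t) {W : Finset (Fin n)}
    (hW : 5 * n ≤ 6 * W.card) : Rich k E W (2 / 5) := by
  intro σ hσ hk
  have h1 := h.card_miss σ hσ hk
  have h2 : (miss E σ ∩ W).card ≤ (miss E σ).card := Finset.card_le_card Finset.inter_subset_left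
  have h3 : 3 * ((miss E σ ∩ W).card + 2) ≤ n :=
    (Nat.mul_le_mul ht (by omega)).trans h1
  have h4 : (3 * ((miss E σ ∩ W).card + 2) : ℝ) ≤ n := by exact_mod_cast h3
  have h5 : (5 * n : ℝ) ≤ 6 * W.card := by exact_mod_cast hW
  linarith

/-- `y` lists the right part, then the reversed left part, of a tight path avoiding `P` into the
middle of which `u` can be inserted. -/
structure InsTuple (k : ℕ) (E : Finset (Finset (Fin n))) (P : Finset (Fin n)) (u : Fin n)
    (y : List (Fin n)) : Prop where
  nodup : y.Nodup
  notMem : u ∉ y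
  avoid : ∀ v ∈ y, v ∉ P
  ft : FT k E ((y.drop (k - 1)).reverse ++ y.take (k - 1))
  ft_ins : FT k E ((y.drop (k - 1)).reverse ++ [u] ++ y.take (k - 1))

theorem InsTuple.exists_ext (hk : 2 ≤ k) {P : Finset (Fin n)} {u : Fin n}
    (hR : Rich k E (Finset.univ \ P) (2 / 5)) (hP : 10 * (2 * k) ≤ (Finset.univ \ P).card)
    {y : List (Fin n)} (hyl : y.length < 2 * (k - 1)) (hy : InsTuple k E P u y) :
    ∃ T : Finset (Fin n), T ⊆ Finset.univ \ P ∧ (1 / 10 : ℝ) * (Finset.univ \ P).card ≤ T.card ∧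
      ∀ v ∈ T, InsTuple k E P u (y ++ [v]) := by
  set W := Finset.univ \ P with hWdef
  have hq : (1 / 10 : ℝ) * W.card + 2 * (2 / 5) * W.card + (u :: y).length ≤ W.card := by
    have h1 : ((u :: y).length : ℝ) ≤ 2 * k := by
      have : (u :: y).length ≤ 2 * k := by simp; omega
      exact_mod_cast this
    have h2 : 10 * (2 * (k : ℝ)) ≤ W.card := by exact_mod_cast hP
    linarith
  have hnd : ∀ v, v ∉ u :: y → (y ++ [v]).Nodup ∧ u ∉ y ++ [v] := fun v hv => by
    simp only [List.mem_cons, not_or] at hv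
    constructor
    · rw [List.nodup_append]
      refine ⟨hy.nodup, by simp, ?_⟩
      intro a ha b hb
      simp only [List.mem_singleton] at hb
      rintro rfl
      exact hv.2 (hb ▸ ha)
    · simp only [List.mem_append, List.mem_singleton, not_or]
      exact ⟨hy.notMem, fun h => hv.1 h.symm⟩
  have hav : ∀ v ∈ W, ∀ x ∈ y ++ [v], x ∉ P := by
    intro v hv x hx
    rcases List.mem_append.1 hx with hx | hx
    · exact hy.avoid x hx
    · rw [List.mem_singleton.1 hx]; simpa [W] using hv
  by_cases hm : y.length < k - 1
  · have ht : y.take (k - 1) = y := List.take_of_length_le hm.le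
    have hdr : y.drop (k - 1) = [] := List.drop_of_length_le hm.le
    have h1 := hy.ft
    have h2 := hy.ft_ins
    rw [ht, hdr] at h1 h2
    obtain ⟨T, hTW, hTc, hT⟩ := hR.exists_ext h1.face_rtake (card_rtake_lt (by omega) _)
      h2.face_rtake (card_rtake_lt (by omega) _) (u :: y) _ hq
    refine ⟨T, hTW, hTc, fun v hv => ?_⟩
    obtain ⟨hv1, hv2, hv3⟩ := hT v hv
    have ht' : (y ++ [v]).take (k - 1) = y ++ [v] := List.take_of_length_le (by simp; omega)
    have hdr' : (y ++ [v]).drop (k - 1) = [] := List.drop_of_length_le (by simp; omega)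
    refine ⟨(hnd v hv3).1, (hnd v hv3).2, hav v (hTW hv), ?_, ?_⟩
    · rw [ht', hdr']
      simpa using h1.snoc (by omega) hv1
    · rw [ht', hdr']
      simpa using h2.snoc (by omega) hv2
  · have hm' : k - 1 ≤ y.length := by omega
    have h1 := hy.ft
    have h2 := hy.ft_ins
    obtain ⟨T, hTW, hTc, hT⟩ := hR.exists_ext h1.face_take (card_take_lt (by omega) _)
      h2.face_take (card_take_lt (by omega) _) (u :: y) _ hq
    refine ⟨T, hTW, hTc, fun v hv => ?_⟩
    obtain ⟨hv1, hv2, hv3⟩ := hT v hv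
    refine ⟨(hnd v hv3).1, (hnd v hv3).2, hav v (hTW hv), ?_, ?_⟩
    · rw [List.take_append_of_le_length hm', List.drop_append_of_le_length hm']
      simpa using h1.cons (by omega) hv1
    · rw [List.take_append_of_le_length hm', List.drop_append_of_le_length hm']
      simpa using h2.cons (by omega) hv2

theorem InsTuple.dense (hk : 2 ≤ k) (hG : Good k t E) {P : Finset (Fin n)}
    (hR : Rich k E (Finset.univ \ P) (2 / 5)) (hP : 10 * (2 * k) ≤ (Finset.univ \ P).card)
    (u : Fin n) : (1 / 20 : ℝ) ^ (2 * (k - 1)) * ((Finset.univ \ P).card : ℝ) ^ (2 * (k - 1)) ≤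
      isum (Finset.univ \ P) (2 * (k - 1)) (ind (InsTuple k E P u)) := by
  have h0 : InsTuple k E P u [] := by
    refine ⟨by simp, by simp, by simp, ?_, ?_⟩
    · simpa using face_ft (hG.face_empty u.pos)
    · simpa using face_ft (l := [u]) (by simpa using hG.face_singleton u)
  have := pow_le_isum_ind (W := Finset.univ \ P) (P := InsTuple k E P u)
    (q := 1 / 10 * (Finset.univ \ P).card)
    (by positivity) (2 * (k - 1)) (fun l hl _ hl' => InsTuple.exists_ext hk hR hP hl hl')
    (2 * (k - 1)) [] (by simp) (by simp) h0
  rw [mul_pow] at this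
  simp only [List.nil_append] at this
  refine le_trans ?_ this
  gcongr
  norm_num

/-- A tight path on `P` from `S` to `Z` which can absorb every set `U` with `|U| ≤ cnt u` for
all `u ∈ U`. -/
structure AbsorbsUpTo (k : ℕ) (E : Finset (Finset (Fin n))) (S Z : List (Fin n)) (P : Finset (Fin n))
    (cnt : Fin n → ℕ) : Prop where
  left_length : S.length = k - 1
  right_length : Z.length = k - 1
  absorb : ∀ U : Finset (Fin n), Disjoint U P → (∀ u ∈ U, U.card ≤ cnt u) →
    ∃ mid : List (Fin n), FT k E (S ++ mid ++ Z) ∧ (S ++ mid ++ Z).Nodup ∧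
      (S ++ mid ++ Z).toFinset = P ∪ U

set_option maxHeartbeats 1000000 in
theorem AbsorbsUpTo.step (hk : 2 ≤ k) {Lc s₀ : ℕ}
    (hconn : ∀ W : Finset (Fin n), s₀ ≤ W.card →
      Rich k E W (2 / 5) → ∀ S Z : List (Fin n), S.length = k - 1 → Z.length = k - 1 →
      Face E S.toFinset → Face E Z.toFinset →
      ∃ C : List (Fin n), C.Nodup ∧ (∀ v ∈ C, v ∈ W) ∧ C.length = Lc ∧ FT k E (S ++ C ++ Z))
    (ht : 3 ≤ t) (hG : Good k t E) {S Z : List (Fin n)} {P : Finset (Fin n)} {cnt : Fin n → ℕ}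
    (hA : AbsorbsUpTo k E S Z P cnt) (hP : 6 * (P.card + 2 * k) ≤ n) (hn : 300 * (k + s₀) ≤ n) :
    ∃ Z' P' cnt', AbsorbsUpTo k E S Z' P' cnt' ∧ P'.card ≤ P.card + Lc + 2 * k ∧
      ∑ u, (1 / 2 : ℝ) ^ cnt' u ≤ (1 - 1 / 2 * (1 / 20) ^ (2 * (k - 1))) * ∑ u, (1 / 2 : ℝ) ^ cnt u := by
  classical
  have hW0 : (Finset.univ \ P).card = n - P.card := by
    rw [Finset.card_sdiff_of_subset (Finset.subset_univ _)]; simp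
  have hR := hG.rich ht (W := Finset.univ \ P) (by omega)
  set M := 2 * (k - 1) with hM
  set W := Finset.univ \ P with hW
  have hWc : 10 * (2 * k) ≤ W.card := by omega
  have hdens : ∀ u, (1 / 20 : ℝ) ^ M * (W.card : ℝ) ^ M * 1 ≤ isum W M (ind (InsTuple k E P u)) :=
    fun u => by rw [mul_one]; exact InsTuple.dense hk hG hR hWc u
  have hWpos : (0 : ℝ) < (W.card : ℝ) ^ M := by
    have : (0 : ℝ) < W.card := by exact_mod_cast (by omega : 0 < W.card)
    positivity
  set Φ : ℝ := ∑ u, (1 / 2 : ℝ) ^ cnt u with hΦ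
  have hΦpos : 0 < Φ := by
    have : Nonempty (Fin n) := ⟨⟨0, by omega⟩⟩
    exact Finset.sum_pos (fun u _ => by positivity) Finset.univ_nonempty
  obtain ⟨y, hyl, hyW, hy⟩ : ∃ y : List (Fin n), y.length = M ∧ (∀ v ∈ y, v ∈ W) ∧
      (1 / 20 : ℝ) ^ M * Φ ≤ ∑ u, (1 / 2 : ℝ) ^ cnt u * ind (InsTuple k E P u) y := by
    apply exists_ge_of_isum (Finset.card_pos.1 (by omega))
    rw [isum_sum]
    calc (1 / 20 : ℝ) ^ M * Φ * (W.card : ℝ) ^ M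
        = ∑ u, (1 / 2 : ℝ) ^ cnt u * ((1 / 20 : ℝ) ^ M * (W.card : ℝ) ^ M * 1) := by
          rw [← Finset.sum_mul]; ring
      _ ≤ ∑ u, (1 / 2 : ℝ) ^ cnt u * isum W M (ind (InsTuple k E P u)) := by
          gcongr with u
          exact hdens u
      _ = _ := Finset.sum_congr rfl fun u _ => (isum_mul _ _ _).symm
  have hex : ∃ u, InsTuple k E P u y := by
    by_contra! hcon
    have : ∑ u, (1 / 2 : ℝ) ^ cnt u * ind (InsTuple k E P u) y = 0 :=
      Finset.sum_eq_zero fun u _ => by rw [ind_of_not (hcon u), mul_zero]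
    rw [this] at hy
    have : 0 < (1 / 20 : ℝ) ^ M * Φ := by positivity
    linarith
  obtain ⟨u₁, hu₁⟩ := hex
  set R := y.take (k - 1) with hRdef
  set L := (y.drop (k - 1)).reverse with hLdef
  have hRl : R.length = k - 1 := by simp [R]; omega
  have hLl : L.length = k - 1 := by simp [L]; omega
  have hLR : ∀ v, v ∈ y ↔ v ∈ L ∨ v ∈ R := by
    intro v
    conv_lhs => rw [← List.take_append_drop (k - 1) y]
    simp only [L, R, List.mem_append, List.mem_reverse, or_comm]
  obtain ⟨mid₀, hmid1, hmid2, hmid3⟩ := hA.absorb ∅ (by simp) (by simp)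
  have hZf : Face E Z.toFinset := hmid1.right.face (by rw [hA.right_length]; omega)
  have hyc : y.toFinset.card ≤ M := hyl ▸ List.toFinset_card_le y
  have hW'c : (W \ y.toFinset).card + M ≥ n - P.card := by
    have := Finset.le_card_sdiff y.toFinset W
    omega
  obtain ⟨C, hC1, hC2, hC3, hC4⟩ := hconn (W \ y.toFinset) (by omega) (hG.rich ht (by omega)) Z L
    hA.right_length hLl hZf (hu₁.ft.left.face (by rw [← hLdef, hLl]; omega))
  have hC2' : ∀ v ∈ C, v ∉ P ∧ v ∉ y := fun v hv => by
    have := hC2 v hv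
    simpa [W] using this
  refine ⟨R, P ∪ C.toFinset ∪ y.toFinset, fun u => cnt u + if InsTuple k E P u y then 1 else 0,
    ⟨hA.left_length, hRl, ?_⟩, ?_, ?_⟩
  · intro U hU hUc
    have hUP : Disjoint U P := hU.mono_right (by
      intro x hx; simp [hx])
    have hUC : ∀ u ∈ U, u ∉ C := fun u hu h => Finset.disjoint_left.1 hU hu (by simp [h])
    have hUy : ∀ u ∈ U, u ∉ y := fun u hu h => Finset.disjoint_left.1 hU hu (by simp [h])
    have build : ∀ (U' : Finset (Fin n)) (o : List (Fin n)), U' ⊆ U → (∀ v ∈ o, v ∈ U) →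
        (∀ v ∈ o, v ∉ U') → o.Nodup → (∀ u ∈ U', U'.card ≤ cnt u) → FT k E (L ++ o ++ R) →
        ∃ mid, FT k E (S ++ mid ++ R) ∧ (S ++ mid ++ R).Nodup ∧
          (S ++ mid ++ R).toFinset = P ∪ C.toFinset ∪ y.toFinset ∪ (U' ∪ o.toFinset) := by
      intro U' o hU' ho1 ho2 ho3 hc hFT
      obtain ⟨mid, hm1, hm2, hm3⟩ := hA.absorb U' (hUP.mono_left hU') hc
      refine ⟨mid ++ Z ++ C ++ L ++ o, ?_, ?_, ?_⟩
      · have h1 := hm1.glue (b := C ++ L) (by simpa using hC4) (by rw [hA.right_length])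
        have h2 := FT.glue (a := S ++ mid ++ Z ++ C) (S := L) (b := o ++ R) (by simpa using h1)
          (by simpa using hFT) (by rw [hLl])
        simpa using h2
      · have hmem : ∀ v, v ∈ S ++ mid ++ Z → v ∈ P ∨ v ∈ U' := by
          intro v hv
          have : v ∈ (S ++ mid ++ Z).toFinset := List.mem_toFinset.2 hv
          rw [hm3] at this
          simpa using this
        have hnd : ((S ++ mid ++ Z) ++ (C ++ (o ++ (L ++ R)))).Nodup := by
          have hLRn : (L ++ R).Nodup := by
            have : (R ++ (y.drop (k - 1))).Nodup := by rw [hRdef, List.take_append_drop]; exact hu₁.nodup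
            rw [List.nodup_append_comm]
            have h2 : (R ++ L).Perm (R ++ y.drop (k - 1)) :=
              List.Perm.append_left _ (List.reverse_perm _)
            exact h2.nodup_iff.2 this
          refine hm2.append (hC1.append (ho3.append hLRn ?_) ?_) ?_
          · intro v hv hv'
            exact hUy v (ho1 v hv) ((hLR v).2 (by simpa using hv'))
          · intro v hv hv'
            rcases List.mem_append.1 hv' with h | h
            · exact hUC v (ho1 v h) hv
            · exact (hC2' v hv).2 ((hLR v).2 (by simpa using h))
          · intro v hv hv'
            have hPU := hmem v hv
            rcases List.mem_append.1 hv' with h | h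
            · rcases hPU with h' | h'
              · exact (hC2' v h).1 h'
              · exact hUC v (hU' h') h
            · rcases List.mem_append.1 h with h | h
              · rcases hPU with h' | h'
                · exact Finset.disjoint_left.1 hUP (ho1 v h) h'
                · exact ho2 v h h'
              · have hvy : v ∈ y := (hLR v).2 (by simpa using h)
                rcases hPU with h' | h'
                · exact hu₁.avoid v hvy h'
                · exact hUy v (hU' h') hvy
        refine List.Perm.nodup ?_ hnd
        simp only [List.append_assoc]
        refine List.Perm.append_left _ (List.Perm.append_left _ (List.Perm.append_left _
          (List.Perm.append_left _ ?_)))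
        rw [← List.append_assoc, ← List.append_assoc]
        exact List.Perm.append_right _ List.perm_append_comm
      · ext v
        have : v ∈ (S ++ mid ++ Z).toFinset ↔ v ∈ P ∪ U' := by rw [hm3]
        simp only [List.mem_toFinset, List.mem_append, Finset.mem_union] at this ⊢
        rw [hLR]
        tauto
    by_cases hins : ∃ u ∈ U, InsTuple k E P u y
    · obtain ⟨u, hu, hI⟩ := hins
      obtain ⟨mid, h1, h2, h3⟩ := build (U.erase u) [u] (Finset.erase_subset _ _) (by simpa using hu)
        (by simp) (by simp) (fun x hx => by
          have h1 := hUc x (Finset.mem_of_mem_erase hx)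
          rw [Finset.card_erase_of_mem hu]
          split_ifs at h1 <;> omega) hI.ft_ins
      refine ⟨mid, h1, h2, ?_⟩
      rw [h3]
      congr 1
      ext v
      simp only [Finset.mem_union, Finset.mem_erase, List.mem_toFinset, List.mem_singleton]
      by_cases hv : v = u
      · simp [hv, hu]
      · simp [hv]
    · obtain ⟨mid, h1, h2, h3⟩ := build U [] subset_rfl (by simp) (by simp) (by simp) (fun x hx => by
          have h1 := hUc x hx
          rw [if_neg (fun h => hins ⟨x, hx, h⟩)] at h1
          omega) (by simpa using hu₁.ft)
      exact ⟨mid, h1, h2, by simpa using h3⟩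
  · have h1 := Finset.card_union_le (P ∪ C.toFinset) y.toFinset
    have h2 := Finset.card_union_le P C.toFinset
    have h3 := List.toFinset_card_le C
    omega
  · have : ∑ u, (1 / 2 : ℝ) ^ (cnt u + if InsTuple k E P u y then 1 else 0) =
        Φ - 1 / 2 * ∑ u, (1 / 2 : ℝ) ^ cnt u * ind (InsTuple k E P u) y := by
      rw [hΦ, Finset.mul_sum, ← Finset.sum_sub_distrib]
      refine Finset.sum_congr rfl fun u _ => ?_
      by_cases h : InsTuple k E P u y
      · rw [if_pos h, ind_of h, pow_succ]; ring
      · rw [if_neg h, ind_of_not h]; simp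
    rw [this]
    linarith

/-- A short tight path into which every small set of vertices can be absorbed. -/
theorem exists_absorber (k t : ℕ) (hk : 2 ≤ k) (ht : 3 ≤ t) (γ : ℝ) (hγ : 0 < γ) :
    ∃ β : ℝ, 0 < β ∧ ∃ n₀ : ℕ, ∀ n, n₀ ≤ n → ∀ E : Finset (Finset (Fin n)), Good k t E →
      ∃ (S Z : List (Fin n)) (P : Finset (Fin n)), S.length = k - 1 ∧ Z.length = k - 1 ∧
        (P.card : ℝ) ≤ γ * n ∧ ∀ U : Finset (Fin n), Disjoint U P → (U.card : ℝ) ≤ β * n →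
          ∃ mid : List (Fin n), FT k E (S ++ mid ++ Z) ∧ (S ++ mid ++ Z).Nodup ∧
            (S ++ mid ++ Z).toFinset = P ∪ U := by
  classical
  obtain ⟨Lc, s₀, -, -, hconn⟩ := exists_connector k 1 hk le_rfl
  set q : ℝ := 1 - 1 / 2 * (1 / 20) ^ (2 * (k - 1)) with hq
  have hq20 : (1 / 20 : ℝ) ^ (2 * (k - 1)) ≤ 1 := pow_le_one₀ (by norm_num) (by norm_num)
  have hq20' : (0 : ℝ) < (1 / 20 : ℝ) ^ (2 * (k - 1)) := by positivity
  have hq0 : 0 < q := by linarith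
  have hq1 : q < 1 := by linarith
  obtain ⟨j, hj⟩ := exists_pow_lt_of_lt_one (show (0 : ℝ) < 1 / 4 by norm_num) hq1
  set c := Lc + 2 * k with hc
  obtain ⟨K₁, hK₁⟩ := exists_nat_ge (2 * j * c / γ)
  set K := max K₁ (12 * j * c) + 1 with hK
  obtain ⟨n₁, hn₁⟩ := exists_nat_ge (4 * k / γ)
  refine ⟨1 / (2 * K), by positivity, n₁ + 48 * k + 300 * (k + s₀) + K * (4 * K + 4),
    fun n hn E hG => ?_⟩
  set B := n / K with hB
  have hKpos : 0 < K := by omega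
  have hBK : B * K ≤ n := Nat.div_mul_le_self n K
  have hBK' : n < K * (B + 1) := Nat.lt_mul_div_succ n hKpos
  have hB4 : 4 * K + 4 ≤ B := by
    rw [hB, Nat.le_div_iff_mul_le hKpos]
    nlinarith
  have hiter : ∀ T, T ≤ j * B → ∃ S Z P cnt, AbsorbsUpTo k E S Z P cnt ∧ P.card ≤ 2 * k + T * c ∧
      ∑ u : Fin n, (1 / 2 : ℝ) ^ cnt u ≤ q ^ T * n := by
    intro T
    induction T with
    | zero =>
      intro _
      have hR := hG.rich ht (W := Finset.univ \ ∅) (by simp; omega)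
      have hW : 10 * (2 * k) ≤ ((Finset.univ : Finset (Fin n)) \ ∅).card := by simp; omega
      have h1 := InsTuple.dense hk hG hR hW ⟨0, by omega⟩
      obtain ⟨y, hyl, -, hy⟩ := exists_ge_of_isum (Finset.card_pos.1 (by omega)) _ _ _ h1
      have hy' : InsTuple k E ∅ ⟨0, by omega⟩ y := by
        by_contra hcon
        rw [ind_of_not hcon] at hy
        linarith
      refine ⟨(y.drop (k - 1)).reverse, y.take (k - 1), y.toFinset, fun _ => 0, ⟨?_, ?_, ?_⟩, ?_, ?_⟩
      · simp; omega
      · simp; omega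
      · intro U hU hU2
        have hU0 : U = ∅ := by
          rcases U.eq_empty_or_nonempty with h | ⟨u, hu⟩
          · exact h
          · have h2 := hU2 u hu
            simpa using h2
        subst hU0
        have hp : ((y.drop (k - 1)).reverse ++ [] ++ y.take (k - 1)).Perm y := by
          rw [List.append_nil]
          refine List.perm_append_comm.trans ?_
          refine (List.Perm.append_left _ (List.reverse_perm _)).trans ?_
          rw [List.take_append_drop]
        refine ⟨[], by simpa using hy'.ft, hp.nodup_iff.2 hy'.nodup, ?_⟩
        rw [List.toFinset_eq_of_perm _ _ hp]
        simp
      · have := List.toFinset_card_le y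
        omega
      · simp
    | succ T ih =>
      intro hT
      obtain ⟨S, Z, P, cnt, hA, hP, hs⟩ := ih (by omega)
      have h1 : T * c ≤ j * c * B := by
        calc T * c ≤ j * B * c := Nat.mul_le_mul_right _ (by omega)
          _ = _ := by ring
      have h2 : 12 * (j * c * B) ≤ n := by
        calc 12 * (j * c * B) = B * (12 * j * c) := by ring
          _ ≤ B * K := Nat.mul_le_mul_left _ (by omega)
          _ ≤ n := hBK
      obtain ⟨Z', P', cnt', hA', hP', hs'⟩ := hA.step hk (hconn n E) ht hG (by omega) (by omega)
      refine ⟨S, Z', P', cnt', hA', ?_, ?_⟩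
      · have : (T + 1) * c = T * c + c := by ring
        omega
      · calc _ ≤ q * ∑ u, (1 / 2 : ℝ) ^ cnt u := hs'
          _ ≤ q * (q ^ T * n) := by gcongr
          _ = _ := by ring
  obtain ⟨S, Z, P, cnt, hA, hP, hs⟩ := hiter _ le_rfl
  have hnpos : (0 : ℝ) < n := by exact_mod_cast (by omega : 0 < n)
  have hcnt : ∀ u, B ≤ cnt u := by
    intro u
    have h1 : (1 / 2 : ℝ) ^ cnt u ≤ q ^ (j * B) * n :=
      (Finset.single_le_sum (f := fun u => (1 / 2 : ℝ) ^ cnt u) (fun i _ => by positivity)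
        (Finset.mem_univ u)).trans hs
    have h2 : q ^ (j * B) ≤ (1 / 4) ^ B := by
      rw [pow_mul]
      gcongr
    have h3 : n ≤ 2 ^ B := by
      have h4 : B / 2 + 1 ≤ 2 ^ (B / 2) := Nat.lt_two_pow_self
      have h5 : 2 ^ (B / 2) * 2 ^ (B / 2) ≤ 2 ^ B := by
        rw [← pow_add]
        exact Nat.pow_le_pow_right (by norm_num) (by omega)
      have h6 : (B / 2 + 1) * (B / 2 + 1) ≤ 2 ^ (B / 2) * 2 ^ (B / 2) := Nat.mul_le_mul h4 h4
      have h7 : 2 * K * (B / 2 + 1) ≤ (B / 2 + 1) * (B / 2 + 1) :=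
        Nat.mul_le_mul_right _ (by omega)
      have h8 : K * (B + 1) ≤ K * (2 * (B / 2 + 1)) := Nat.mul_le_mul_left _ (by omega)
      nlinarith
    have h4 : (n : ℝ) ≤ 2 ^ B := by exact_mod_cast h3
    have h5 : (1 / 2 : ℝ) ^ cnt u ≤ (1 / 2) ^ B := by
      calc _ ≤ q ^ (j * B) * n := h1
        _ ≤ (1 / 4) ^ B * 2 ^ B := by gcongr
        _ = (1 / 2) ^ B := by rw [← mul_pow]; norm_num
    by_contra hcon
    have h6 : (1 / 2 : ℝ) ^ B < (1 / 2) ^ cnt u :=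
      pow_lt_pow_right_of_lt_one₀ (by norm_num) (by norm_num) (not_le.1 hcon)
    linarith
  refine ⟨S, Z, P, hA.left_length, hA.right_length, ?_, fun U hU hUc => hA.absorb U hU fun u hu => ?_⟩
  · have h1 : (P.card : ℝ) ≤ 2 * k + j * B * c := by exact_mod_cast hP
    have h2 : (n₁ : ℝ) ≤ n := by exact_mod_cast (by omega : n₁ ≤ n)
    have h3 : 4 * k / γ ≤ n := hn₁.trans h2
    rw [div_le_iff₀ hγ] at h3
    have h4 : 2 * j * c / γ ≤ K := hK₁.trans (by exact_mod_cast (by omega : K₁ ≤ K))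
    rw [div_le_iff₀ hγ] at h4
    have h5 : (B : ℝ) * K ≤ n := by exact_mod_cast hBK
    have h6 : (0 : ℝ) ≤ B := by positivity
    nlinarith [mul_le_mul_of_nonneg_left h4 h6, mul_le_mul_of_nonneg_left h5 hγ.le]
  · refine le_trans ?_ (hcnt u)
    have h1 : (n : ℝ) < K * (B + 1) := by exact_mod_cast hBK'
    have hKr : (0 : ℝ) < K := by exact_mod_cast hKpos
    have h2 : (U.card : ℝ) ≤ B := by
      have h3 : (1 : ℝ) ≤ B := by exact_mod_cast (by omega : 1 ≤ B)
      calc (U.card : ℝ) ≤ 1 / (2 * K) * n := hUc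
        _ ≤ 1 / (2 * K) * (K * (B + 1)) := by gcongr
        _ = (B + 1) / 2 := by field_simp
        _ ≤ B := by linarith
    exact_mod_cast h2

end absorb

section tileword
variable {k t m d : ℕ}

/-- Positions carrying the distinguished letter: last in one of the first `m` blocks of length
`t`. -/
def Special (t m p : ℕ) : Prop := p % t = t - 1 ∧ p / t < m

open Classical in
/-- The word with letter `0` at special positions and `1, …, k - 1` cyclically elsewhere. -/
noncomputable def tileWord (k t m p : ℕ) : ℕ :=
  if Special t m p then 0 else 1 + (p - min (p / t) m) % (k - 1)

theorem tileWord_lt (hk : 2 ≤ k) (p : ℕ) : tileWord k t m p < k := by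
  unfold tileWord
  split_ifs
  · omega
  · have := Nat.mod_lt (p - min (p / t) m) (show 0 < k - 1 by omega)
    omega

theorem tileWord_ne (hk : 2 ≤ k) (ht : 2 ≤ t) {p p' : ℕ} (hpp : p < p') (hp : ¬ Special t m p)
    (hp' : ¬ Special t m p')
    (h : p' < p + k - 1 ∨ p' < p + k ∧ ∃ x, Special t m x ∧ p < x ∧ x < p') :
    tileWord k t m p ≠ tileWord k t m p' := by
  have hle : ∀ x, min (x / t) m ≤ x := fun x => (min_le_left _ _).trans (Nat.div_le_self _ _)
  have hmono : min (p / t) m ≤ min (p' / t) m := min_le_min_right _ (Nat.div_le_div_right hpp.le)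
  have h1 : p - min (p / t) m < p' - min (p' / t) m := by
    have e1 := Nat.div_add_mod p t
    have e2 := Nat.div_add_mod p' t
    have l1 := Nat.mod_lt p (show 0 < t by omega)
    have l3 := hle p
    have l4 := hle p'
    by_cases hm : p / t < m
    · have l5 : p % t ≤ t - 2 := by
        have : p % t ≠ t - 1 := fun h => hp ⟨h, hm⟩
        omega
      have l6 : p / t ≤ p' / t := Nat.div_le_div_right hpp.le
      obtain ⟨j, hj⟩ := Nat.exists_eq_add_of_le l6
      rcases Nat.eq_zero_or_pos j with hj0 | hj0
      · subst hj0
        simp only [add_zero] at hj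
        rw [hj] at l4 ⊢
        omega
      · have l7 : 2 * (j - 1) ≤ t * (j - 1) := Nat.mul_le_mul_right _ ht
        have l8 : t * (p' / t) = t * (p / t) + t + t * (j - 1) := by
          rw [hj, mul_add]
          obtain ⟨j', rfl⟩ : ∃ j', j = j' + 1 := ⟨j - 1, by omega⟩
          simp
          ring
        have l9 : min (p' / t) m ≤ p / t + j := by omega
        have l10 : min (p / t) m = p / t := min_eq_left hm.le
        omega
    · have : min (p / t) m = m := by omega
      have : min (p' / t) m = m := by omega
      omega
  have h2 : p' - min (p' / t) m < p - min (p / t) m + (k - 1) := by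
    rcases h with h | ⟨h, x, hx, hx1, hx2⟩
    · have := hle p
      omega
    · have e1 := Nat.div_add_mod x t
      have l1 : p / t ≤ x / t := Nat.div_le_div_right hx1.le
      have l2 : x / t + 1 ≤ p' / t := by
        rw [Nat.le_div_iff_mul_le (by omega)]
        have := hx.1
        have : (x / t + 1) * t = t * (x / t) + t := by ring
        omega
      have := hx.2
      have := hle p
      have := hle p'
      omega
  unfold tileWord
  rw [if_neg hp, if_neg hp']
  intro heq
  have h3 : (p - min (p / t) m) ≡ (p' - min (p' / t) m) [MOD k - 1] := by
    have := Nat.add_left_cancel heq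
    exact this
  have h4 := (Nat.modEq_iff_dvd' h1.le).1 h3
  have h5 := Nat.le_of_dvd (by omega) h4
  omega

theorem tileWord_injOn (hk : 2 ≤ k) (ht : 2 ≤ t) {a b : ℕ}
    (huniq : ∀ x x', a ≤ x → x < x' → x' < b → Special t m x → Special t m x' → False)
    (hab : b ≤ a + (k - 1) ∨ b ≤ a + k ∧ ∃ x, Special t m x ∧ a ≤ x ∧ x < b) :
    Set.InjOn (tileWord k t m) (Finset.Ico a b : Finset ℕ) := by
  have key : ∀ p p', a ≤ p → p < p' → p' < b → tileWord k t m p ≠ tileWord k t m p' := by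
    intro p p' h1 h2 h3
    by_cases hp : Special t m p
    · by_cases hp' : Special t m p'
      · exact (huniq p p' h1 h2 h3 hp hp').elim
      · unfold tileWord
        rw [if_pos hp, if_neg hp']
        omega
    · by_cases hp' : Special t m p'
      · unfold tileWord
        rw [if_neg hp, if_pos hp']
        omega
      · refine tileWord_ne hk ht h2 hp hp' ?_
        rcases hab with h | ⟨h, x, hx, hx1, hx2⟩
        · left; omega
        · by_cases hh : p' < p + k - 1
          · exact Or.inl hh
          · right
            have : x ≠ p := fun h => hp (h ▸ hx)
            have : x ≠ p' := fun h => hp' (h ▸ hx)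
            exact ⟨by omega, x, hx, by omega, by omega⟩
  intro p hp p' hp' h
  simp only [Finset.coe_Ico, Set.mem_Ico] at hp hp'
  rcases lt_trichotomy p p' with h1 | h1 | h1
  · exact (key p p' hp.1 h1 hp'.2 h).elim
  · exact h1
  · exact (key p' p hp'.1 h1 hp.2 h.symm).elim

theorem Special.add_le {x x' : ℕ} (hx : Special t m x) (hx' : Special t m x')
    (h : x < x') : x + t ≤ x' := by
  have e1 := Nat.div_add_mod x t
  have e2 := Nat.div_add_mod x' t
  have h1 := hx.1
  have h2 := hx'.1
  have h3 : x / t < x' / t := by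
    by_contra hcon
    have := Nat.mul_le_mul_left t (not_lt.1 hcon)
    omega
  have := Nat.mul_le_mul_left t h3
  simp only [Nat.succ_eq_add_one, mul_add, mul_one] at this
  omega

theorem tileWord_injOn_window (hk : 2 ≤ k) (ht : 2 ≤ t) (hdt : d ∣ t) (hkt : k < t + d)
    (htk : t ≤ k) (hdk : d < k) {a : ℕ} (ha : d ∣ a) (hal : a + k ≤ t * m + d) :
    Set.InjOn (tileWord k t m) (Finset.Ico a (a + k) : Finset ℕ) := by
  refine tileWord_injOn hk ht ?_ (Or.inr ⟨le_rfl, t * (a / t) + (t - 1), ⟨?_, ?_⟩, ?_, ?_⟩)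
  · intro x x' h1 h2 h3 hx hx'
    have h4 := hx.add_le hx' h2
    have h5 : d ∣ x + 1 := by
      have e1 := Nat.div_add_mod x t
      rw [hx.1] at e1
      have : x + 1 = t * (x / t + 1) := by rw [mul_add]; omega
      rw [this]
      exact hdt.mul_right _
    have h6 := Nat.le_of_dvd (by omega) (Nat.dvd_sub h5 ha)
    omega
  · rw [Nat.mul_add_mod, Nat.mod_eq_of_lt (by omega)]
  · rw [Nat.mul_add_div (by omega), Nat.div_eq_of_lt (show t - 1 < t by omega), add_zero,
      Nat.div_lt_iff_lt_mul (by omega), mul_comm]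
    omega
  · have e1 := Nat.div_add_mod a t
    have := Nat.mod_lt a (show 0 < t by omega)
    omega
  · have e1 := Nat.div_add_mod a t
    omega

theorem tileWord_injOn_first (hk : 2 ≤ k) (ht : 2 ≤ t) (hkt : k < 2 * t) :
    Set.InjOn (tileWord k t m) (Finset.Ico 0 (k - 1) : Finset ℕ) := by
  refine tileWord_injOn hk ht ?_ (Or.inl (by omega))
  intro x x' h1 h2 h3 hx hx'
  have h4 := hx.add_le hx' h2
  have := hx.1
  have := Nat.mod_le x t
  omega

theorem tileWord_injOn_last (hk : 2 ≤ k) (ht : 2 ≤ t) (hkt : k < t + d) (hl : k ≤ t * m + d) :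
    Set.InjOn (tileWord k t m) (Finset.Ico (t * m + d - (k - 1)) (t * m + d) : Finset ℕ) := by
  refine tileWord_injOn hk ht ?_ (Or.inl (by omega))
  intro x x' h1 h2 h3 hx hx'
  have h4 := hx.add_le hx' h2
  have e1 := Nat.div_add_mod x' t
  have h5 := hx'.1
  have h6 := Nat.mul_le_mul_left t (Nat.succ_le_of_lt hx'.2)
  simp only [Nat.succ_eq_add_one, mul_add, mul_one] at h6
  omega

theorem le_card_tileWord_zero (ht : 1 ≤ t) :
    m ≤ ((Finset.range (t * m + d)).filter fun p => tileWord k t m p = 0).card := by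
  have h : ((Finset.range m).image fun i => t * i + (t - 1)) ⊆
      (Finset.range (t * m + d)).filter fun p => tileWord k t m p = 0 := by
    intro p hp
    obtain ⟨i, hi, rfl⟩ := Finset.mem_image.1 hp
    simp only [Finset.mem_range, Finset.mem_filter] at *
    have h1 := Nat.mul_le_mul_left t (Nat.succ_le_of_lt hi)
    simp only [Nat.succ_eq_add_one, mul_add, mul_one] at h1
    refine ⟨by omega, if_pos ⟨?_, ?_⟩⟩
    · rw [Nat.mul_add_mod, Nat.mod_eq_of_lt (by omega)]
    · rw [Nat.mul_add_div (by omega), Nat.div_eq_of_lt (show t - 1 < t by omega)]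
      simpa using hi
  have h2 := Finset.card_le_card h
  rw [Finset.card_image_of_injective, Finset.card_range] at h2
  · exact h2
  · intro i j hij
    simp only [add_left_inj] at hij
    exact Nat.eq_of_mul_eq_mul_left (by omega) hij

theorem le_card_mod_lt_two {L : ℕ} (hk : 2 ≤ k) :
    2 * (L / k) ≤ ((Finset.range L).filter fun p => p % k < 2).card := by
  have h : ((Finset.range (L / k) ×ˢ Finset.range 2).image fun i => k * i.1 + i.2) ⊆
      (Finset.range L).filter fun p => p % k < 2 := by
    intro p hp
    obtain ⟨⟨i, j⟩, hi, rfl⟩ := Finset.mem_image.1 hp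
    simp only [Finset.mem_range, Finset.mem_filter, Finset.mem_product] at *
    have h1 := Nat.mul_le_mul_left k (Nat.succ_le_of_lt hi.1)
    simp only [Nat.succ_eq_add_one, mul_add, mul_one] at h1
    have := Nat.div_mul_le_self L k
    rw [mul_comm] at this
    refine ⟨by omega, ?_⟩
    rw [Nat.mul_add_mod, Nat.mod_eq_of_lt (by omega)]
    exact hi.2
  have h2 := Finset.card_le_card h
  rw [Finset.card_image_of_injOn, Finset.card_product, Finset.card_range, Finset.card_range] at h2
  · omega
  · rintro ⟨i, j⟩ hi ⟨i', j'⟩ hi' hij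
    simp only [Finset.coe_product, Finset.coe_range, Set.mem_prod, Set.mem_Iio] at hi hi' hij
    have h3 : (k * i + j) / k = (k * i' + j') / k := by rw [hij]
    rw [Nat.mul_add_div (by omega), Nat.mul_add_div (by omega),
      Nat.div_eq_of_lt (show j < k by omega), Nat.div_eq_of_lt (show j' < k by omega)] at h3
    simp only [add_zero] at h3
    subst h3
    simp at hij
    simp [hij]

theorem injOn_mod {a b : ℕ} (hab : b ≤ a + k) :
    Set.InjOn (fun p => p % k) (Finset.Ico a b : Finset ℕ) := by
  intro p hp p' hp' h
  simp only [Finset.coe_Ico, Set.mem_Ico] at hp hp'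
  rcases Nat.le_total p p' with h1 | h1
  · have h4 := (Nat.modEq_iff_dvd' h1).1 h
    by_contra hne
    have h5 := Nat.le_of_dvd (by omega) h4
    omega
  · have h4 := (Nat.modEq_iff_dvd' h1).1 (Eq.symm h)
    by_contra hne
    have h5 := Nat.le_of_dvd (by omega) h4
    omega

end tileword

section pattern
variable {n : ℕ} {E : Finset (Finset (Fin n))} {k : ℕ}

/-- Faces inside `A` listed so that the first letter lies in `X₀` and the second in `X₁`. -/
structure PatternTuple (E : Finset (Finset (Fin n))) (A X₀ X₁ : Finset (Fin n))
    (y : List (Fin n)) : Prop where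
  nodup : y.Nodup
  face : Face E y.toFinset
  mem : ∀ v ∈ y, v ∈ A
  zero : ∀ v, y[0]? = some v → v ∈ X₀
  one : ∀ v, y[1]? = some v → v ∈ X₁

theorem PatternTuple.exists_ext {A X₀ X₁ : Finset (Fin n)} (hX₀ : X₀ ⊆ A) (hX₁ : X₁ ⊆ A)
    (hsing : ∀ v : Fin n, Face E {v}) {q : ℝ}
    (hA : ∀ σ, Face E σ → σ.card < k → q ≤ (A \ miss E σ).card) (h₀ : q ≤ X₀.card)
    (h₁ : ∀ x ∈ X₀, q ≤ (X₁ \ miss E {x}).card) {y : List (Fin n)} (hyl : y.length < k)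
    (hy : PatternTuple E A X₀ X₁ y) :
    ∃ T ⊆ A, q - k ≤ T.card ∧ ∀ v ∈ T, PatternTuple E A X₀ X₁ (y ++ [v]) := by
  classical
  have key : ∀ T ⊆ A, q ≤ T.card → (∀ v ∈ T, v ∉ miss E y.toFinset) →
      (y.length = 0 → T ⊆ X₀) → (y.length = 1 → T ⊆ X₁) →
      ∃ T ⊆ A, q - k ≤ T.card ∧ ∀ v ∈ T, PatternTuple E A X₀ X₁ (y ++ [v]) := by
    intro T hTA hTq hTm hT0 hT1
    refine ⟨T \ y.toFinset, Finset.sdiff_subset.trans hTA, ?_, fun v hv => ?_⟩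
    · have h1 := Finset.le_card_sdiff y.toFinset T
      have h2 := List.toFinset_card_le y
      have h3 : (T.card : ℝ) ≤ (T \ y.toFinset).card + k := by
        exact_mod_cast (by omega : T.card ≤ (T \ y.toFinset).card + k)
      linarith
    · simp only [Finset.mem_sdiff, List.mem_toFinset] at hv
      have hlast : ∀ j x, (y ++ [v])[j]? = some x → y[j]? = some x ∨ (j = y.length ∧ x = v) := by
        intro j x h
        rcases lt_trichotomy j y.length with hj | hj | hj
        · left; rwa [List.getElem?_append_left hj] at h
        · right
          subst hj
          simp at h
          exact ⟨rfl, h.symm⟩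
        · rw [List.getElem?_eq_none (by simp; omega)] at h
          simp at h
      refine ⟨?_, ?_, ?_, ?_, ?_⟩
      · rw [List.nodup_append]
        refine ⟨hy.nodup, by simp, ?_⟩
        intro a ha b hb
        simp only [List.mem_singleton] at hb
        rintro rfl
        exact hv.2 (hb ▸ ha)
      · have := face_insert (hTm v hv.1)
        simpa [List.toFinset_append, Finset.union_comm] using this
      · intro x hx
        rcases List.mem_append.1 hx with h | h
        · exact hy.mem x h
        · rw [List.mem_singleton.1 h]; exact hTA hv.1
      · intro x hx
        rcases hlast _ _ hx with h | ⟨h, rfl⟩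
        · exact hy.zero x h
        · exact hT0 h.symm hv.1
      · intro x hx
        rcases hlast _ _ hx with h | ⟨h, rfl⟩
        · exact hy.one x h
        · exact hT1 h.symm hv.1
  rcases Nat.lt_or_ge y.length 2 with hl | hl
  · rcases Nat.lt_or_ge y.length 1 with hl' | hl'
    · have : y = [] := List.eq_nil_of_length_eq_zero (by omega)
      subst this
      refine key X₀ hX₀ h₀ (fun v _ => ?_) (fun _ => subset_rfl) (by simp)
      rw [mem_miss]
      simpa using hsing v
    · obtain ⟨x, rfl⟩ := List.length_eq_one_iff.1 (show y.length = 1 by omega)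
      refine key (X₁ \ miss E {x}) (Finset.sdiff_subset.trans hX₁) (h₁ x (hy.zero x (by simp)))
        (fun v hv => ?_) (by simp) (fun _ => Finset.sdiff_subset)
      simpa using (Finset.mem_sdiff.1 hv).2
  · have hc := List.toFinset_card_le y
    exact key (A \ miss E y.toFinset) Finset.sdiff_subset (hA _ hy.face (by omega))
      (fun v hv => (Finset.mem_sdiff.1 hv).2) (by omega) (by omega)

theorem exists_pattern (k len : ℕ) (w : ℕ → ℕ) (hw : ∀ j < len, w j < k) (q : ℝ)
    (hq : 0 < q) : ∃ s₀ : ℕ, ∀ (n : ℕ) (E : Finset (Finset (Fin n))) (W A X₀ X₁ : Finset (Fin n)),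
      s₀ ≤ W.card → A ⊆ W → X₀ ⊆ A → X₁ ⊆ A → (∀ v : Fin n, Face E {v}) →
      (∀ σ, Face E σ → σ.card < k → q * W.card ≤ (A \ miss E σ).card) → q * W.card ≤ X₀.card →
      (∀ x ∈ X₀, q * W.card ≤ (X₁ \ miss E {x}).card) →
      ∃ p : ℕ → Fin n, (∀ j < len, p j ∈ A) ∧ Set.InjOn p {j | j < len} ∧
        (∀ j < len, w j = 0 → p j ∈ X₀) ∧ (∀ j < len, w j = 1 → p j ∈ X₁) ∧
        ∀ J : Finset ℕ, (∀ j ∈ J, j < len) → Set.InjOn w J → Face E (J.image p) := by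
  classical
  obtain ⟨s₁, hs₁⟩ := exists_word k len w hw ((q / 2) ^ k) (by positivity)
  obtain ⟨s₂, hs₂⟩ := exists_nat_ge (2 * k / q)
  refine ⟨max s₁ (max s₂ 1), fun n E W A X₀ X₁ hW hAW hX₀ hX₁ hsing hA h₀ h₁ => ?_⟩
  have hWq : (k : ℝ) ≤ q / 2 * W.card := by
    have h1 : (s₂ : ℝ) ≤ W.card := by exact_mod_cast (by omega : s₂ ≤ W.card)
    have h2 := hs₂.trans h1
    rw [div_le_iff₀ hq] at h2
    linarith
  have hdens : (q / 2) ^ k * (W.card : ℝ) ^ k ≤ isum W k (ind (PatternTuple E A X₀ X₁)) := by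
    have h0 : PatternTuple E A X₀ X₁ [] := by
      obtain ⟨v, -⟩ := Finset.card_pos.1 (show 0 < W.card by omega)
      exact ⟨by simp, (hsing v).mono (by simp), by simp, by simp, by simp⟩
    have := pow_le_isum_ind (W := W) (P := PatternTuple E A X₀ X₁) (q := q / 2 * W.card)
      (by positivity) k (fun l hl _ hP => by
        obtain ⟨T, hT, hTq, hT'⟩ := PatternTuple.exists_ext hX₀ hX₁ hsing hA h₀ h₁ hl hP
        exact ⟨T, hT.trans hAW, by linarith, hT'⟩)
      k [] (by simp) (by simp) h0
    rw [mul_pow] at this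
    simpa using this
  obtain ⟨p, hpW, hpinj, hp⟩ := hs₁ n W (by omega) _ (fun l h => h.nodup) hdens
  have hone : ∀ j < len, ∃ y, PatternTuple E A X₀ X₁ y ∧ y[w j]? = some (p j) := fun j hj => by
    obtain ⟨y, -, hy, -, h⟩ := hp {j} (by simpa using hj) (by simp)
    exact ⟨y, hy, h j (by simp)⟩
  refine ⟨p, fun j hj => ?_, hpinj, fun j hj h => ?_, fun j hj h => ?_, fun J hJ hwJ => ?_⟩
  · obtain ⟨y, hy, h⟩ := hone j hj
    exact hy.mem _ (List.mem_iff_getElem?.2 ⟨_, h⟩)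
  · obtain ⟨y, hy, h'⟩ := hone j hj
    exact hy.zero _ (h ▸ h')
  · obtain ⟨y, hy, h'⟩ := hone j hj
    exact hy.one _ (h ▸ h')
  · obtain ⟨y, -, hy, -, h⟩ := hp J hJ hwJ
    refine hy.face.mono fun v hv => ?_
    obtain ⟨j, hj, rfl⟩ := Finset.mem_image.1 hv
    exact List.mem_toFinset.2 (List.mem_iff_getElem?.2 ⟨_, h j hj⟩)

/-- Turning a word realisation into a list following a given end. -/
theorem exists_tile_of_pattern {d Lc s₀ : ℕ} (hk : 2 ≤ k)
    (hconn : ∀ W : Finset (Fin n), s₀ ≤ W.card → Rich k E W (2 / 5) → ∀ S Z : List (Fin n),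
      S.length = k - 1 → Z.length = k - 1 → Face E S.toFinset → Face E Z.toFinset →
      ∃ C : List (Fin n), C.Nodup ∧ (∀ v ∈ C, v ∈ W) ∧ C.length = Lc ∧ FT k E (S ++ C ++ Z))
    (hE : ∀ e ∈ E, e.card = k) {len : ℕ} (hlen : k ≤ len) {w : ℕ → ℕ}
    (hwin : ∀ a, d ∣ a → a + k ≤ len → Set.InjOn w (Finset.Ico a (a + k) : Finset ℕ))
    (hfirst : Set.InjOn w (Finset.Ico 0 (k - 1) : Finset ℕ))
    (hlast : Set.InjOn w (Finset.Ico (len - (k - 1)) len : Finset ℕ))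
    {W : Finset (Fin n)} {μ : ℝ} (hR : Rich k E W μ)
    (hμW : μ * W.card + len ≤ 2 / 5 * W.card)
    (hWs : s₀ + len ≤ W.card) {p : ℕ → Fin n} (hpW : ∀ j < len, p j ∈ W)
    (hpinj : Set.InjOn p {j | j < len})
    (hp : ∀ J : Finset ℕ, (∀ j ∈ J, j < len) → Set.InjOn w J → Face E (J.image p))
    {S : List (Fin n)} (hS : S.length = k - 1) (hSf : Face E S.toFinset) :
    ∃ C P : List (Fin n), (C ++ P).Nodup ∧ (∀ v ∈ C ++ P, v ∈ W) ∧ C.length = Lc ∧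
      P.length = len ∧ FT k E (S ++ C ++ P.take (k - 1)) ∧ AW d k E P ∧
      Face E (P.drop (len - (k - 1))).toFinset ∧ P = (List.range len).map p := by
  classical
  set P := (List.range len).map p with hP
  have hPl : P.length = len := by simp [hP]
  have hPW : ∀ v ∈ P, v ∈ W := by
    intro v hv
    obtain ⟨j, hj, rfl⟩ := List.mem_map.1 hv
    exact hpW j (by simpa using hj)
  have hPn : P.Nodup := by
    rw [hP]
    refine List.Nodup.map_on ?_ List.nodup_range
    intro a ha b hb h
    exact hpinj (by simpa using ha) (by simpa using hb) h
  have hface : ∀ a b, b ≤ len → Set.InjOn w (Finset.Ico a b : Finset ℕ) →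
      Face E ((P.drop a).take (b - a)).toFinset := by
    intro a b hb hi
    refine (hp (Finset.Ico a b) (fun j hj => by simp at hj; omega) hi).mono ?_
    intro v hv
    simp only [List.mem_toFinset, hP, ← List.map_drop, ← List.map_take, List.mem_map] at hv
    obtain ⟨x, hx, rfl⟩ := hv
    refine Finset.mem_image_of_mem _ ?_
    rw [List.mem_iff_getElem] at hx
    obtain ⟨j, hj, hx⟩ := hx
    simp at hj hx
    simp only [Finset.mem_Ico]
    omega
  have hW'c : W.card - len ≤ (W \ P.toFinset).card := by
    have h1 := Finset.le_card_sdiff P.toFinset W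
    have h2 := List.toFinset_card_le P
    omega
  have hW'r : (W.card : ℝ) ≤ (W \ P.toFinset).card + len := by
    exact_mod_cast (by omega : W.card ≤ (W \ P.toFinset).card + len)
  have hlen0 : (0 : ℝ) ≤ len := by positivity
  have hR' : Rich k E (W \ P.toFinset) (2 / 5) := by
    intro σ hσ hσk
    have h1 := hR σ hσ hσk
    have h2 : ((miss E σ ∩ (W \ P.toFinset)).card : ℝ) ≤ (miss E σ ∩ W).card := by
      exact_mod_cast Finset.card_le_card (Finset.inter_subset_inter_left Finset.sdiff_subset)
    linarith
  obtain ⟨C, hCn, hCW, hCl, hC⟩ := hconn _ (by omega) hR' S (P.take (k - 1)) hS (by simp; omega) hSf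
    (by simpa using hface 0 (k - 1) (by omega) hfirst)
  refine ⟨C, P, ?_, ?_, hCl, hPl, hC, ?_, ?_, rfl⟩
  · rw [List.nodup_append]
    refine ⟨hCn, hPn, fun a ha b hb => ?_⟩
    rintro rfl
    have := hCW a ha
    simp [hb] at this
  · intro v hv
    rcases List.mem_append.1 hv with h | h
    · exact (Finset.mem_sdiff.1 (hCW v h)).1
    · exact hPW v h
  · intro a hda hak
    have h1 := hface a (a + k) (by omega) (hwin a hda (by omega))
    rw [show a + k - a = k by omega] at h1
    refine h1.mem hE ?_
    have : ((P.drop a).take k).Nodup :=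
      hPn.sublist ((List.take_sublist _ _).trans (List.drop_sublist _ _))
    rw [List.toFinset_card_of_nodup this]
    simp
    omega
  · have h1 := hface (len - (k - 1)) len le_rfl hlast
    rwa [List.take_of_length_le (by simp; omega)] at h1

end pattern

section heavytile

theorem exists_top {α : Type*} [DecidableEq α] (W : Finset α) (c : α → ℝ) (M : ℝ) (hM : 0 ≤ M)
    (hc : ∀ v, 0 ≤ c v ∧ c v ≤ M) : ∀ a ≤ W.card, ∃ A ⊆ W, A.card = a ∧ ∃ θ, 0 ≤ θ ∧ θ ≤ M ∧
      (∀ x ∈ A, θ ≤ c x) ∧ ∀ y ∈ W \ A, c y ≤ θ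
  | 0, _ => ⟨∅, by simp, rfl, M, hM, le_rfl, by simp, fun y _ => (hc y).2⟩
  | a + 1, ha => by
    obtain ⟨A, hA, hAc, θ, -, -, h1, h2⟩ := exists_top W c M hM hc a (by omega)
    have hne : (W \ A).Nonempty := by
      rw [← Finset.card_pos, Finset.card_sdiff_of_subset hA]
      omega
    obtain ⟨x, hx, hmax⟩ := Finset.exists_max_image (W \ A) c hne
    have hx' := Finset.mem_sdiff.1 hx
    refine ⟨insert x A, Finset.insert_subset hx'.1 hA, by rw [Finset.card_insert_of_notMem hx'.2, hAc],
      c x, (hc x).1, (hc x).2, ?_, ?_⟩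
    · intro y hy
      rcases Finset.mem_insert.1 hy with rfl | hy
      · exact le_rfl
      · exact (h2 x hx).trans (h1 y hy)
    · intro y hy
      refine hmax y ?_
      simp only [Finset.mem_sdiff, Finset.mem_insert, not_or] at hy ⊢
      exact ⟨hy.1, hy.2.2⟩

theorem excess_cases {α : Type*} (A : Finset α) (f : α → ℝ) {M D ζ ξ δ : ℝ} (hζ : 0 < ζ)
    (hξ : 0 < ξ) (hA : 0 < A.card) (hf : ∀ x ∈ A, 0 ≤ f x ∧ f x ≤ M)
    (hD : ∑ x ∈ A, f x = A.card * D) (hDM : δ * M < D)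
    (hhi : ((A.filter fun x => (1 + ζ) * D ≤ f x).card : ℝ) < ζ * δ * A.card) :
    (1 - 2 * ζ / ξ) * A.card ≤ ((A.filter fun x => (1 - ξ) * D ≤ f x).card : ℝ) := by
  classical
  have hA' : (0 : ℝ) < A.card := by exact_mod_cast hA
  have hD0 : 0 ≤ D := by
    have : 0 ≤ A.card * D := hD ▸ Finset.sum_nonneg fun x hx => (hf x hx).1
    exact nonneg_of_mul_nonneg_right this hA'
  have hM0 : 0 ≤ M := by
    obtain ⟨x, hx⟩ := Finset.card_pos.1 hA
    exact (hf x hx).1.trans (hf x hx).2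
  have h1 : ∑ x ∈ A, f x ≤ ∑ x ∈ A, ((if (1 + ζ) * D ≤ f x then M else 0) +
      (if (1 - ξ) * D ≤ f x then (ζ + ξ) * D else 0) + (1 - ξ) * D) := by
    refine Finset.sum_le_sum fun x hx => ?_
    obtain ⟨h0, hM⟩ := hf x hx
    have e1 := mul_nonneg hζ.le hD0
    have e2 := mul_nonneg hξ.le hD0
    split_ifs with h2 h3 h3 <;> nlinarith
  rw [Finset.sum_add_distrib, Finset.sum_add_distrib, ← Finset.sum_filter, ← Finset.sum_filter,
    hD] at h1
  simp only [Finset.sum_const, nsmul_eq_mul] at h1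
  set y := ((A.filter fun x => (1 - ξ) * D ≤ f x).card : ℝ)
  have hδM : ((A.filter fun x => (1 + ζ) * D ≤ f x).card : ℝ) * M ≤ ζ * A.card * D := by
    calc _ ≤ ζ * δ * A.card * M := by gcongr
      _ = ζ * A.card * (δ * M) := by ring
      _ ≤ _ := by gcongr
  have hDpos : 0 < D ∨ D = 0 := hD0.lt_or_eq.imp id Eq.symm
  rcases hDpos with hDpos | hDz
  · have h2 : (A.card : ℝ) * (ξ - ζ) ≤ y * (ζ + ξ) := by
      have : D * (A.card * (ξ - ζ)) ≤ D * (y * (ζ + ξ)) := by nlinarith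
      exact le_of_mul_le_mul_left this hDpos
    have h3 : (1 - 2 * ζ / ξ) * (ζ + ξ) ≤ ξ - ζ := by
      have : (1 - 2 * ζ / ξ) * (ζ + ξ) = ξ - ζ - 2 * ζ * ζ / ξ := by field_simp; ring
      rw [this]
      have : 0 ≤ 2 * ζ * ζ / ξ := by positivity
      linarith
    have h4 : (1 - 2 * ζ / ξ) * A.card * (ζ + ξ) ≤ y * (ζ + ξ) := by
      calc _ = A.card * ((1 - 2 * ζ / ξ) * (ζ + ξ)) := by ring
        _ ≤ A.card * (ξ - ζ) := by gcongr
        _ ≤ _ := h2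
    exact le_of_mul_le_mul_right h4 (by linarith)
  · have : y = A.card := by
      have h5 : A.filter (fun x => (1 - ξ) * D ≤ f x) = A :=
        Finset.filter_true_of_mem fun x hx => by rw [hDz]; simpa using (hf x hx).1
      simp only [y, h5]
    rw [this]
    have : 0 ≤ 2 * ζ / ξ := by positivity
    nlinarith

theorem le_sum_pattern {n len : ℕ} {p : ℕ → Fin n} (hpinj : Set.InjOn p {j | j < len})
    (C : List (Fin n)) {c : Fin n → ℝ} (hc : ∀ v, 0 ≤ c v) {θ b : ℝ} {P : ℕ → Prop}
    [DecidablePred P] (h1 : ∀ j < len, θ ≤ c (p j)) (h2 : ∀ j < len, P j → θ + b ≤ c (p j)) :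
    len * θ + ((Finset.range len).filter P).card * b ≤
      ∑ v ∈ (C ++ (List.range len).map p).toFinset, c v := by
  classical
  have h3 : (Finset.range len).image p ⊆ (C ++ (List.range len).map p).toFinset := by
    intro v hv
    simpa [or_iff_right_iff_imp] using Or.inr (by simpa using hv)
  refine le_trans ?_ (Finset.sum_le_sum_of_subset_of_nonneg h3 fun v _ _ => hc v)
  rw [Finset.sum_image (fun a ha b hb h => hpinj (by simpa using ha) (by simpa using hb) h)]
  have : (len : ℝ) * θ + ((Finset.range len).filter P).card * b =
      ∑ j ∈ Finset.range len, (θ + if P j then b else 0) := by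
    rw [Finset.sum_add_distrib, ← Finset.sum_filter]
    simp
  rw [this]
  refine Finset.sum_le_sum fun j hj => ?_
  have hj := Finset.mem_range.1 hj
  split_ifs with h
  · exact h2 j hj h
  · simpa using h1 j hj

end heavytile

section heavytile

set_option maxHeartbeats 2000000 in
/-- In a rich set without large almost independent subsets there is, for any weights, a tile of
fixed size that is at least about as heavy as average. -/
theorem exists_tile (k d t : ℕ) (hk : 3 ≤ k) (hd : 1 ≤ d) (hdk : d < k) (ht : t = k / d * d)
    (ht3 : 3 ≤ t) {γ ρ η : ℝ} (hγ : 0 < γ) (hγk : 3 * k ^ 2 * γ ≤ 1) (hρ : 0 < ρ) (hη : 0 < η)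
    (hη1 : η ≤ 1) :
    ∃ N s₀ : ℕ, 1 ≤ N ∧ d ∣ N ∧ k ≤ N ∧
      ∀ (n : ℕ) (E : Finset (Finset (Fin n))) (W : Finset (Fin n)), s₀ ≤ W.card → (∀ e ∈ E, e.card = k) → (∀ v : Fin n, Face E {v}) →
      Rich k E W (1 / t + γ) →
      (∀ X ⊆ W, (1 / t - 24 * k * γ) * W.card ≤ (X.card : ℝ) → ∃ X₀ ⊆ X, ρ * W.card ≤ (X₀.card : ℝ) ∧
        ∀ x ∈ X₀, ρ * W.card ≤ ((X \ miss E {x}).card : ℝ)) →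
      ∀ S : List (Fin n), S.length = k - 1 → Face E S.toFinset →
      ∀ (c : Fin n → ℝ) (M : ℝ), (∀ v, 0 ≤ c v ∧ c v ≤ M) →
      ∃ C P : List (Fin n), (C ++ P).Nodup ∧ (∀ v ∈ C ++ P, v ∈ W) ∧ d ∣ C.length ∧
        (C ++ P).length = N ∧ k ≤ P.length ∧ FT k E (S ++ C ++ P.take (k - 1)) ∧ AW d k E P ∧
        Face E (P.drop (P.length - (k - 1))).toFinset ∧
        N * ∑ v ∈ W, c v ≤ W.card * (∑ v ∈ (C ++ P).toFinset, c v + η * N * M) := by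
  classical
  have hdt : d ∣ t := ht ▸ Dvd.intro_left _ rfl
  have htk : t ≤ k := ht ▸ Nat.div_mul_le_self k d
  have hkt : k < t + d := by
    have h1 := Nat.div_add_mod k d
    have h2 := Nat.mod_lt k (show 0 < d by omega)
    rw [mul_comm] at h1
    omega
  have hdt' : d ≤ t := Nat.le_of_dvd (by omega) hdt
  obtain ⟨Lc, sc, hdLc, -, hconn⟩ := exists_connector k d (by omega) hd
  have hkr : (3 : ℝ) ≤ k := by exact_mod_cast hk
  have htr : (3 : ℝ) ≤ t := by exact_mod_cast ht3
  have htkr : (k : ℝ) + 1 ≤ 2 * t := by exact_mod_cast (by omega : k + 1 ≤ 2 * t)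
  have htkr' : (t : ℝ) ≤ k := by exact_mod_cast htk
  obtain ⟨m₀, hm₀⟩ := exists_nat_ge (16 * (t + Lc + k) / η)
  obtain ⟨m, hm⟩ : ∃ m, m = m₀ + k := ⟨_, rfl⟩
  obtain ⟨L, hL⟩ : ∃ L, L = t * m + d := ⟨_, rfl⟩
  obtain ⟨N, hN⟩ : ∃ N, N = Lc + L := ⟨_, rfl⟩
  have hmL : m ≤ t * m := Nat.le_mul_of_pos_left _ (by omega)
  have hkL : k ≤ L := by omega
  have hLr : (L : ℝ) ≤ t * m + t := by exact_mod_cast (by omega : L ≤ t * m + t)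
  have hNr : (N : ℝ) = Lc + L := by rw [hN]; push_cast; ring
  have hNη : 16 * (t + Lc + k) ≤ η * N := by
    have h1 : (m₀ : ℝ) ≤ N := by exact_mod_cast (by omega : m₀ ≤ N)
    have h2 := hm₀.trans h1
    rw [div_le_iff₀ hη] at h2
    linarith
  obtain ⟨ζ, hζ⟩ : ∃ ζ, ζ = 3 * t * γ := ⟨_, rfl⟩
  have hζ0 : 0 < ζ := by rw [hζ]; positivity
  have hγ9 : 27 * γ ≤ 1 := by
    refine le_trans ?_ hγk
    have : (9 : ℝ) ≤ k ^ 2 := by nlinarith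
    nlinarith
  have hζ1 : ζ ≤ 1 := by
    have : ζ ≤ 3 * k ^ 2 * γ := by
      rw [hζ]
      have : (t : ℝ) ≤ k ^ 2 := by nlinarith
      gcongr
    linarith
  obtain ⟨ξ, hξ⟩ : ∃ ξ, ξ = 1 / (4 * k : ℝ) := ⟨_, rfl⟩
  have hξ0 : 0 < ξ := by rw [hξ]; positivity
  obtain ⟨q, hq⟩ : ∃ q, q = min γ (min (ζ * (η / 4) / t) ρ) := ⟨_, rfl⟩
  have hq0 : 0 < q := by simp only [hq, lt_min_iff]; exact ⟨hγ, by positivity, hρ⟩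
  have hqγ' : q ≤ γ := hq ▸ min_le_left _ _
  have hqζ : q ≤ ζ * (η / 4) / t := hq ▸ (min_le_right _ _).trans (min_le_left _ _)
  have hqρ' : q ≤ ρ := hq ▸ (min_le_right _ _).trans (min_le_right _ _)
  obtain ⟨s₁, hs₁⟩ := exists_pattern k L (tileWord k t m) (fun j _ => tileWord_lt (by omega) j) q hq0
  obtain ⟨s₂, hs₂⟩ := exists_pattern k L (fun j => j % k) (fun j _ => Nat.mod_lt _ (by omega)) q hq0
  obtain ⟨s₃, hs₃⟩ := exists_nat_ge (1 / γ)
  refine ⟨N, max (max s₁ s₂) (max (sc + L) (max (40 * L) s₃)), by omega, ?_, by omega,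
    fun n E W hWs hE hsing hR hNE S hS hSf c M hc => ?_⟩
  · exact hN ▸ dvd_add hdLc (hL ▸ dvd_add (hdt.mul_right _) dvd_rfl)
  have hWpos : 0 < W.card := by omega
  have hs0 : (0 : ℝ) < W.card := by exact_mod_cast hWpos
  have hsγ : 1 ≤ γ * W.card := by
    have h1 : (s₃ : ℝ) ≤ W.card := by exact_mod_cast (by omega : s₃ ≤ W.card)
    have h2 := hs₃.trans h1
    rw [div_le_iff₀ hγ] at h2
    linarith
  have ht13 : 1 / (t : ℝ) ≤ 1 / 3 := one_div_le_one_div_of_le (by norm_num) htr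
  have ht0 : 0 < 1 / (t : ℝ) := by positivity
  have hM0 : 0 ≤ M := by
    obtain ⟨v, -⟩ := Finset.card_pos.1 hWpos
    exact (hc v).1.trans (hc v).2
  obtain ⟨A, hAW, hAc, θ, hθ0, hθM, hθA, hθW⟩ := exists_top W c M hM0 hc
    ⌈(1 / (t : ℝ) + 2 * γ) * W.card⌉₊ (by
      rw [Nat.ceil_le]
      nlinarith)
  have hA1 : (1 / (t : ℝ) + 2 * γ) * W.card ≤ A.card := by rw [hAc]; exact Nat.le_ceil _
  have hA2 : (A.card : ℝ) ≤ (1 / (t : ℝ) + 3 * γ) * W.card := by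
    rw [hAc]
    refine (Nat.ceil_lt_add_one (mul_nonneg (by linarith) hs0.le)).le.trans ?_
    linarith
  have hApos' : (0 : ℝ) < A.card := lt_of_lt_of_le (mul_pos (by linarith) hs0) hA1
  have hApos : 0 < A.card := by exact_mod_cast hApos'
  have hAt : (W.card : ℝ) / t ≤ A.card := by
    refine le_trans ?_ hA1
    rw [add_mul, one_div, div_eq_inv_mul]
    have : 0 ≤ 2 * γ * W.card := mul_nonneg (by linarith) hs0.le
    linarith
  obtain ⟨D, hD⟩ : ∃ D, D = (∑ x ∈ A, (c x - θ)) / A.card := ⟨_, rfl⟩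
  have hDsum : ∑ x ∈ A, (c x - θ) = A.card * D := by rw [hD]; field_simp
  have hfA : ∀ x ∈ A, 0 ≤ c x - θ ∧ c x - θ ≤ M := fun x hx =>
    ⟨by linarith [hθA x hx], by linarith [(hc x).2]⟩
  have hD0 : 0 ≤ D := hD ▸ div_nonneg (Finset.sum_nonneg fun x hx => (hfA x hx).1) hApos'.le
  have hDM : D ≤ M := by
    rw [hD, div_le_iff₀ hApos']
    calc _ ≤ ∑ x ∈ A, M := Finset.sum_le_sum fun x hx => (hfA x hx).2
      _ = _ := by rw [Finset.sum_const, nsmul_eq_mul, mul_comm]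
  have hsumW : ∑ v ∈ W, c v ≤ W.card * (θ + (1 / t + 3 * γ) * D) := by
    have h1 : ∑ v ∈ W, c v = ∑ v ∈ W \ A, c v + ∑ v ∈ A, c v := (Finset.sum_sdiff hAW).symm
    have h2 : ∑ v ∈ W \ A, c v ≤ ∑ v ∈ W \ A, θ := Finset.sum_le_sum hθW
    have h3 : ∑ v ∈ A, c v = ∑ v ∈ A, (c v - θ) + ∑ v ∈ A, θ := by
      rw [← Finset.sum_add_distrib]; simp
    have h4 : ∑ v ∈ W \ A, θ + ∑ v ∈ A, θ = W.card * θ := by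
      rw [Finset.sum_sdiff hAW]; simp
    have h5 : A.card * D ≤ (1 / (t : ℝ) + 3 * γ) * W.card * D :=
      mul_le_mul_of_nonneg_right hA2 hD0
    linarith
  have hAmiss : ∀ σ, Face E σ → σ.card < k → q * W.card ≤ ((A \ miss E σ).card : ℝ) := by
    intro σ hσ hσk
    have h1 := hR σ hσ hσk
    have h2 : A.card ≤ (A \ miss E σ).card + (miss E σ ∩ W).card := by
      have h3 : A ⊆ (A \ miss E σ) ∪ (miss E σ ∩ W) := by
        intro x hx
        by_cases h : x ∈ miss E σ
        · exact Finset.mem_union_right _ (Finset.mem_inter.2 ⟨h, hAW hx⟩)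
        · exact Finset.mem_union_left _ (Finset.mem_sdiff.2 ⟨hx, h⟩)
      exact (Finset.card_le_card h3).trans (Finset.card_union_le _ _)
    have h3 : (A.card : ℝ) ≤ (A \ miss E σ).card + (miss E σ ∩ W).card := by exact_mod_cast h2
    have h4 : q * W.card ≤ γ * W.card := mul_le_mul_of_nonneg_right hqγ' hs0.le
    linarith
  have finish : ∀ w : ℕ → ℕ, (∀ a, d ∣ a → a + k ≤ L → Set.InjOn w (Finset.Ico a (a + k) : Finset ℕ)) →
      Set.InjOn w (Finset.Ico 0 (k - 1) : Finset ℕ) →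
      Set.InjOn w (Finset.Ico (L - (k - 1)) L : Finset ℕ) → ∀ (p : ℕ → Fin n), (∀ j < L, p j ∈ A) →
      Set.InjOn p {j | j < L} →
      (∀ J : Finset ℕ, (∀ j ∈ J, j < L) → Set.InjOn w J → Face E (J.image p)) →
      ∀ b (Q : ℕ → Prop) [DecidablePred Q], (∀ j < L, Q j → θ + b ≤ c (p j)) →
      (1 / (t : ℝ) + 3 * γ) * D * N ≤ ((Finset.range L).filter Q).card * b + η / 2 * N * M →
      ∃ C P : List (Fin n), (C ++ P).Nodup ∧ (∀ v ∈ C ++ P, v ∈ W) ∧ d ∣ C.length ∧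
        (C ++ P).length = N ∧ k ≤ P.length ∧ FT k E (S ++ C ++ P.take (k - 1)) ∧ AW d k E P ∧
        Face E (P.drop (P.length - (k - 1))).toFinset ∧
        N * ∑ v ∈ W, c v ≤ W.card * (∑ v ∈ (C ++ P).toFinset, c v + η * N * M) := by
    intro w hw1 hw2 hw3 p hpA hpi hpf b Q _ hQ hsum
    have h40 : (40 * L : ℝ) ≤ W.card := by exact_mod_cast (by omega : 40 * L ≤ W.card)
    obtain ⟨C, P, h1, h2, h3, h4, h5, h6, h7, h8⟩ := exists_tile_of_pattern (by omega) (hconn n E) hE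
      hkL hw1 hw2 hw3 hR (by nlinarith) (by omega) (fun j hj => hAW (hpA j hj)) hpi hpf hS hSf
    refine ⟨C, P, h1, h2, h3 ▸ hdLc, by rw [List.length_append, h3, h4, hN], by omega, h5, h6,
      by rwa [h4], ?_⟩
    have h9 := le_sum_pattern hpi C (fun v => (hc v).1) (θ := θ) (b := b) (P := Q)
      (fun j hj => hθA _ (hpA j hj)) hQ
    rw [← h8] at h9
    have h10 : (Lc : ℝ) * θ ≤ η / 2 * N * M := by
      calc (Lc : ℝ) * θ ≤ η / 2 * N * θ := mul_le_mul_of_nonneg_right (by linarith) hθ0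
        _ ≤ _ := mul_le_mul_of_nonneg_left hθM (by linarith)
    calc (N : ℝ) * ∑ v ∈ W, c v ≤ N * (W.card * (θ + (1 / t + 3 * γ) * D)) :=
          mul_le_mul_of_nonneg_left hsumW (Nat.cast_nonneg _)
      _ = W.card * (Lc * θ + L * θ + (1 / t + 3 * γ) * D * N) := by rw [hNr]; ring
      _ ≤ _ := mul_le_mul_of_nonneg_left (by linarith) hs0.le
  have hN0 : (0 : ℝ) ≤ N := Nat.cast_nonneg _
  have hAγ : γ * W.card ≤ A.card := by
    exact le_trans (mul_le_mul_of_nonneg_right (by linarith) hs0.le) hA1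
  have hqγ : q * W.card ≤ γ * W.card := mul_le_mul_of_nonneg_right hqγ' hs0.le
  have hw1 : ∀ a, d ∣ a → a + k ≤ L → Set.InjOn (tileWord k t m) (Finset.Ico a (a + k) : Finset ℕ) :=
    fun a ha hal => tileWord_injOn_window (by omega) (by omega) hdt hkt htk hdk ha (hL ▸ hal)
  have hw2 : Set.InjOn (tileWord k t m) (Finset.Ico 0 (k - 1) : Finset ℕ) :=
    tileWord_injOn_first (by omega) (by omega) (by omega)
  have hw3 : Set.InjOn (tileWord k t m) (Finset.Ico (L - (k - 1)) L : Finset ℕ) :=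
    hL ▸ tileWord_injOn_last (by omega) (by omega) hkt (by omega)
  rcases le_or_gt D (η / 4 * M) with hDs | hDl
  · obtain ⟨p, hpA, hpi, -, -, hpf⟩ := hs₁ n E W A A A (by omega) hAW subset_rfl subset_rfl hsing
      hAmiss (hqγ.trans hAγ) (fun x _ => hAmiss {x} (hsing x) (by rw [Finset.card_singleton]; omega))
    refine finish _ hw1 hw2 hw3 p hpA hpi hpf 0 (fun _ => False) (by simp) ?_
    have h1 : (1 / (t : ℝ) + 3 * γ) * D * N ≤ 1 * D * N :=
      mul_le_mul_of_nonneg_right (mul_le_mul_of_nonneg_right (by linarith) hD0) hN0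
    have h2 : 1 * D * N ≤ η / 4 * M * N := mul_le_mul_of_nonneg_right (by linarith) hN0
    have h3 : 0 ≤ η * M * N := mul_nonneg (mul_nonneg hη.le hM0) hN0
    simp only [mul_zero, zero_add]
    linarith
  by_cases hhi : ζ * (η / 4) * A.card ≤ ((A.filter fun x => (1 + ζ) * D ≤ c x - θ).card : ℝ)
  · obtain ⟨p, hpA, hpi, hp0, -, hpf⟩ := hs₁ n E W A (A.filter fun x => (1 + ζ) * D ≤ c x - θ) A
      (by omega) hAW (Finset.filter_subset _ _) subset_rfl hsing hAmiss (by
        refine le_trans ?_ hhi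
        calc q * W.card ≤ ζ * (η / 4) / t * W.card :=
              mul_le_mul_of_nonneg_right hqζ hs0.le
          _ = ζ * (η / 4) * (W.card / t) := by ring
          _ ≤ _ := mul_le_mul_of_nonneg_left hAt (mul_nonneg hζ0.le (by linarith)))
      (fun x _ => hAmiss {x} (hsing x) (by rw [Finset.card_singleton]; omega))
    refine finish _ hw1 hw2 hw3 p hpA hpi hpf ((1 + ζ) * D) (fun j => tileWord k t m j = 0)
      (fun j hj h => by have := (Finset.mem_filter.1 (hp0 j hj h)).2; linarith) ?_
    have h1 : (m : ℝ) ≤ ((Finset.range L).filter fun j => tileWord k t m j = 0).card := by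
      rw [hL]
      exact_mod_cast le_card_tileWord_zero (by omega)
    have h2 : (1 / (t : ℝ) + 3 * γ) * D * N = (1 + ζ) * D * (N / t) := by
      rw [hζ]; field_simp
    have h3 : (N : ℝ) / t ≤ m + (1 + Lc) := by
      rw [div_le_iff₀ (by positivity), hNr]
      have : (Lc : ℝ) ≤ Lc * t := by nlinarith [show (0 : ℝ) ≤ Lc by positivity]
      linarith
    have hLc0 : (0 : ℝ) ≤ Lc := Nat.cast_nonneg _
    have hb0 : 0 ≤ (1 + ζ) * D := mul_nonneg (by linarith) hD0
    have h4 : (1 + ζ) * D * (1 + Lc) ≤ η / 2 * N * M := by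
      calc (1 + ζ) * D * (1 + Lc) ≤ 2 * M * (1 + Lc) :=
            mul_le_mul_of_nonneg_right (mul_le_mul (by linarith) hDM hD0 (by norm_num)) (by linarith)
        _ = 2 * (1 + Lc) * M := by ring
        _ ≤ _ := mul_le_mul_of_nonneg_right (by linarith) hM0
    rw [h2]
    calc _ ≤ (1 + ζ) * D * (m + (1 + Lc)) := mul_le_mul_of_nonneg_left h3 hb0
      _ = m * ((1 + ζ) * D) + (1 + ζ) * D * (1 + Lc) := by ring
      _ ≤ _ := add_le_add (mul_le_mul_of_nonneg_right h1 hb0) h4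
  · have hX := excess_cases A (fun x => c x - θ) (M := M) (D := D) hζ0 hξ0 hApos hfA hDsum hDl
      (not_le.1 hhi)
    obtain ⟨X, hXdef⟩ : ∃ X, X = A.filter fun x => (1 - ξ) * D ≤ c x - θ := ⟨_, rfl⟩
    have hXA : X ⊆ A := hXdef ▸ Finset.filter_subset _ _
    rw [← hXdef] at hX
    have hXW : (1 / t - 24 * k * γ) * W.card ≤ (X.card : ℝ) := by
      have h1 : 1 - 2 * ζ / ξ = 1 - 24 * k * t * γ := by
        rw [hζ, hξ]; field_simp; ring
      rw [h1] at hX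
      have hWt : (1 / t - 24 * k * γ) * W.card = (1 - 24 * k * t * γ) * (W.card / t) := by
        have h3 : (t : ℝ) * (W.card / t) = W.card := mul_div_cancel₀ _ (by linarith)
        linear_combination (24 * k * γ) * h3
      by_cases h2 : 0 ≤ 1 - 24 * k * t * γ
      · refine le_trans ?_ hX
        calc (1 / t - 24 * k * γ) * W.card = (1 - 24 * k * t * γ) * (W.card / t) := hWt
          _ ≤ _ := mul_le_mul_of_nonneg_left hAt h2
      · have h4 : 0 ≤ (W.card : ℝ) / t := div_nonneg hs0.le (Nat.cast_nonneg _)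
        rw [hWt]
        refine le_trans ?_ (Nat.cast_nonneg _)
        exact mul_nonpos_of_nonpos_of_nonneg (by linarith) h4
    obtain ⟨X₀, hX₀, hX₀c, hX₀m⟩ := hNE X (hXA.trans hAW) hXW
    have hqρ : q * W.card ≤ ρ * W.card := mul_le_mul_of_nonneg_right hqρ' hs0.le
    obtain ⟨p, hpA, hpi, hp0, hp1, hpf⟩ := hs₂ n E W A X₀ X (by omega) hAW
      (hX₀.trans hXA) hXA hsing hAmiss
      (hqρ.trans hX₀c) (fun x hx => hqρ.trans (hX₀m x hx))
    have hpX : ∀ j < L, j % k < 2 → p j ∈ X := by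
      intro j hj h
      rcases Nat.lt_or_ge (j % k) 1 with h0 | h0
      · exact hX₀ (hp0 j hj (by omega))
      · exact hp1 j hj (by omega)
    refine finish _ (fun a _ _ => injOn_mod le_rfl) (injOn_mod (by omega)) (injOn_mod (by omega)) p
      hpA hpi hpf ((1 - ξ) * D) (fun j => j % k < 2)
      (fun j hj h => by have := (Finset.mem_filter.1 (hXdef ▸ hpX j hj h)).2; linarith) ?_
    have hξ1 : ξ ≤ 1 := by
      rw [hξ, div_le_one (by positivity)]; linarith
    have h1 : 2 * ((L : ℝ) / k) - 2 ≤ ((Finset.range L).filter fun j => j % k < 2).card := by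
      have h2 : (2 * (L / k) : ℕ) ≤ ((Finset.range L).filter fun j => j % k < 2).card :=
        le_card_mod_lt_two (by omega)
      have h3 : L < k * (L / k + 1) := Nat.lt_mul_div_succ L (by omega)
      have h4 : (L : ℝ) / k ≤ (L / k : ℕ) + 1 := by
        rw [div_le_iff₀ (by positivity)]
        have : (L : ℝ) ≤ k * ((L / k : ℕ) + 1) := by exact_mod_cast h3.le
        linarith
      have h5 : (2 * ((L / k : ℕ) : ℝ)) ≤ ((Finset.range L).filter fun j => j % k < 2).card := by
        exact_mod_cast h2
      linarith
    have h2 : 1 / (t : ℝ) + 3 * γ ≤ (1 - ξ) * (2 / k) := by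
      have e1 : 1 / (t : ℝ) ≤ 2 / (k + 1) := by
        rw [div_le_div_iff₀ (by positivity) (by positivity)]; linarith
      have e2 : 3 * γ ≤ 1 / k ^ 2 := by
        rw [le_div_iff₀ (by positivity)]; linarith
      have e3 : 2 / ((k : ℝ) + 1) + 1 / k ^ 2 ≤ (1 - ξ) * (2 / k) := by
        rw [hξ, div_add_div _ _ (by positivity) (by positivity),
          show (1 - 1 / (4 * (k : ℝ))) * (2 / k) = (4 * k - 1) / (2 * k ^ 2) by field_simp; ring,
          div_le_div_iff₀ (by positivity) (by positivity)]
        have : (0 : ℝ) < k ^ 2 := by positivity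
        nlinarith
      linarith
    have h3 : (1 - ξ) * D * (2 * ((Lc : ℝ) / k) + 2) ≤ η / 2 * N * M := by
      have e0 : (0 : ℝ) ≤ Lc := Nat.cast_nonneg _
      have e2 : 0 ≤ (Lc : ℝ) / k := div_nonneg e0 (by linarith)
      have e1 : (Lc : ℝ) / k ≤ Lc := div_le_self e0 (by linarith)
      calc (1 - ξ) * D * (2 * ((Lc : ℝ) / k) + 2) ≤ 1 * M * (2 * Lc + 2) :=
            mul_le_mul (mul_le_mul (by linarith) hDM hD0 zero_le_one) (by linarith)
              (by linarith) (by linarith)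
        _ = (2 * Lc + 2) * M := by ring
        _ ≤ _ := mul_le_mul_of_nonneg_right (by linarith) hM0
    have hb0 : 0 ≤ (1 - ξ) * D := mul_nonneg (by linarith) hD0
    calc _ ≤ (1 - ξ) * (2 / k) * D * N :=
        mul_le_mul_of_nonneg_right (mul_le_mul_of_nonneg_right h2 hD0) hN0
      _ = (2 * (L / k) - 2) * ((1 - ξ) * D) + (1 - ξ) * D * (2 * (Lc / k) + 2) := by
        rw [hNr]; field_simp; ring
      _ ≤ _ := add_le_add (mul_le_mul_of_nonneg_right h1 hb0) h3

end heavytile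

section nibble

variable {V : Type*} [DecidableEq V]

/-- The exponential weight measuring how far a subset `V'` of `V₀` over-represents `F`. -/
noncomputable def nibbleWeight (V₀ : Finset V) (lam : ℝ) (V' F : Finset V) : ℝ :=
  Real.exp (lam * ((F ∩ V').card - (F ∩ V₀).card / V₀.card * V'.card))

theorem nibbleWeight_step {ℱ : Finset (Finset V)} {V₀ V' Q : Finset V} {κ lam m : ℝ} {N : ℕ}
    (hN : 1 ≤ N) (hκ : 0 < κ) (hκ1 : κ ≤ 1) (hlam : lam * N = κ) (hm : 0 < m)
    (hV : V₀ ∈ ℱ) (hexp : ℱ.card * Real.exp (-(lam * κ * m)) ≤ κ) (hV' : V' ⊆ V₀)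
    (hmV : m ≤ V'.card) (hQ : Q ⊆ V') (hQN : Q.card = N)
    (hc : N * ∑ v ∈ V', ∑ F ∈ ℱ with v ∈ F, nibbleWeight V₀ lam V' F ≤
      V'.card * (∑ v ∈ Q, ∑ F ∈ ℱ with v ∈ F, nibbleWeight V₀ lam V' F +
        κ * N * ∑ F ∈ ℱ, nibbleWeight V₀ lam V' F)) :
    ∑ F ∈ ℱ, nibbleWeight V₀ lam (V' \ Q) F ≤
      Real.exp (4 * κ ^ 2) * ∑ F ∈ ℱ, nibbleWeight V₀ lam V' F := by
  have hNr : (0 : ℝ) < N := by exact_mod_cast hN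
  have hlam0 : 0 < lam := by
    by_contra h
    nlinarith
  set w := nibbleWeight V₀ lam V' with hw
  set φ : Finset V → ℝ := fun F => (F ∩ V₀).card / V₀.card with hφ
  have hs : (0 : ℝ) < V'.card := hm.trans_le hmV
  have hs0 : (0 : ℝ) < V₀.card := hs.trans_le (by exact_mod_cast Finset.card_le_card hV')
  have hw0 : ∀ F, 0 < w F := fun F => Real.exp_pos _
  have hφ0 : ∀ F, 0 ≤ φ F := fun F => by positivity
  have hφ1 : ∀ F, φ F ≤ 1 := fun F => by
    rw [hφ, div_le_one hs0]
    exact_mod_cast Finset.card_le_card Finset.inter_subset_right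
  have hdc : ∀ B : Finset V, ∑ v ∈ B, ∑ F ∈ ℱ with v ∈ F, w F = ∑ F ∈ ℱ, w F * (F ∩ B).card := by
    intro B
    simp_rw [Finset.sum_filter]
    rw [Finset.sum_comm]
    refine Finset.sum_congr rfl fun F _ => ?_
    rw [← Finset.sum_filter, Finset.sum_const, nsmul_eq_mul, mul_comm, Finset.filter_mem_eq_inter,
      Finset.inter_comm]
  rw [hdc, hdc] at hc
  set Φ := ∑ F ∈ ℱ, w F with hΦ
  have hΦ1 : 1 ≤ Φ := by
    have h1 : w V₀ = 1 := by
      simp only [hw, nibbleWeight]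
      rw [Finset.inter_eq_right.2 hV', Finset.inter_self, div_self hs0.ne']
      simp
    rw [← h1]
    exact Finset.single_le_sum (fun F _ => (hw0 F).le) hV
  have hstep : ∀ F ∈ ℱ, nibbleWeight V₀ lam (V' \ Q) F ≤
      w F * (1 + κ ^ 2) + lam * (N * (φ F * w F) - w F * (F ∩ Q).card) := by
    intro F _
    set z := lam * (φ F * N - (F ∩ Q).card) with hz
    have e1 : nibbleWeight V₀ lam (V' \ Q) F = w F * Real.exp z := by
      simp only [hw, nibbleWeight, hz]
      rw [← Real.exp_add]
      congr 1
      have c1 : ((V' \ Q).card : ℝ) = V'.card - N := by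
        rw [Finset.card_sdiff_of_subset hQ, Nat.cast_sub (Finset.card_le_card hQ), hQN]
      have c2 : ((F ∩ (V' \ Q)).card : ℝ) = (F ∩ V').card - (F ∩ Q).card := by
        rw [← Nat.cast_sub (Finset.card_le_card (Finset.inter_subset_inter_left hQ)),
          ← Finset.card_sdiff_of_subset (Finset.inter_subset_inter_left hQ)]
        congr 2
        ext x
        simp only [Finset.mem_inter, Finset.mem_sdiff]
        tauto
      rw [c1, c2]
      simp only [hφ]
      ring
    have hFQ : ((F ∩ Q).card : ℝ) ≤ N := by
      rw [← hQN]; exact_mod_cast Finset.card_le_card Finset.inter_subset_right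
    have hFQ0 : (0 : ℝ) ≤ (F ∩ Q).card := Nat.cast_nonneg _
    have hz1 : |z| ≤ κ := by
      rw [← hlam, hz, abs_mul, abs_of_pos hlam0]
      refine mul_le_mul_of_nonneg_left ?_ hlam0.le
      have := mul_le_mul_of_nonneg_right (hφ1 F) hNr.le
      have := mul_nonneg (hφ0 F) hNr.le
      rw [abs_le]
      constructor <;> linarith
    have h2 := Real.abs_exp_sub_one_sub_id_le (hz1.trans hκ1)
    have h3 : z ^ 2 ≤ κ ^ 2 := by
      rw [← sq_abs]; exact pow_le_pow_left₀ (abs_nonneg _) hz1 2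
    have h4 : Real.exp z ≤ 1 + z + κ ^ 2 := by linarith [(abs_le.1 h2).2]
    rw [e1]
    calc w F * Real.exp z ≤ w F * (1 + z + κ ^ 2) := mul_le_mul_of_nonneg_left h4 (hw0 F).le
      _ = _ := by rw [hz]; ring
  have hbal : ∑ F ∈ ℱ, w F * (φ F * V'.card - (F ∩ V').card) ≤ V'.card * (2 * κ * Φ) := by
    have h1 : ∀ F ∈ ℱ, w F * (φ F * V'.card - (F ∩ V').card) ≤
        V'.card * (κ * w F + Real.exp (-(lam * κ * m))) := by
      intro F _
      rcases le_or_gt ((φ F - κ) * V'.card) ((F ∩ V').card) with h | h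
      · have e1 : w F * (φ F * V'.card - (F ∩ V').card) ≤ w F * (κ * V'.card) :=
          mul_le_mul_of_nonneg_left (by linarith) (hw0 F).le
        have e2 := mul_pos hs (Real.exp_pos (-(lam * κ * m)))
        linarith
      · have e1 : w F ≤ Real.exp (-(lam * κ * m)) := by
          simp only [hw, nibbleWeight]
          rw [Real.exp_le_exp]
          have a1 : lam * ((F ∩ V').card - φ F * V'.card) ≤ lam * (-(κ * V'.card)) :=
            mul_le_mul_of_nonneg_left (by linarith) hlam0.le
          have a2 : lam * κ * m ≤ lam * κ * V'.card :=
            mul_le_mul_of_nonneg_left hmV (by positivity)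
          simp only [hφ] at a1
          linarith
        have e2 : φ F * V'.card - (F ∩ V').card ≤ V'.card := by
          have := mul_le_mul_of_nonneg_right (hφ1 F) hs.le
          have : (0 : ℝ) ≤ (F ∩ V').card := Nat.cast_nonneg _
          linarith
        have e3 := mul_le_mul_of_nonneg_left e2 (hw0 F).le
        have e4 := mul_le_mul_of_nonneg_right e1 hs.le
        have e5 := mul_pos hs (mul_pos hκ (hw0 F))
        linarith
    refine (Finset.sum_le_sum h1).trans ?_
    rw [← Finset.mul_sum, Finset.sum_add_distrib, ← Finset.mul_sum, Finset.sum_const, nsmul_eq_mul]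
    refine mul_le_mul_of_nonneg_left ?_ hs.le
    have := mul_le_mul_of_nonneg_left hΦ1 hκ.le
    linarith
  have hsum := Finset.sum_le_sum hstep
  rw [Finset.sum_add_distrib, ← Finset.sum_mul, ← Finset.mul_sum, Finset.sum_sub_distrib,
    ← Finset.mul_sum] at hsum
  have hbal' : ∑ F ∈ ℱ, φ F * w F * V'.card - ∑ F ∈ ℱ, w F * (F ∩ V').card ≤
      V'.card * (2 * κ * Φ) := by
    rw [← Finset.sum_sub_distrib]
    refine le_trans (le_of_eq (Finset.sum_congr rfl fun F _ => by ring)) hbal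
  rw [← Finset.sum_mul] at hbal'
  have hkey : N * ∑ F ∈ ℱ, φ F * w F - ∑ F ∈ ℱ, w F * (F ∩ Q).card ≤ 3 * κ * N * Φ := by
    have e1 := mul_le_mul_of_nonneg_left hbal' hNr.le
    have : (V'.card : ℝ) * (N * ∑ F ∈ ℱ, φ F * w F - ∑ F ∈ ℱ, w F * (F ∩ Q).card) ≤
        V'.card * (3 * κ * N * Φ) := by linarith
    exact le_of_mul_le_mul_left this hs
  have e2 := mul_le_mul_of_nonneg_left hkey hlam0.le
  have e3 : lam * (3 * κ * N * Φ) = 3 * κ ^ 2 * Φ := by rw [← hlam]; ring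
  have e4 : 4 * κ ^ 2 + 1 ≤ Real.exp (4 * κ ^ 2) := Real.add_one_le_exp _
  have e5 := mul_le_mul_of_nonneg_right e4 (zero_le_one.trans hΦ1)
  linarith

/-- Iterated removal of heavy sets: an oracle finding heavy `N`-sets for arbitrary weights lets
us exhaust `V₀` while keeping the density of every member of `ℱ` under control. -/
theorem exists_exhaust {ℱ : Finset (Finset V)} {V₀ : Finset V} {κ m : ℝ} {N : ℕ}
    (hN : 1 ≤ N) (hκ : 0 < κ) (hκ1 : κ ≤ 1) (hm : 0 < m) (hV : V₀ ∈ ℱ)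
    (hexp : ℱ.card * Real.exp (-(κ / N * κ * m)) ≤ κ)
    (hlog : (ℱ.card : ℝ) ≤ Real.exp (κ / N * κ * V₀.card)) (R : Finset V → Prop) (hR : R V₀)
    (horacle : ∀ V' ⊆ V₀, R V' → m ≤ V'.card →
      (∀ F ∈ ℱ, ((F ∩ V').card : ℝ) ≤ (F ∩ V₀).card / V₀.card * V'.card + 5 * κ * V₀.card) →
      ∀ (c : V → ℝ) (M : ℝ), (∀ v, 0 ≤ c v ∧ c v ≤ M) →
        ∃ Q ⊆ V', Q.card = N ∧ R (V' \ Q) ∧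
          N * ∑ v ∈ V', c v ≤ V'.card * (∑ v ∈ Q, c v + κ * N * M)) :
    ∃ V' ⊆ V₀, R V' ∧ (V'.card : ℝ) < m := by
  have hNr : (0 : ℝ) < N := by exact_mod_cast hN
  set lam := κ / N with hlam
  have hlamN : lam * N = κ := div_mul_cancel₀ _ hNr.ne'
  have hlam0 : 0 < lam := by positivity
  have key : ∀ s : ℕ, ∀ V' ⊆ V₀, V'.card = s → R V' → ∑ F ∈ ℱ, nibbleWeight V₀ lam V' F ≤
      ℱ.card * Real.exp (4 * κ * lam * (V₀.card - V'.card)) →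
      ∃ V' ⊆ V₀, R V' ∧ (V'.card : ℝ) < m := by
    intro s
    induction s using Nat.strong_induction_on with
    | _ s ih =>
      intro V' hV' hs hRV' hΦ
      rcases lt_or_ge (V'.card : ℝ) m with hlt | hge
      · exact ⟨V', hV', hRV', hlt⟩
      have hdens : ∀ F ∈ ℱ, ((F ∩ V').card : ℝ) ≤
          (F ∩ V₀).card / V₀.card * V'.card + 5 * κ * V₀.card := by
        intro F hF
        have h1 : nibbleWeight V₀ lam V' F ≤ ∑ F ∈ ℱ, nibbleWeight V₀ lam V' F :=
          Finset.single_le_sum (f := nibbleWeight V₀ lam V') (fun F _ => (Real.exp_pos _).le) hF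
        have h2 : (ℱ.card : ℝ) * Real.exp (4 * κ * lam * (V₀.card - V'.card)) ≤
            Real.exp (lam * κ * V₀.card) * Real.exp (4 * κ * lam * V₀.card) := by
          refine mul_le_mul hlog ?_ (Real.exp_pos _).le (Real.exp_pos _).le
          rw [Real.exp_le_exp]
          refine mul_le_mul_of_nonneg_left ?_ (by positivity)
          linarith [(Nat.cast_nonneg V'.card : (0 : ℝ) ≤ _)]
        rw [← Real.exp_add] at h2
        have h3 := h1.trans (hΦ.trans h2)
        rw [nibbleWeight, Real.exp_le_exp] at h3
        have h4 : lam * ((F ∩ V').card - (F ∩ V₀).card / V₀.card * V'.card) ≤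
            lam * (5 * κ * V₀.card) := by linarith
        have := le_of_mul_le_mul_left h4 hlam0
        linarith
      obtain ⟨Q, hQ, hQN, hRQ, hQc⟩ := horacle V' hV' hRV' hge hdens
        (fun v => ∑ F ∈ ℱ with v ∈ F, nibbleWeight V₀ lam V' F)
        (∑ F ∈ ℱ, nibbleWeight V₀ lam V' F) (fun v =>
          ⟨Finset.sum_nonneg fun F _ => (Real.exp_pos _).le,
            Finset.sum_le_sum_of_subset_of_nonneg (Finset.filter_subset _ _)
              fun F _ _ => (Real.exp_pos _).le⟩)
      have hstep := nibbleWeight_step hN hκ hκ1 hlamN hm hV hexp hV' hge hQ hQN hQc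
      have hcard : (V' \ Q).card = s - N := by rw [Finset.card_sdiff_of_subset hQ, hs, hQN]
      have hNs : N ≤ s := by rw [← hs, ← hQN]; exact Finset.card_le_card hQ
      refine ih (s - N) (by omega) (V' \ Q) (Finset.sdiff_subset.trans hV') hcard hRQ ?_
      refine hstep.trans ((mul_le_mul_of_nonneg_left hΦ (Real.exp_pos _).le).trans (le_of_eq ?_))
      rw [mul_left_comm, ← Real.exp_add, hcard, Nat.cast_sub hNs, hs]
      congr 2
      rw [← hlamN]
      ring
  refine key _ V₀ subset_rfl rfl hR ?_
  rw [sub_self, mul_zero, Real.exp_zero, mul_one,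
    show (ℱ.card : ℝ) = ∑ F ∈ ℱ, (1 : ℝ) by simp]
  refine Finset.sum_le_sum fun F _ => ?_
  rw [nibbleWeight]
  rcases eq_or_ne (V₀.card : ℝ) 0 with h | h
  · rw [Nat.cast_eq_zero, Finset.card_eq_zero] at h
    simp [h]
  · rw [div_mul_cancel₀ _ h]
    simp

end nibble

section closing
variable {n : ℕ} {E : Finset (Finset (Fin n))} {k d : ℕ}

theorem AW.glue_ft (hE : ∀ e ∈ E, e.card = k) {a S b : List (Fin n)} (h1 : AW d k E (a ++ S))
    (h2 : FT k E (S ++ b)) (hn : (S ++ b).Nodup) (hS : k - 1 ≤ S.length) :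
    AW d k E (a ++ S ++ b) := by
  intro i hdi hik
  by_cases hi : a.length ≤ i
  · have h3 := FT.aw (d := 1) hE h2 hn (i - a.length) (one_dvd _) (by simp at *; omega)
    rwa [List.append_assoc, List.drop_append, List.drop_of_length_le hi, List.nil_append]
  · have h3 := h1 i hdi (by simp; omega)
    rwa [List.drop_append_of_le_length (by simp; omega),
      List.take_append_of_le_length (by simp; omega)]

/-- A cyclic ordering of all vertices whose aligned windows are edges. -/
def CycleList (d k : ℕ) (E : Finset (Finset (Fin n))) (l : List (Fin n)) : Prop :=
  l.Nodup ∧ l.length = n ∧ AW d k E (l ++ l.take (k - 1))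

theorem CycleList.hamCycle {l : ℕ} {L : List (Fin n)} (h : CycleList (k - l) k E L)
    (hk : 1 ≤ k) (hkn : k ≤ n) (hd : 1 ≤ k - l) (hdn : (k - l) ∣ n) : HamCycle k l E := by
  obtain ⟨hnd, hlen, haw⟩ := h
  have : NeZero n := ⟨by omega⟩
  have hlt : ∀ x : ZMod n, x.val < L.length := fun x => hlen.symm ▸ ZMod.val_lt x
  have hinj : Function.Injective fun x : ZMod n => L[x.val]'(hlt x) := fun x y hxy =>
    ZMod.val_injective n ((List.Nodup.getElem_inj_iff hnd).1 hxy)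
  refine ⟨fun x => L[x.val]'(hlt x), ?_, fun i => ?_⟩
  · rw [Fintype.bijective_iff_injective_and_card]
    exact ⟨hinj, by simp [ZMod.card]⟩
  set d := k - l
  have hmod : d ∣ (i * d) % n := (Nat.dvd_mod_iff hdn).2 (dvd_mul_left d i)
  have hlt' : (i * d) % n < n := Nat.mod_lt _ (by omega)
  have h1 := haw ((i * d) % n) hmod (by simp; omega)
  convert h1 using 1
  ext v
  simp only [Finset.mem_image, Finset.mem_univ, true_and, List.mem_toFinset]
  have hget : ∀ j < k, ∀ hj : (i * d) % n + j < (L ++ L.take (k - 1)).length,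
      (L ++ L.take (k - 1))[(i * d) % n + j] =
        L[((i * d + j : ℕ) : ZMod n).val]'(hlt _) := by
    intro j hj hj'
    have hv : ((i * d + j : ℕ) : ZMod n).val = ((i * d) % n + j) % n := by
      rw [ZMod.val_natCast, Nat.mod_add_mod]
    rcases lt_or_ge ((i * d) % n + j) n with hlt2 | hge
    · rw [List.getElem_append_left (by omega)]
      congr 1
      rw [hv, Nat.mod_eq_of_lt hlt2]
    · rw [List.getElem_append_right (by omega), List.getElem_take]
      congr 1
      have hr : ((i * d) % n + j) % n = (i * d) % n + j - n := by
        generalize (i * d) % n = r at *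
        rw [Nat.mod_eq_sub_mod hge, Nat.mod_eq_of_lt (by omega)]
      rw [hv, hr, hlen]
  constructor
  · rintro ⟨j, rfl⟩
    rw [List.mem_iff_getElem]
    refine ⟨j, by simp; omega, ?_⟩
    rw [List.getElem_take, List.getElem_drop]
    exact hget j j.2 _
  · intro hv
    obtain ⟨j, hj, rfl⟩ := List.mem_iff_getElem.1 hv
    simp only [List.length_take, List.length_drop] at hj
    refine ⟨⟨j, by omega⟩, ?_⟩
    rw [List.getElem_take, List.getElem_drop]
    exact (hget j (by omega) _).symm

/-- An almost path-cover, ready to be extended and closed: `T` covers `X` and can be preceded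
by `Z`. -/
structure Strand (d k : ℕ) (E : Finset (Finset (Fin n))) (Z : List (Fin n)) (X : Finset (Fin n))
    (T : List (Fin n)) : Prop where
  nodup : T.Nodup
  toFinset : T.toFinset = X
  dvd : d ∣ T.length
  le_length : k - 1 ≤ T.length
  aw : AW d k E T
  ft : FT k E (Z ++ T.take (k - 1))
  face : Face E (T.drop (T.length - (k - 1))).toFinset

theorem Strand.extend (hE : ∀ e ∈ E, e.card = k) {Z T C P : List (Fin n)} {X : Finset (Fin n)}
    (h : Strand d k E Z X T) (hn : (C ++ P).Nodup) (hX : ∀ v ∈ C ++ P, v ∉ X) (hC : d ∣ C.length)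
    (hCP : d ∣ (C ++ P).length) (hP : k ≤ P.length)
    (hft : FT k E (T.drop (T.length - (k - 1)) ++ C ++ P.take (k - 1))) (hPaw : AW d k E P)
    (hPf : Face E (P.drop (P.length - (k - 1))).toFinset) :
    Strand d k E Z (X ∪ (C ++ P).toFinset) (T ++ (C ++ P)) := by
  have hT := List.take_append_drop (T.length - (k - 1)) T
  have hTX : ∀ v ∈ T, v ∈ X := fun v hv => h.toFinset ▸ List.mem_toFinset.2 hv
  have hnd : (T ++ (C ++ P)).Nodup := List.nodup_append'.2 ⟨h.nodup, hn, fun v hv hv' =>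
    hX v hv' (hTX v hv)⟩
  have hlen : (T.drop (T.length - (k - 1))).length = k - 1 := by
    have := h.le_length
    simp; omega
  have h1 : AW d k E (T ++ (C ++ P.take (k - 1))) := by
    have h2 := h.aw
    rw [← hT] at h2
    have h3 := AW.glue_ft (b := C ++ P.take (k - 1)) hE h2 (by rwa [← List.append_assoc]) (by
      refine List.Nodup.sublist ?_ hnd
      refine (List.drop_sublist _ _).append (List.Sublist.append (List.Sublist.refl _) ?_)
      exact List.take_sublist _ _) hlen.ge
    rwa [hT] at h3
  refine ⟨hnd, by rw [List.toFinset_append, h.toFinset], ?_, ?_, ?_, ?_, ?_⟩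
  · rw [List.length_append]
    exact dvd_add h.dvd hCP
  · have := h.le_length
    rw [List.length_append]; omega
  · have h2 := AW.glue (a := T ++ C) (S := P.take (k - 1)) (b := P.drop (k - 1))
      (by rwa [List.append_assoc]) (by rwa [List.take_append_drop]) (by simp; omega)
      (by rw [List.length_append]; exact dvd_add h.dvd hC)
    rwa [List.append_assoc (T ++ C), List.take_append_drop, List.append_assoc] at h2
  · rw [List.take_append_of_le_length h.le_length]
    exact h.ft
  · have : (T ++ (C ++ P)).drop ((T ++ (C ++ P)).length - (k - 1)) =
        P.drop (P.length - (k - 1)) := by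
      rw [← List.append_assoc, List.drop_append, List.drop_of_length_le (by simp; omega),
        List.nil_append]
      congr 1
      simp; omega
    rwa [this]

theorem Strand.close (hE : ∀ e ∈ E, e.card = k) {Z T C S mid : List (Fin n)} {X : Finset (Fin n)}
    (h : Strand d k E Z X T) (hS : S.length = k - 1) (hZ : Z.length = k - 1)
    (hft : FT k E (T.drop (T.length - (k - 1)) ++ C ++ S)) (hft' : FT k E (S ++ mid ++ Z))
    (hn : (T ++ C ++ (S ++ mid ++ Z)).Nodup)
    (hu : ∀ v, v ∈ T ++ C ++ (S ++ mid ++ Z)) : CycleList d k E (T ++ C ++ (S ++ mid ++ Z)) := by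
  have hlen : (T.drop (T.length - (k - 1))).length = k - 1 := by
    have := h.le_length
    simp; omega
  refine ⟨hn, ?_, ?_⟩
  · have h1 : (T ++ C ++ (S ++ mid ++ Z)).toFinset = Finset.univ :=
      Finset.eq_univ_of_forall fun v => List.mem_toFinset.2 (hu v)
    rw [← List.toFinset_card_of_nodup hn, h1, Finset.card_univ, Fintype.card_fin]
  have hT := List.take_append_drop (T.length - (k - 1)) T
  have h1 : AW d k E (T ++ (C ++ S)) := by
    have h2 := h.aw
    rw [← hT] at h2
    have h3 := AW.glue_ft (b := C ++ S) hE h2 (by rwa [← List.append_assoc]) (by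
      refine List.Nodup.sublist ?_ hn
      rw [List.append_assoc]
      refine (List.drop_sublist _ _).append (List.Sublist.append (List.Sublist.refl _) ?_)
      rw [List.append_assoc]
      exact List.sublist_append_left _ _) hlen.ge
    rwa [hT] at h3
  have h2 : AW d k E (T ++ C ++ S ++ (mid ++ Z)) :=
    AW.glue_ft hE (by rwa [List.append_assoc]) (by rwa [← List.append_assoc]) (by
      refine List.Nodup.sublist ?_ hn
      rw [← List.append_assoc]
      exact List.sublist_append_right _ _) hS.ge
  have h3 : AW d k E (T ++ C ++ S ++ mid ++ Z ++ T.take (k - 1)) :=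
    AW.glue_ft hE (by simpa [List.append_assoc] using h2) h.ft (by
      have h4 : (T ++ Z).Nodup := List.Nodup.sublist (by
        simp only [List.append_assoc]
        refine List.Sublist.append (List.Sublist.refl _) ?_
        exact (List.sublist_append_right (C ++ (S ++ mid)) Z).trans (by simp)) hn
      exact (List.nodup_append_comm.1 h4).sublist
        (List.Sublist.append (List.Sublist.refl _) (List.take_sublist _ _))) hZ.ge
  have h4 : (T ++ C ++ (S ++ mid ++ Z)).take (k - 1) = T.take (k - 1) := by
    rw [List.append_assoc, List.take_append_of_le_length h.le_length]
  rw [h4]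
  simpa [List.append_assoc] using h3

end closing

section nonextremal
variable {n : ℕ} {E : Finset (Finset (Fin n))} {k d t : ℕ}

/-- The vertices missing `v` and at least `θ` of the vertices missing `v`. -/
noncomputable def denseCore (E : Finset (Finset (Fin n))) (θ : ℝ) (v : Fin n) : Finset (Fin n) :=
  (miss E {v}).filter fun a => θ ≤ ((miss E {a} ∩ miss E {v}).card : ℝ)

theorem exists_spread {τ ρ ρ₁ ρ₂ δ : ℝ} {V : Finset (Fin n)} (hV : 0 < V.card)
    (hθ : ∀ v, ((denseCore E ((τ - ρ) * n) v).card : ℝ) < (τ - ρ) * n)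
    (hpair : ∀ u v, ((miss E {u} ∩ miss E {v} ∩ V).card : ℝ) * n ≤
      ((miss E {u} ∩ miss E {v}).card + δ * n) * V.card)
    (hD : ∀ v, ((denseCore E ((τ - ρ) * n) v ∩ V).card : ℝ) * n ≤
      ((denseCore E ((τ - ρ) * n) v).card + δ * n) * V.card)
    (hρ : ρ₁ + 2 * ρ₂ + δ ≤ ρ) (hτ : ρ₁ + ρ₂ < τ) :
    ∀ X ⊆ V, (τ - ρ₁) * V.card ≤ (X.card : ℝ) → ∃ X₀ ⊆ X, ρ₂ * V.card ≤ (X₀.card : ℝ) ∧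
      ∀ x ∈ X₀, ρ₂ * V.card ≤ ((X \ miss E {x}).card : ℝ) := by
  intro X hXV hX
  have hs : (0 : ℝ) < V.card := by exact_mod_cast hV
  by_contra! hcon
  set X₀ := X.filter fun x => ρ₂ * V.card ≤ ((X \ miss E {x}).card : ℝ) with hX₀
  have hX₀X : X₀ ⊆ X := Finset.filter_subset _ _
  have hX₀c : (X₀.card : ℝ) < ρ₂ * V.card := by
    by_contra! h
    obtain ⟨x, hx, hx'⟩ := hcon X₀ hX₀X h
    exact absurd (Finset.mem_filter.1 hx).2 (not_le.2 hx')
  have hsd : ((X \ X₀).card : ℝ) = X.card - X₀.card := by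
    rw [Finset.card_sdiff_of_subset hX₀X, Nat.cast_sub (Finset.card_le_card hX₀X)]
  have hmem : ∀ x ∈ X \ X₀, ((X \ miss E {x}).card : ℝ) < ρ₂ * V.card := by
    intro x hx
    rw [Finset.mem_sdiff] at hx
    by_contra! h
    exact hx.2 (Finset.mem_filter.2 ⟨hx.1, h⟩)
  have hpos : (0 : ℝ) < (X \ X₀).card := by
    have := mul_pos (sub_pos.2 hτ) hs
    linarith
  obtain ⟨v, hv⟩ := Finset.card_pos.1 (by exact_mod_cast hpos : 0 < (X \ X₀).card)
  have hvX := hmem v hv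
  have hcore : (X \ X₀) \ (X \ miss E {v}) ⊆ denseCore E ((τ - ρ) * n) v ∩ V := by
    intro x hx
    simp only [Finset.mem_sdiff (s := X \ X₀), Finset.mem_sdiff (s := X) (t := miss E {v}),
      not_and, not_not] at hx
    have hxX := (Finset.mem_sdiff.1 hx.1).1
    refine Finset.mem_inter.2 ⟨Finset.mem_filter.2 ⟨hx.2 hxX, ?_⟩, hXV hxX⟩
    have h1 : X ⊆ ((X \ miss E {x}) ∪ (X \ miss E {v})) ∪ (miss E {x} ∩ miss E {v} ∩ V) := by
      intro y hy
      simp only [Finset.mem_union, Finset.mem_sdiff, Finset.mem_inter]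
      have := hXV hy
      tauto
    have h2 : (X.card : ℝ) ≤ (X \ miss E {x}).card + (X \ miss E {v}).card +
        (miss E {x} ∩ miss E {v} ∩ V).card := by
      exact_mod_cast (Finset.card_le_card h1).trans ((Finset.card_union_le _ _).trans
        (Nat.add_le_add_right (Finset.card_union_le _ _) _))
    have h3 := hmem x hx.1
    have h4 := hpair x v
    have h5 : (τ - ρ₁ - 2 * ρ₂) * V.card ≤ (miss E {x} ∩ miss E {v} ∩ V).card := by linarith
    have h6 := mul_le_mul_of_nonneg_right h5 (Nat.cast_nonneg n)
    have h7 : V.card * ((τ - ρ₁ - 2 * ρ₂ - δ) * n) ≤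
        V.card * ((miss E {x} ∩ miss E {v}).card : ℝ) := by linarith
    have h8 := le_of_mul_le_mul_left h7 hs
    have h9 := mul_le_mul_of_nonneg_right hρ (Nat.cast_nonneg n : (0 : ℝ) ≤ n)
    linarith
  have h1 : ((X \ X₀).card : ℝ) ≤ ((X \ X₀) \ (X \ miss E {v})).card + (X \ miss E {v}).card := by
    have := Finset.le_card_sdiff (X \ miss E {v}) (X \ X₀)
    exact_mod_cast (by omega : (X \ X₀).card ≤
      ((X \ X₀) \ (X \ miss E {v})).card + (X \ miss E {v}).card)
  have h2 : (((X \ X₀) \ (X \ miss E {v})).card : ℝ) ≤ (denseCore E ((τ - ρ) * n) v ∩ V).card := by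
    exact_mod_cast Finset.card_le_card hcore
  have h5 : (τ - ρ₁ - 2 * ρ₂) * V.card ≤ (denseCore E ((τ - ρ) * n) v ∩ V).card := by linarith
  have h6 := mul_le_mul_of_nonneg_right h5 (Nat.cast_nonneg n)
  have h7 : V.card * ((τ - ρ₁ - 2 * ρ₂ - δ) * n) ≤
      V.card * ((denseCore E ((τ - ρ) * n) v).card : ℝ) := by
    linarith [hD v]
  have h8 := le_of_mul_le_mul_left h7 hs
  have h9 := mul_le_mul_of_nonneg_right hρ (Nat.cast_nonneg n : (0 : ℝ) ≤ n)
  linarith [hθ v]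

/-- All the vertex sets whose density is controlled when exhausting the vertex set. -/
noncomputable def controlSets (k : ℕ) (E : Finset (Finset (Fin n))) (θ : ℝ) :
    Finset (Finset (Fin n)) :=
  (Finset.powersetCard (k - 1) Finset.univ).image (miss E) ∪
    (Finset.univ.image (fun p : Fin n × Fin n => miss E {p.1} ∩ miss E {p.2}) ∪
      Finset.univ.image (denseCore E θ))

theorem inter_mem_controlSets (E : Finset (Finset (Fin n))) (θ : ℝ) (u v : Fin n) :
    miss E {u} ∩ miss E {v} ∈ controlSets k E θ := by
  simp only [controlSets, Finset.mem_union, Finset.mem_image, Finset.mem_univ, true_and]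
  exact Or.inr (Or.inl ⟨(u, v), by congr⟩)

theorem denseCore_mem_controlSets (E : Finset (Finset (Fin n))) (θ : ℝ) (v : Fin n) :
    denseCore E θ v ∈ controlSets k E θ := by
  simp only [controlSets, Finset.mem_union, Finset.mem_image, Finset.mem_univ, true_and]
  exact Or.inr (Or.inr ⟨v, rfl⟩)

theorem card_controlSets_le (hk : 3 ≤ k) (hn : 1 ≤ n) (E : Finset (Finset (Fin n))) (θ : ℝ) :
    (controlSets k E θ).card ≤ 3 * n ^ k := by
  have h1 : ((Finset.powersetCard (k - 1) (Finset.univ : Finset (Fin n))).image (miss E)).card ≤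
      n ^ k := by
    refine Finset.card_image_le.trans ?_
    rw [Finset.card_powersetCard, Finset.card_univ, Fintype.card_fin]
    exact (Nat.choose_le_pow _ _).trans (Nat.pow_le_pow_right hn (by omega))
  have h2 : (Finset.univ.image
      (fun p : Fin n × Fin n => miss E {p.1} ∩ miss E {p.2})).card ≤ n ^ k := by
    refine Finset.card_image_le.trans ?_
    rw [Finset.card_univ, Fintype.card_prod, Fintype.card_fin, ← sq]
    exact Nat.pow_le_pow_right hn (by omega)
  have h3 : (Finset.univ.image (denseCore E θ)).card ≤ n ^ k := by
    refine Finset.card_image_le.trans ?_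
    rw [Finset.card_univ, Fintype.card_fin]
    exact Nat.le_self_pow (by omega) _
  have h4 := Finset.card_union_le
    ((Finset.powersetCard (k - 1) (Finset.univ : Finset (Fin n))).image (miss E))
    (Finset.univ.image (fun p : Fin n × Fin n => miss E {p.1} ∩ miss E {p.2}) ∪
      Finset.univ.image (denseCore E θ))
  have h5 := Finset.card_union_le
    (Finset.univ.image (fun p : Fin n × Fin n => miss E {p.1} ∩ miss E {p.2}))
    (Finset.univ.image (denseCore E θ))
  rw [controlSets]
  omega

/-- Density control of all `controlSets` on `V` makes `V` rich. -/
theorem Good.rich_of_control (h : Good k t E) (ht : 1 ≤ t) (hn : 0 < n) {θ δ γ : ℝ}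
    {V : Finset (Fin n)} (hδ : δ ≤ γ)
    (hc : ∀ F ∈ controlSets k E θ, ((F ∩ V).card : ℝ) * n ≤ (F.card + δ * n) * V.card) :
    Rich k E V (1 / t + γ) := by
  intro σ hσ hσk
  obtain ⟨τ, hστ, hτc, hτ⟩ := hσ.exists_superset h.card_eq (j := k - 1) (by omega) (by omega)
  have h1 := hc (miss E τ) (Finset.mem_union_left _ (Finset.mem_image_of_mem _
    (Finset.mem_powersetCard.2 ⟨Finset.subset_univ _, hτc⟩)))
  have h2 : ((miss E σ ∩ V).card : ℝ) ≤ (miss E τ ∩ V).card := by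
    exact_mod_cast Finset.card_le_card (Finset.inter_subset_inter_right (miss_mono hστ))
  have h3 := h.miss_le ht hτ (by omega)
  have hn' : (0 : ℝ) < n := by exact_mod_cast hn
  have h4 : ((miss E τ).card : ℝ) + δ * n ≤ (1 / t + γ) * n := by
    have h5 := mul_le_mul_of_nonneg_right hδ hn'.le
    have h6 : (n : ℝ) / t = 1 / t * n := by ring
    linarith
  have h5 := h1.trans (mul_le_mul_of_nonneg_right h4 (Nat.cast_nonneg _))
  have h6 : (n : ℝ) * (miss E σ ∩ V).card ≤ n * ((1 / t + γ) * V.card) := by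
    have := mul_le_mul_of_nonneg_right h2 hn'.le
    linarith
  exact le_of_mul_le_mul_left h6 hn'

theorem density_transfer {f f₀ s s₀ n δ κ ε fs : ℝ} (hn : 0 < n) (hf : f ≤ n) (hf0 : 0 ≤ f₀)
    (hff : f₀ ≤ f) (hs₀ : (1 - δ / 8) * n ≤ s₀) (hs₀n : s₀ ≤ n) (hs : ε * n ≤ s)
    (hδ0 : 0 < δ) (hδ : δ ≤ 1) (hκ : 10 * κ ≤ δ * ε) (hκ0 : 0 ≤ κ)
    (hε : 0 < ε) (h : fs ≤ f₀ / s₀ * s + 5 * κ * s₀) : fs * n ≤ (f + δ * n) * s := by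
  have hs₀0 : 0 < s₀ := lt_of_lt_of_le (mul_pos (by linarith) hn) hs₀
  have hs0 : 0 < s := (mul_pos hε hn).trans_le hs
  have h1 : f₀ / s₀ * n ≤ f + δ / 2 * n := by
    rw [div_mul_eq_mul_div, div_le_iff₀ hs₀0]
    have e1 : f₀ * n ≤ f * n := mul_le_mul_of_nonneg_right hff hn.le
    have e2 : (f + δ / 2 * n) * ((1 - δ / 8) * n) ≤ (f + δ / 2 * n) * s₀ :=
      mul_le_mul_of_nonneg_left hs₀ (by have := mul_pos hδ0 hn; linarith)
    have e3 : δ / 8 * n * f ≤ δ / 8 * n * n :=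
      mul_le_mul_of_nonneg_left hf (by have := mul_pos hδ0 hn; linarith)
    have e4 : δ * (δ * (n * n)) ≤ 1 * (δ * (n * n)) :=
      mul_le_mul_of_nonneg_right hδ (by positivity)
    have e5 : 0 < δ * (n * n) := by positivity
    nlinarith
  have h2 : 5 * κ * s₀ * n ≤ δ / 2 * n * s := by
    have e1 : κ * s₀ ≤ κ * n := mul_le_mul_of_nonneg_left hs₀n hκ0
    have e2 : 10 * κ * n ≤ δ * ε * n := mul_le_mul_of_nonneg_right hκ hn.le
    have e3 : δ * (ε * n) ≤ δ * s := mul_le_mul_of_nonneg_left hs hδ0.le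
    have e4 : n * (10 * (κ * s₀)) ≤ n * (δ * s) := mul_le_mul_of_nonneg_left (by linarith) hn.le
    linarith
  calc fs * n ≤ (f₀ / s₀ * s + 5 * κ * s₀) * n := mul_le_mul_of_nonneg_right h hn.le
    _ = f₀ / s₀ * n * s + 5 * κ * s₀ * n := by ring
    _ ≤ (f + δ / 2 * n) * s + δ / 2 * n * s :=
      add_le_add (mul_le_mul_of_nonneg_right h1 hs0.le) h2
    _ = _ := by ring

end nonextremal

section nonextremal

theorem eventually_pow_le_exp (k : ℕ) {κ b : ℝ} (hκ : 0 < κ) (hb : 0 < b) :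
    ∃ n₀ : ℕ, ∀ n : ℕ, n₀ ≤ n → 4 * (n : ℝ) ^ k ≤ κ * Real.exp (b * n) := by
  have h1 := (isLittleO_pow_exp_pos_mul_atTop k hb).def (show 0 < κ / 4 by positivity)
  have h2 := tendsto_natCast_atTop_atTop.eventually h1
  obtain ⟨n₀, h3⟩ := Filter.eventually_atTop.1 h2
  refine ⟨n₀, fun n hn => ?_⟩
  have h4 := h3 n hn
  rw [Real.norm_of_nonneg (by positivity), Real.norm_of_nonneg (Real.exp_pos _).le] at h4
  linarith

theorem exists_cycleList_of_control {n k d t : ℕ} {E : Finset (Finset (Fin n))} (hk : 3 ≤ k)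
    (hE : Good k t E) {γ ρ κ ε δ θ : ℝ} {N Lc sc s₀ : ℕ} (ht3 : 3 ≤ t)
    (hγ : γ ≤ 1 / 27) (hn : 0 < n)
    (hδ0 : 0 < δ) (hδγ : δ ≤ γ) (hκ0 : 0 < κ) (hκ1 : κ ≤ 1) (hε0 : 0 < ε) (hε4 : ε ≤ 1 / 4)
    (hκ : 10 * κ ≤ δ * ε) (hN : 1 ≤ N) (hdN : d ∣ N) (hkN : k ≤ N)
    (hdLc : d ∣ Lc) (hLck : 2 * (k - 1) ≤ Lc) (hnLc : Lc ≤ δ / 16 * n)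
    (hns : (s₀ + sc + 14 * N : ℕ) ≤ ε * n)
    (hexp : 4 * (n : ℝ) ^ k ≤ κ * Real.exp (κ / N * κ * ε * n))
    (hconn : ∀ W : Finset (Fin n), sc ≤ W.card → Rich k E W (2 / 5) → ∀ S Z : List (Fin n),
      S.length = k - 1 → Z.length = k - 1 → Face E S.toFinset → Face E Z.toFinset →
      ∃ C : List (Fin n), C.Nodup ∧ (∀ v ∈ C, v ∈ W) ∧ C.length = Lc ∧ FT k E (S ++ C ++ Z))
    (htile : ∀ W : Finset (Fin n), s₀ ≤ W.card → Rich k E W (1 / t + γ) →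
      (∀ X ⊆ W, (1 / t - 24 * k * γ) * W.card ≤ (X.card : ℝ) → ∃ X₀ ⊆ X, ρ * W.card ≤ (X₀.card : ℝ) ∧
        ∀ x ∈ X₀, ρ * W.card ≤ ((X \ miss E {x}).card : ℝ)) →
      ∀ S : List (Fin n), S.length = k - 1 → Face E S.toFinset →
      ∀ (c : Fin n → ℝ) (M : ℝ), (∀ v, 0 ≤ c v ∧ c v ≤ M) →
      ∃ C P : List (Fin n), (C ++ P).Nodup ∧ (∀ v ∈ C ++ P, v ∈ W) ∧ d ∣ C.length ∧
        (C ++ P).length = N ∧ k ≤ P.length ∧ FT k E (S ++ C ++ P.take (k - 1)) ∧ AW d k E P ∧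
        Face E (P.drop (P.length - (k - 1))).toFinset ∧
        N * ∑ v ∈ W, c v ≤ W.card * (∑ v ∈ (C ++ P).toFinset, c v + κ * N * M))
    (hspread : ∀ V : Finset (Fin n), 0 < V.card →
      (∀ F ∈ controlSets k E θ, ((F ∩ V).card : ℝ) * n ≤ (F.card + δ * n) * V.card) →
      ∀ X ⊆ V, (1 / t - 24 * k * γ) * V.card ≤ (X.card : ℝ) →
        ∃ X₀ ⊆ X, ρ * V.card ≤ (X₀.card : ℝ) ∧
          ∀ x ∈ X₀, ρ * V.card ≤ ((X \ miss E {x}).card : ℝ))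
    {S Z : List (Fin n)} {P : Finset (Fin n)} (hS : S.length = k - 1) (hZ : Z.length = k - 1)
    (hP : (P.card : ℝ) ≤ δ / 16 * n)
    (habs : ∀ U : Finset (Fin n), Disjoint U P → (U.card : ℝ) ≤ ε * n →
      ∃ mid : List (Fin n), FT k E (S ++ mid ++ Z) ∧ (S ++ mid ++ Z).Nodup ∧
        (S ++ mid ++ Z).toFinset = P ∪ U) : ∃ l, CycleList d k E l := by
  classical
  have hn' : (0 : ℝ) < n := by exact_mod_cast hn
  have htr : (3 : ℝ) ≤ t := by exact_mod_cast ht3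
  have ht13 : 1 / (t : ℝ) ≤ 1 / 3 := one_div_le_one_div_of_le (by norm_num) htr
  have hNr : (0 : ℝ) < N := by exact_mod_cast hN
  have hδn : δ * n ≤ 1 / 27 * n := mul_le_mul_of_nonneg_right (hδγ.trans hγ) hn'.le
  have hεn4 : ε * n ≤ 1 / 4 * n := mul_le_mul_of_nonneg_right hε4 hn'.le
  have hns' : (s₀ : ℝ) + sc + 14 * N ≤ ε * n := by push_cast at hns; exact hns
  have hs0r : (0 : ℝ) ≤ s₀ := Nat.cast_nonneg _
  have hscr : (0 : ℝ) ≤ sc := Nat.cast_nonneg _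
  obtain ⟨mid₀, hmid₀, -⟩ := habs ∅ (by simp) (by simp; positivity)
  have hSf : Face E S.toFinset := hmid₀.left.left.face (by omega)
  have hZf : Face E Z.toFinset := hmid₀.right.face (by omega)
  have hWc : ((Finset.univ \ P).card : ℝ) = n - P.card := by
    rw [Finset.card_sdiff_of_subset (Finset.subset_univ _), Nat.cast_sub
      (Finset.card_le_card (Finset.subset_univ _)), Finset.card_univ, Fintype.card_fin]
  obtain ⟨C₁, hC₁n, hC₁W, hC₁l, hC₁ft⟩ := hconn (Finset.univ \ P)
    (by have : (sc : ℝ) ≤ (Finset.univ \ P).card := by linarith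
        exact_mod_cast this)
    (hE.rich ht3 (by
      have : (5 * n : ℝ) ≤ 6 * (Finset.univ \ P).card := by linarith
      exact_mod_cast this)) Z Z hZ hZ hZf hZf
  set V₀ := (Finset.univ \ P) \ C₁.toFinset with hV₀
  have hV₀P : ∀ v ∈ V₀, v ∉ P := fun v hv =>
    (Finset.mem_sdiff.1 (Finset.mem_sdiff.1 hv).1).2
  have hC₁sub : C₁.toFinset ⊆ Finset.univ \ P := fun v hv => hC₁W v (List.mem_toFinset.1 hv)
  have hV₀c : (V₀.card : ℝ) = n - P.card - Lc := by
    rw [hV₀, Finset.card_sdiff_of_subset hC₁sub, Nat.cast_sub (Finset.card_le_card hC₁sub), hWc,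
      List.toFinset_card_of_nodup hC₁n, hC₁l]
  have hV₀n : (V₀.card : ℝ) ≤ n := by
    have : (0 : ℝ) ≤ P.card := Nat.cast_nonneg _
    have : (0 : ℝ) ≤ Lc := Nat.cast_nonneg _
    linarith
  have hεn : 0 < ε * n := by positivity
  have hℱ : ((insert V₀ (controlSets k E θ)).card : ℝ) ≤ 4 * (n : ℝ) ^ k := by
    have h1 := card_controlSets_le hk hn E θ
    have h2 := Finset.card_insert_le V₀ (controlSets k E θ)
    have h3 : 1 ≤ n ^ k := Nat.one_le_pow _ _ hn
    exact_mod_cast (by omega : (insert V₀ (controlSets k E θ)).card ≤ 4 * n ^ k)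
  have hR₀ : ε * n - N ≤ (V₀.card : ℝ) ∧ Rich k E V₀ (2 / 5) ∧
      ∃ T, Strand d k E Z ((Finset.univ \ P) \ V₀) T := by
    refine ⟨by linarith, hE.rich ht3 ?_, C₁, hC₁n, ?_, hC₁l ▸ hdLc, by omega,
      FT.aw hE.card_eq hC₁ft.left.right hC₁n, ?_, hC₁ft.left.right.face_rtake⟩
    · have : (5 * n : ℝ) ≤ 6 * V₀.card := by linarith
      exact_mod_cast this
    · rw [hV₀, Finset.sdiff_sdiff_eq_self hC₁sub]
    · refine hC₁ft.left.of_isInfix (List.IsPrefix.isInfix ?_)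
      exact (List.prefix_append_right_inj Z).2 (List.take_prefix _ _)
  obtain ⟨V, hV, ⟨hVm, hVr, T, hT⟩, hVlt⟩ := exists_exhaust (ℱ := insert V₀ (controlSets k E θ))
    (V₀ := V₀) (κ := κ) (m := ε * n) (N := N) hN hκ0 hκ1 hεn (Finset.mem_insert_self _ _)
    (by
      rw [Real.exp_neg, ← div_eq_mul_inv, div_le_iff₀ (Real.exp_pos _), ← mul_assoc]
      exact hℱ.trans hexp)
    (by
      refine hℱ.trans (hexp.trans ((mul_le_mul_of_nonneg_right hκ1 (Real.exp_pos _).le).trans ?_))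
      rw [one_mul, Real.exp_le_exp, mul_assoc]
      exact mul_le_mul_of_nonneg_left (by linarith) (by positivity))
    (fun V => ε * n - N ≤ (V.card : ℝ) ∧ Rich k E V (2 / 5) ∧
      ∃ T, Strand d k E Z ((Finset.univ \ P) \ V) T) hR₀ (by
    rintro V hV ⟨-, -, T, hT⟩ hm hdens c M hc
    have hctl : ∀ F ∈ controlSets k E θ, ((F ∩ V).card : ℝ) * n ≤ (F.card + δ * n) * V.card := by
      intro F hF
      refine density_transfer (f₀ := (F ∩ V₀).card) (s₀ := V₀.card) (κ := κ) (ε := ε) hn' ?_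
        (Nat.cast_nonneg _) ?_ (by linarith) hV₀n hm hδ0 (by linarith) hκ hκ0.le hε0
        (hdens F (Finset.mem_insert_of_mem hF))
      · have := Finset.card_le_univ F
        rw [Fintype.card_fin] at this
        exact_mod_cast this
      · exact_mod_cast Finset.card_le_card Finset.inter_subset_left
    have hrich := hE.rich_of_control (by omega) hn hδγ hctl
    have hVpos : (0 : ℝ) < V.card := hεn.trans_le hm
    have hTl : (T.drop (T.length - (k - 1))).length = k - 1 := by
      have := hT.le_length
      simp; omega
    obtain ⟨C, Q, h1, h2, h3, h4, h5, h6, h7, h8, h9⟩ := htile V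
      (by have : (s₀ : ℝ) ≤ V.card := by linarith
          exact_mod_cast this) hrich
      (hspread V (by exact_mod_cast hVpos) hctl) _ hTl hT.face c M hc
    have hQV : (C ++ Q).toFinset ⊆ V := fun v hv => h2 v (List.mem_toFinset.1 hv)
    have hQc : (C ++ Q).toFinset.card = N := by rw [List.toFinset_card_of_nodup h1, h4]
    have hcard : ((V \ (C ++ Q).toFinset).card : ℝ) = V.card - N := by
      rw [Finset.card_sdiff_of_subset hQV, Nat.cast_sub (Finset.card_le_card hQV), hQc]
    refine ⟨(C ++ Q).toFinset, hQV, hQc, ⟨by rw [hcard]; linarith, ?_, T ++ (C ++ Q), ?_⟩, h9⟩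
    · intro σ hσ hσk
      have e1 := hrich σ hσ hσk
      have e2 : ((miss E σ ∩ (V \ (C ++ Q).toFinset)).card : ℝ) ≤ (miss E σ ∩ V).card := by
        exact_mod_cast Finset.card_le_card (Finset.inter_subset_inter_left Finset.sdiff_subset)
      have e3 : (1 / t + γ) * V.card ≤ (10 / 27) * (V.card : ℝ) :=
        mul_le_mul_of_nonneg_right (by linarith) hVpos.le
      rw [hcard]
      linarith
    · have hs := hT.extend hE.card_eq h1 (fun v hv hv' => (Finset.mem_sdiff.1 hv').2 (h2 v hv)) h3
        (h4 ▸ hdN) h5 h6 h7 h8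
      convert hs using 1
      ext v
      have : v ∈ (C ++ Q).toFinset → v ∉ P := fun hv => hV₀P v (hV (hQV hv))
      simp only [Finset.mem_sdiff, Finset.mem_univ, true_and, Finset.mem_union]
      tauto)
  have hTl : (T.drop (T.length - (k - 1))).length = k - 1 := by
    have := hT.le_length
    simp; omega
  obtain ⟨C, hCn, hCV, -, hCft⟩ := hconn V
    (by have : (sc : ℝ) ≤ V.card := by linarith
        exact_mod_cast this) hVr _ S hTl hS hT.face hSf
  obtain ⟨mid, hmid, hmidn, hmidu⟩ := habs (V \ C.toFinset)
    (Finset.disjoint_left.2 fun v hv => hV₀P v (hV (Finset.mem_sdiff.1 hv).1)) (by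
      refine le_trans ?_ hVlt.le
      exact_mod_cast Finset.card_le_card Finset.sdiff_subset)
  have hTm : ∀ v, v ∈ T ↔ v ∉ P ∧ v ∉ V := fun v => by
    rw [← List.mem_toFinset, hT.toFinset]; simp
  have hmm : ∀ v, v ∈ S ++ mid ++ Z ↔ v ∈ P ∨ (v ∈ V ∧ v ∉ C) := fun v => by
    rw [← List.mem_toFinset, hmidu]; simp
  have hVP : ∀ v ∈ V, v ∉ P := fun v hv => hV₀P v (hV hv)
  refine ⟨_, hT.close hE.card_eq (C := C) hS hZ hCft hmid ?_ ?_⟩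
  · rw [List.nodup_append', List.nodup_append']
    refine ⟨⟨hT.nodup, hCn, fun v hv hv' => ((hTm v).1 hv).2 (hCV v hv')⟩, hmidn, fun v hv hv' => ?_⟩
    rw [hmm] at hv'
    rw [List.mem_append, hTm] at hv
    have := hVP v
    have := hCV v
    tauto
  · intro v
    rw [List.mem_append, List.mem_append, hTm, hmm]
    tauto

theorem exists_cycleList_of_nonextremal (k d t : ℕ) (hk : 3 ≤ k) (hd : 1 ≤ d) (hdk : d < k)
    (ht : t = k / d * d) (ht3 : 3 ≤ t) {ρ : ℝ} (hρ : 0 < ρ) (hρt : ρ ≤ 1 / t) :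
    ∃ n₀ : ℕ, ∀ n, n₀ ≤ n → ∀ E : Finset (Finset (Fin n)), Good k t E →
      (∀ v, ((denseCore E ((1 / t - ρ) * n) v).card : ℝ) < (1 / t - ρ) * n) →
      ∃ l, CycleList d k E l := by
  have hkr : (3 : ℝ) ≤ k := by exact_mod_cast hk
  have htr : (3 : ℝ) ≤ t := by exact_mod_cast ht3
  have hnat_div : ∀ {a b : ℝ} {m n : ℕ}, 0 < b → a / b ≤ m → m ≤ n → a ≤ b * n := by
    intro a b m n hb h1 h2
    have := (div_le_iff₀ hb).1 (h1.trans (Nat.cast_le.2 h2))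
    linarith
  obtain ⟨γ, hγ0, hγk, hγρ⟩ : ∃ γ : ℝ, 0 < γ ∧ 3 * k ^ 2 * γ ≤ 1 ∧ 24 * k * γ ≤ ρ / 4 := by
    refine ⟨min (1 / (3 * k ^ 2)) (ρ / (96 * k)), by positivity, ?_, ?_⟩
    · have := (le_div_iff₀ (by positivity)).1
        (min_le_left (1 / (3 * (k : ℝ) ^ 2)) (ρ / (96 * k)))
      linarith
    · have := (le_div_iff₀ (by positivity)).1
        (min_le_right (1 / (3 * (k : ℝ) ^ 2)) (ρ / (96 * k)))
      linarith
  have hγ27 : γ ≤ 1 / 27 := by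
    have : (9 : ℝ) * γ ≤ k ^ 2 * γ := mul_le_mul_of_nonneg_right (by nlinarith) hγ0.le
    linarith
  obtain ⟨δ, hδ0, hδγ, hδρ⟩ : ∃ δ : ℝ, 0 < δ ∧ δ ≤ γ ∧ δ ≤ ρ / 4 :=
    ⟨min γ (ρ / 4), by positivity, min_le_left _ _, min_le_right _ _⟩
  have hsum : 24 * k * γ + 2 * (ρ / 8) + δ ≤ ρ := by linarith
  have hsum' : 24 * k * γ + ρ / 8 < 1 / t := by linarith
  obtain ⟨β, hβ0, n₁, habs⟩ := exists_absorber k t (by omega) ht3 (δ / 16) (by positivity)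
  obtain ⟨ε, hε0, hεβ, hε4⟩ : ∃ ε : ℝ, 0 < ε ∧ ε ≤ β ∧ ε ≤ 1 / 4 :=
    ⟨min β (1 / 4), by positivity, min_le_left _ _, min_le_right _ _⟩
  obtain ⟨κ, hκ0, hκ⟩ : ∃ κ : ℝ, 0 < κ ∧ 10 * κ = δ * ε := ⟨δ * ε / 10, by positivity, by ring⟩
  have hκ1 : κ ≤ 1 := by nlinarith
  obtain ⟨Lc, sc, hdLc, hLck, hconn⟩ := exists_connector k d (by omega) hd
  obtain ⟨N, s₀, hN, hdN, hkN, htile⟩ := exists_tile k d t hk hd hdk ht ht3 hγ0 hγk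
    (ρ := ρ / 8) (η := κ) (by positivity) hκ0 hκ1
  have hNr : (0 : ℝ) < N := by exact_mod_cast hN
  obtain ⟨n₂, hn₂⟩ := eventually_pow_le_exp k hκ0 (show 0 < κ / N * κ * ε by positivity)
  obtain ⟨n₃, hn₃⟩ := exists_nat_ge (Lc / (δ / 16))
  obtain ⟨n₄, hn₄⟩ := exists_nat_ge (((s₀ + sc + 14 * N : ℕ) : ℝ) / ε)
  refine ⟨max (max n₁ n₂) (max (max n₃ n₄) 1), fun n hn E hE hθ => ?_⟩
  have hn0 : 0 < n := by omega
  obtain ⟨S, Z, P, hS, hZ, hP, hU⟩ := habs n (by omega) E hE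
  refine exists_cycleList_of_control hk hE (θ := (1 / t - ρ) * n) (ρ := ρ / 8) (N := N) (Lc := Lc)
    (sc := sc) (s₀ := s₀) ht3 hγ27 hn0 hδ0 hδγ hκ0 hκ1 hε0 hε4 hκ.le hN hdN hkN hdLc hLck ?_ ?_
    (hn₂ n (by omega)) (fun W h1 h2 => hconn n E W h1 h2)
    (fun W h1 h2 h3 => htile n E W h1 hE.card_eq hE.face_singleton h2 h3) ?_ hS hZ hP
    (fun U h1 h2 => hU U h1 (h2.trans (mul_le_mul_of_nonneg_right hεβ (Nat.cast_nonneg _))))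
  · exact hnat_div (by positivity) hn₃ (by omega)
  · exact hnat_div hε0 hn₄ (by omega)
  · intro V hV hc
    exact exists_spread (τ := 1 / t) (ρ := ρ) (ρ₁ := 24 * k * γ) (ρ₂ := ρ / 8) (δ := δ) hV hθ
      (fun u v => hc _ (inter_mem_controlSets E _ u v))
      (fun v => hc _ (denseCore_mem_controlSets E _ v)) hsum hsum'

end nonextremal

section windows

/-- The cyclic window of `k` consecutive positions modulo `n` starting at `s`. -/
def win (n k s : ℕ) : Finset ℕ := (Finset.range n).filter fun p => (s ≤ p ∧ p < s + k) ∨ p + n < s + k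

theorem mem_win {n k s p : ℕ} :
    p ∈ win n k s ↔ p < n ∧ ((s ≤ p ∧ p < s + k) ∨ p + n < s + k) := by simp [win]

theorem card_win {n k s : ℕ} (hk : k ≤ n) (hs : s < n) : (win n k s).card = k := by
  rcases le_total (s + k) n with h | h
  · have : win n k s = Finset.Ico s (s + k) := by
      ext p; rw [mem_win, Finset.mem_Ico]; omega
    rw [this, Nat.card_Ico]; omega
  · have : win n k s = Finset.Ico s n ∪ Finset.range (s + k - n) := by
      ext p; rw [mem_win, Finset.mem_union, Finset.mem_Ico, Finset.mem_range]; omega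
    rw [this, Finset.card_union_of_disjoint, Nat.card_Ico, Finset.card_range]
    · omega
    · rw [Finset.disjoint_left]; intro p; rw [Finset.mem_Ico, Finset.mem_range]; omega

theorem win_eq_image {n k s : ℕ} (hk : k ≤ n) (hs : s < n) :
    win n k s = (Finset.univ : Finset (Fin k)).image fun j : Fin k => (s + (j : ℕ)) % n := by
  symm
  apply Finset.eq_of_subset_of_card_le
  · intro p hp
    obtain ⟨j, -, rfl⟩ := Finset.mem_image.1 hp
    have hj := j.2
    rw [mem_win]
    refine ⟨Nat.mod_lt _ (by omega), ?_⟩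
    rcases lt_or_ge (s + (j : ℕ)) n with h | h
    · rw [Nat.mod_eq_of_lt h]; omega
    · rw [Nat.mod_eq_sub_mod h, Nat.mod_eq_of_lt (by omega)]; omega
  · rw [card_win hk hs, Finset.card_image_of_injective]
    · simp
    · intro i j hij
      have hi := i.2
      have hj := j.2
      simp only at hij
      apply Fin.ext
      rcases lt_or_ge (s + (i : ℕ)) n with h | h <;> rcases lt_or_ge (s + (j : ℕ)) n with h' | h'
      · rw [Nat.mod_eq_of_lt h, Nat.mod_eq_of_lt h'] at hij; omega
      · rw [Nat.mod_eq_of_lt h, Nat.mod_eq_sub_mod h', Nat.mod_eq_of_lt (by omega)] at hij; omega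
      · rw [Nat.mod_eq_sub_mod h, Nat.mod_eq_of_lt (by omega), Nat.mod_eq_of_lt h'] at hij; omega
      · rw [Nat.mod_eq_sub_mod h, Nat.mod_eq_of_lt (by omega), Nat.mod_eq_sub_mod h',
          Nat.mod_eq_of_lt (by omega)] at hij; omega

/-- The starting points of the windows through `p`. -/
def starts (n k d p : ℕ) : Finset ℕ :=
  (Finset.range n).filter fun s => d ∣ s ∧ p ∈ win n k s

theorem mem_starts {n k d p s : ℕ} :
    s ∈ starts n k d p ↔ s < n ∧ d ∣ s ∧ p ∈ win n k s := by simp [starts]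

theorem card_starts_le {n k d : ℕ} (p : ℕ) (hk : k ≤ n) : (starts n k d p).card ≤ k := by
  calc (starts n k d p).card ≤ ((Finset.range k).image fun j => (p + n - j) % n).card := by
        apply Finset.card_le_card
        intro s hs
        rw [mem_starts, mem_win] at hs
        obtain ⟨hs, -, hp, h⟩ := hs
        rw [Finset.mem_image]
        rcases h with h | h
        · refine ⟨p - s, Finset.mem_range.2 (by omega), ?_⟩
          rw [show p + n - (p - s) = s + n by omega, Nat.add_mod_right, Nat.mod_eq_of_lt hs]
        · refine ⟨p + n - s, Finset.mem_range.2 (by omega), ?_⟩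
          rw [show p + n - (p + n - s) = s by omega, Nat.mod_eq_of_lt hs]
    _ ≤ k := Finset.card_image_le.trans (by simp)

/-- The `j`-th special position: the last position of the `j`-th block of length `t` after `s₀`. -/
def spec (s₀ t j : ℕ) : ℕ := s₀ + j * t + (t - 1)

/-- Arithmetic assumptions on the positions of the cycle. -/
structure Layout (n k d t s₀ π : ℕ) : Prop where
  hd : 1 ≤ d
  hπ : 0 < π
  ht : 3 ≤ t
  hdt : d ∣ t
  htk : t ≤ k
  hkt : k < t + d
  hs₀ : d ∣ s₀
  hn : n = s₀ + π * t
  hkn : k ≤ n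

variable {n k d t s₀ π : ℕ}

theorem Layout.d_le (h : Layout n k d t s₀ π) : d ≤ t :=
  Nat.le_of_dvd (by have := h.ht; omega) h.hdt

theorem Layout.spec_lt (h : Layout n k d t s₀ π) {j : ℕ} (hj : j < π) : spec s₀ t j < n := by
  have := h.hn
  have := h.ht
  have : (j + 1) * t ≤ π * t := Nat.mul_le_mul_right _ hj
  rw [spec]; rw [Nat.add_mul] at this; omega

theorem spec_add (s₀ t i j : ℕ) : spec s₀ t (i + j) = spec s₀ t i + j * t := by
  simp only [spec, Nat.add_mul]; omega

theorem Layout.spec_inj (h : Layout n k d t s₀ π) {i j : ℕ} (hij : spec s₀ t i = spec s₀ t j) :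
    i = j := by
  have : i * t = j * t := by simp only [spec] at hij; omega
  exact Nat.eq_of_mul_eq_mul_right (by have := h.ht; omega) this

theorem spec_mono {i j : ℕ} (c : ℕ) (h : i + c ≤ j) : spec s₀ t i + c * t ≤ spec s₀ t j := by
  have : (i + c) * t ≤ j * t := Nat.mul_le_mul_right _ h
  rw [Nat.add_mul] at this
  simp only [spec]; omega

theorem Layout.add_le (h : Layout n k d t s₀ π) {s j : ℕ} (hs : d ∣ s) (hj : s ≤ spec s₀ t j) :
    s + d ≤ spec s₀ t j + 1 := by
  have h1 : d ∣ spec s₀ t j + 1 := by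
    have : spec s₀ t j + 1 = s₀ + j * t + t := by simp only [spec]; have := h.ht; omega
    rw [this]
    exact dvd_add (dvd_add h.hs₀ (h.hdt.mul_left _)) h.hdt
  obtain ⟨a, rfl⟩ := hs
  obtain ⟨b, hb⟩ := h1
  have : d * a < d * b := by rw [← hb]; omega
  rw [hb]
  have : a + 1 ≤ b := Nat.lt_of_mul_lt_mul_left this
  have := Nat.mul_le_mul_left d this
  rw [Nat.mul_add] at this
  omega

theorem Layout.spec_unique_aux (h : Layout n k d t s₀ π) {s i j : ℕ} (hs : s < n) (hds : d ∣ s)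
    (hij : i < j) (hj : j < π) (h1 : spec s₀ t i ∈ win n k s) (h2 : spec s₀ t j ∈ win n k s) :
    False := by
  rw [mem_win] at h1 h2
  have e1 := h.hkt
  have e2 := h.hkn
  have e3 := h.ht
  have e4 := h.d_le
  have e5 : spec s₀ t i + 1 * t ≤ spec s₀ t j := spec_mono 1 hij
  have e6 : t - 1 ≤ spec s₀ t i := by simp only [spec]; omega
  have e7 : s ≤ spec s₀ t i → s + d ≤ spec s₀ t i + 1 := h.add_le hds
  have e8 : s ≤ spec s₀ t j → s + d ≤ spec s₀ t j + 1 := h.add_le hds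
  omega

theorem Layout.spec_unique (h : Layout n k d t s₀ π) {s i j : ℕ} (hs : s < n) (hds : d ∣ s)
    (hi : i < π) (hj : j < π) (h1 : spec s₀ t i ∈ win n k s) (h2 : spec s₀ t j ∈ win n k s) :
    i = j := by
  rcases lt_trichotomy i j with hij | hij | hij
  · exact (h.spec_unique_aux hs hds hij hj h1 h2).elim
  · exact hij
  · exact (h.spec_unique_aux hs hds hij hi h2 h1).elim

theorem Layout.exists_spec (h : Layout n k d t s₀ π) {s : ℕ} (hs : s < n)
    (hk : s₀ + t ≤ s + k) : ∃ j < π, spec s₀ t j ∈ win n k s := by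
  have e3 := h.ht
  have e4 := h.htk
  rcases lt_or_ge s (s₀ + t) with h1 | h1
  · have hπ := h.hπ
    refine ⟨0, hπ, ?_⟩
    have := h.spec_lt hπ
    rw [mem_win]
    simp only [spec] at *
    omega
  · have h2 := Nat.div_add_mod (s - s₀) t
    have h3 := Nat.mod_lt (s - s₀) (show t > 0 by omega)
    rw [mul_comm] at h2
    have h5 : (s - s₀) / t < π := by
      rw [Nat.div_lt_iff_lt_mul (by omega)]
      have := h.hn
      omega
    refine ⟨_, h5, ?_⟩
    have := h.spec_lt h5
    rw [mem_win]
    simp only [spec] at *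
    omega

theorem Layout.spec_of_succ (h : Layout n k d t s₀ π) {s j : ℕ} (hs : s < n) (hj : j + 1 < π)
    (hw : spec s₀ t j + 1 ∈ win n k s) :
    spec s₀ t j ∈ win n k s ∨ spec s₀ t (j + 1) ∈ win n k s := by
  have e1 := h.spec_lt hj
  have e2 := h.spec_lt (show j < π by omega)
  have e3 : spec s₀ t (j + 1) = spec s₀ t j + 1 * t := spec_add _ _ _ _
  have := h.htk
  have := h.ht
  rw [mem_win] at *
  rw [mem_win]
  omega

theorem Layout.succ_unique (h : Layout n k d t s₀ π) {s i j : ℕ} (hs : s < n) (hij : i + 2 ≤ j)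
    (hj : j + 1 < π) (h1 : spec s₀ t i + 1 ∈ win n k s) (h2 : spec s₀ t j + 1 ∈ win n k s) :
    False := by
  have e1 : spec s₀ t i + 2 * t ≤ spec s₀ t j := spec_mono 2 hij
  have e2 := h.hkt
  have e3 := h.d_le
  have e4 := h.ht
  have e5 : spec s₀ t j + 1 * t ≤ spec s₀ t (j + 1) := spec_mono 1 le_rfl
  have e6 := h.spec_lt hj
  have e7 : t - 1 ≤ spec s₀ t i := by simp only [spec]; omega
  have := h.hkn
  rw [mem_win] at *
  omega

/-- Special positions near a position far from the ends are close to it. -/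
theorem Layout.near (h : Layout n k d t s₀ π) {s s' p u l j m : ℕ} (hs : s < n) (hs' : s' < n)
    (hu : 10 ≤ u) (hul : u + l + 10 ≤ π) (hj : u + 8 ≤ j) (hjl : j + 8 ≤ u + l) (hm : m < π)
    (hy : spec s₀ t j + 1 ∈ win n k s) (hp : p ∈ win n k s) (hp' : p ∈ win n k s')
    (hx : spec s₀ t m ∈ win n k s') : u ≤ m ∧ m < u + l := by
  have e2 := h.hkt
  have e3 := h.d_le
  have e4 := h.ht
  have e1 : spec s₀ t 0 + 10 * t ≤ spec s₀ t j := spec_mono 10 (by omega)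
  have e5 : spec s₀ t j + 10 * t ≤ spec s₀ t (π - 1) := spec_mono 10 (by omega)
  have e6 := h.spec_lt (show π - 1 < π by omega)
  have e7 : m < u → spec s₀ t m + 8 * t ≤ spec s₀ t j := fun hm => spec_mono 8 (by omega)
  have e8 : u + l ≤ m → spec s₀ t j + 8 * t ≤ spec s₀ t m := fun hm => spec_mono 8 (by omega)
  rw [mem_win] at *
  omega

theorem Layout.le_of_near (h : Layout n k d t s₀ π) {s s' p j : ℕ} (hs : s < n) (hs' : s' < n)
    (hj : 10 ≤ j) (hjl : j + 10 ≤ π)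
    (hy : spec s₀ t j + 1 ∈ win n k s) (hp : p ∈ win n k s) (hp' : p ∈ win n k s') :
    s₀ + t ≤ s' + k := by
  have e2 := h.hkt
  have e3 := h.d_le
  have e4 := h.ht
  have e1 : spec s₀ t 0 + 10 * t ≤ spec s₀ t j := spec_mono 10 (by omega)
  have e9 : spec s₀ t 0 = s₀ + (t - 1) := by simp [spec]
  have e5 : spec s₀ t j + 9 * t ≤ spec s₀ t (π - 1) := spec_mono 9 (by omega)
  have e6 := h.spec_lt (show π - 1 < π by omega)
  rw [mem_win] at *
  omega

end windows

section valid
variable {n : ℕ}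

/-- A partial assignment of distinct vertices to the positions in `D` such that the assigned part
of every aligned window is a face. -/
structure Valid (k d : ℕ) (E : Finset (Finset (Fin n))) (D : Finset ℕ) (f : ℕ → Fin n) : Prop where
  injOn : Set.InjOn f D
  face : ∀ s < n, d ∣ s → Face E ((win n k s ∩ D).image f)

variable {k d : ℕ} {E : Finset (Finset (Fin n))} {D R : Finset ℕ} {f : ℕ → Fin n}

theorem image_update_inter {W : Finset ℕ} {x : ℕ} (hx : x ∉ D) (v : Fin n) :
    (W ∩ D).image (Function.update f x v) = (W ∩ D).image f := by
  apply Finset.image_congr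
  intro p hp
  apply Function.update_of_ne
  rintro rfl
  exact hx (Finset.mem_inter.1 hp).2

theorem Valid.insert (hv : Valid k d E D f) {x : ℕ} (hx : x ∉ D) {v : Fin n} (hvD : v ∉ D.image f)
    (hm : ∀ s ∈ starts n k d x, Face E (insert v ((win n k s ∩ D).image f))) :
    Valid k d E (insert x D) (Function.update f x v) := by
  refine ⟨?_, fun s hs hds => ?_⟩
  · rw [Finset.coe_insert, Set.injOn_insert (by simpa using hx)]
    constructor
    · intro a ha b hb hab
      have h1 : a ≠ x := fun h => hx (h ▸ ha)
      have h2 : b ≠ x := fun h => hx (h ▸ hb)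
      rw [Function.update_of_ne h1, Function.update_of_ne h2] at hab
      exact hv.injOn ha hb hab
    · rintro ⟨a, ha, hax⟩
      have h1 : a ≠ x := fun h => hx (h ▸ ha)
      rw [Function.update_of_ne h1, Function.update_self] at hax
      exact hvD (Finset.mem_image.2 ⟨a, ha, hax⟩)
  · by_cases hxs : x ∈ win n k s
    · rw [Finset.inter_insert_of_mem hxs, Finset.image_insert, Function.update_self,
        image_update_inter hx]
      exact hm s (mem_starts.2 ⟨hs, hds, hxs⟩)
    · rw [Finset.inter_insert_of_notMem hxs, image_update_inter hx]
      exact hv.face s hs hds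

theorem card_image_win_lt (hk : k ≤ n) {x s : ℕ} (hx : x ∉ D) (hs : s ∈ starts n k d x) :
    ((win n k s ∩ D).image f).card < k := by
  rw [mem_starts] at hs
  refine Finset.card_image_le.trans_lt ?_
  calc _ < (win n k s).card := by
        apply Finset.card_lt_card
        rw [Finset.ssubset_iff_of_subset Finset.inter_subset_left]
        exact ⟨x, hs.2.2, fun h => hx (Finset.mem_inter.1 h).2⟩
    _ = k := card_win hk hs.1

/-- Extending a partial assignment greedily. -/
theorem Valid.greedy (hv : Valid k d E D f) (T : Finset (Fin n)) (m : ℕ)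
    (R : Finset ℕ) (hR : Disjoint R D)
    (hbad : ∀ D' f', Valid k d E D' f' → D ⊆ D' → D' ⊆ D ∪ R → (∀ p ∈ D, f' p = f p) →
      ∀ x ∈ R, x ∉ D' → ∃ T' : Finset (Fin n), T'.card ≤ m ∧ ∀ v ∈ T \ T', ∀ s ∈ starts n k d x,
        Face E (Insert.insert v ((win n k s ∩ D').image f')))
    (hcard : R.card + m ≤ (T \ D.image f).card) :
    ∃ f', Valid k d E (D ∪ R) f' ∧ (∀ p ∈ D, f' p = f p) ∧ ∀ x ∈ R, f' x ∈ T := by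
  induction R using Finset.induction_on with
  | empty => exact ⟨f, by simpa using hv, fun _ _ => rfl, by simp⟩
  | insert x R hx ih =>
    rw [Finset.card_insert_of_notMem hx] at hcard
    rw [Finset.disjoint_insert_left] at hR
    obtain ⟨f', h1, h2, h3⟩ := ih hR.2 (fun D' f' hD' hDD' hDR hf' y hy => hbad D' f' hD' hDD'
      (hDR.trans (Finset.union_subset_union_right (Finset.subset_insert _ _))) hf' y
      (Finset.mem_insert_of_mem hy)) (by omega)
    have hxD : x ∉ D ∪ R := by simp [hx, hR.1]
    obtain ⟨T', hT', hT'f⟩ := hbad (D ∪ R) f' h1 Finset.subset_union_left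
      (Finset.union_subset_union_right (Finset.subset_insert _ _)) h2 x
      (Finset.mem_insert_self _ _) hxD
    have himg : (D ∪ R).image f' = D.image f ∪ R.image f' := by
      rw [Finset.image_union]; congr 1
      exact Finset.image_congr fun p hp => h2 p hp
    have hlt : (T' ∪ R.image f').card < (T \ D.image f).card := by
      have := Finset.card_union_le T' (R.image f')
      have := Finset.card_image_le (s := R) (f := f')
      omega
    obtain ⟨v, hv1, hv2⟩ := Finset.exists_mem_notMem_of_card_lt_card hlt
    rw [Finset.mem_sdiff] at hv1
    rw [Finset.mem_union, not_or] at hv2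
    refine ⟨Function.update f' x v, ?_, fun p hp => ?_, fun y hy => ?_⟩
    · rw [Finset.union_insert]
      refine h1.insert hxD ?_ (hT'f v (Finset.mem_sdiff.2 ⟨hv1.1, hv2.1⟩))
      rw [himg, Finset.mem_union, not_or]
      exact ⟨hv1.2, hv2.2⟩
    · rw [Function.update_of_ne, h2 p hp]
      rintro rfl; exact hR.1 hp
    · rcases Finset.mem_insert.1 hy with rfl | hy
      · rw [Function.update_self]; exact hv1.1
      · rw [Function.update_of_ne (show y ≠ x from fun h => hx (h ▸ hy))]
        exact h3 y hy

/-- Assigning vertices to positions which do not share windows with assigned positions. -/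
theorem Valid.place (hv : Valid k d E D f) (hE : ∀ v, Face E {v}) (T : Finset (Fin n))
    (R : Finset ℕ) (hR : Disjoint R D)
    (hsep : ∀ x ∈ R, ∀ s ∈ starts n k d x, ∀ p ∈ win n k s, p ∈ D ∪ R → p = x)
    (hcard : R.card ≤ (T \ D.image f).card) :
    ∃ f', Valid k d E (D ∪ R) f' ∧ (∀ p ∈ D, f' p = f p) ∧ ∀ x ∈ R, f' x ∈ T := by
  refine hv.greedy T 0 R hR (fun D' f' _ _ hDR _ x hx hxD => ⟨∅, by simp, fun v _ s hs => ?_⟩)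
    (by omega)
  have : win n k s ∩ D' = ∅ := by
    rw [Finset.eq_empty_iff_forall_notMem]
    intro p hp
    rw [Finset.mem_inter] at hp
    have := hsep x hx s hs p hp.1 (hDR hp.2)
    exact hxD (this ▸ hp.2)
  rw [this]
  simpa using hE v

/-- `A` has the property that faces meeting `A` are extended by all but `μ` vertices of `B`. -/
def Strong (k : ℕ) (E : Finset (Finset (Fin n))) (A B : Finset (Fin n)) (μ : ℕ) : Prop :=
  ∀ a ∈ A, ∀ σ, a ∈ σ → Face E σ → σ.card < k → (miss E σ ∩ B).card ≤ μ

theorem card_biUnion_starts_le (hk : k ≤ n) (x : ℕ) (g : ℕ → Finset (Fin n)) {μ : ℕ}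
    (h : ∀ s ∈ starts n k d x, (g s).card ≤ μ) :
    ((starts n k d x).biUnion g).card ≤ k * μ :=
  (Finset.card_biUnion_le_card_mul _ _ _ h).trans (Nat.mul_le_mul_right _ (card_starts_le x hk))

/-- Filling positions all of whose windows contain an assigned vertex of `A`. -/
theorem Valid.fill (hk : k ≤ n) (hv : Valid k d E D f) {A B : Finset (Fin n)} {μ : ℕ}
    (hA : Strong k E A B μ) (R : Finset ℕ) (hR : Disjoint R D)
    (hwin : ∀ x ∈ R, ∀ s ∈ starts n k d x, ∃ p ∈ D, p ∈ win n k s ∧ f p ∈ A)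
    (hcard : R.card + k * μ ≤ (B \ D.image f).card) :
    ∃ f', Valid k d E (D ∪ R) f' ∧ (∀ p ∈ D, f' p = f p) ∧ ∀ x ∈ R, f' x ∈ B := by
  refine hv.greedy B (k * μ) R hR (fun D' f' hv' hDD _ hff x hx hxD =>
    ⟨(starts n k d x).biUnion fun s => miss E ((win n k s ∩ D').image f') ∩ B,
      card_biUnion_starts_le hk x _ fun s hs => ?_, fun v hvT s hs => ?_⟩) hcard
  · obtain ⟨p, hpD, hps, hpA⟩ := hwin x hx s hs
    have hs' := mem_starts.1 hs
    refine hA (f p) hpA _ ?_ (hv'.face s hs'.1 hs'.2.1) (card_image_win_lt hk hxD hs)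
    rw [← hff p hpD]
    exact Finset.mem_image_of_mem _ (Finset.mem_inter.2 ⟨hps, hDD hpD⟩)
  · rw [Finset.mem_sdiff, Finset.mem_biUnion] at hvT
    apply face_insert
    intro hvm
    exact hvT.2 ⟨s, hs, Finset.mem_inter.2 ⟨hvm, hvT.1⟩⟩

/-- Filling an initial stretch of positions from left to right. -/
theorem Valid.stretch (hk1 : 1 ≤ k) (hk : k ≤ n) (hv : Valid k d E D f) {A B : Finset (Fin n)}
    {μ τ m : ℕ} (hA : Strong k E A B μ) (hm : m ≤ n) (hE : Face E ∅)
    (hτ : ∀ σ, Face E σ → σ.card < k → (miss E σ).card ≤ τ) (hD : ∀ x < m, x ∉ D)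
    (hwin : ∀ x < m, ∀ s ∈ starts n k d x, s + k ≤ m ∨ ∃ p ∈ D, p ∈ win n k s ∧ f p ∈ A)
    (hcard : m + τ + k * μ ≤ (B \ D.image f).card) :
    ∃ f', Valid k d E (D ∪ Finset.range m) f' ∧ (∀ p ∈ D, f' p = f p) ∧ ∀ x < m, f' x ∈ B := by
  suffices H : ∀ j ≤ m, ∃ f', Valid k d E (D ∪ Finset.range j) f' ∧ (∀ p ∈ D, f' p = f p) ∧
      (∀ x < j, f' x ∈ B) ∧ Face E ((Finset.Ico (j + 1 - k) j).image f') by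
    obtain ⟨f', h1, h2, h3, -⟩ := H m le_rfl
    exact ⟨f', h1, h2, h3⟩
  intro j
  induction j with
  | zero => exact fun _ => ⟨f, by simpa using hv, fun _ _ => rfl, by simp, by simpa using hE⟩
  | succ j ih =>
    intro hj
    obtain ⟨f', h1, h2, h3, h4⟩ := ih (by omega)
    have hjD : j ∉ D ∪ Finset.range j := by
      have := hD j (by omega)
      simp [this]
    have hI : ((Finset.Ico (j + 1 - k) j).image f').card < k :=
      Finset.card_image_le.trans_lt (by rw [Nat.card_Ico]; omega)
    have himg : (D ∪ Finset.range j).image f' = D.image f ∪ (Finset.range j).image f' := by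
      rw [Finset.image_union]; congr 1
      exact Finset.image_congr fun p hp => h2 p hp
    set S := (starts n k d j).filter fun s => ∃ p ∈ D, p ∈ win n k s ∧ f p ∈ A with hS
    set T := miss E ((Finset.Ico (j + 1 - k) j).image f') ∪ (Finset.range j).image f' ∪
      S.biUnion fun s => miss E ((win n k s ∩ (D ∪ Finset.range j)).image f') ∩ B with hT
    have hTc : T.card < (B \ D.image f).card := by
      have e1 := hτ _ h4 hI
      have e2 : ((Finset.range j).image f').card ≤ j := Finset.card_image_le.trans (by simp)
      have e3 : (S.biUnion fun s =>
          miss E ((win n k s ∩ (D ∪ Finset.range j)).image f') ∩ B).card ≤ k * μ := by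
        refine (Finset.card_biUnion_le_card_mul _ _ μ fun s hs => ?_).trans
          (Nat.mul_le_mul_right _ ((Finset.card_filter_le _ _).trans (card_starts_le j hk)))
        obtain ⟨hs, p, hpD, hps, hpA⟩ := Finset.mem_filter.1 hs
        have hs' := mem_starts.1 hs
        refine hA (f p) hpA _ ?_ (h1.face s hs'.1 hs'.2.1) (card_image_win_lt hk hjD hs)
        rw [← h2 p hpD]
        exact Finset.mem_image_of_mem _ (Finset.mem_inter.2 ⟨hps, Finset.mem_union_left _ hpD⟩)
      have e4 := Finset.card_union_le (miss E ((Finset.Ico (j + 1 - k) j).image f') ∪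
        (Finset.range j).image f') (S.biUnion fun s =>
          miss E ((win n k s ∩ (D ∪ Finset.range j)).image f') ∩ B)
      have e5 := Finset.card_union_le (miss E ((Finset.Ico (j + 1 - k) j).image f'))
        ((Finset.range j).image f')
      rw [hT]
      omega
    obtain ⟨v, hv1, hv2⟩ := Finset.exists_mem_notMem_of_card_lt_card hTc
    rw [Finset.mem_sdiff] at hv1
    simp only [hT, Finset.mem_union, not_or] at hv2
    obtain ⟨⟨hv2, hv3⟩, hv4⟩ := hv2
    refine ⟨Function.update f' j v, ?_, fun p hp => ?_, fun y hy => ?_, ?_⟩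
    · rw [Finset.range_add_one, Finset.union_insert]
      refine h1.insert hjD ?_ fun s hs => ?_
      · rw [himg, Finset.mem_union, not_or]
        exact ⟨hv1.2, hv3⟩
      · apply face_insert
        by_cases hsS : ∃ p ∈ D, p ∈ win n k s ∧ f p ∈ A
        · intro hvm
          exact hv4 (Finset.mem_biUnion.2 ⟨s, Finset.mem_filter.2 ⟨hs, hsS⟩,
            Finset.mem_inter.2 ⟨hvm, hv1.1⟩⟩)
        · have hsm := (hwin j (by omega) s hs).resolve_right hsS
          refine fun hvm => hv2 (miss_mono (Finset.image_subset_image fun p hp => ?_) hvm)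
          have hs' := mem_starts.1 hs
          have e1 := mem_win.1 hs'.2.2
          rw [Finset.mem_inter, mem_win] at hp
          have e2 : p < j := by
            rcases Finset.mem_union.1 hp.2 with h | h
            · exact absurd h (hD p (by omega))
            · exact Finset.mem_range.1 h
          rw [Finset.mem_Ico]
          omega
    · rw [Function.update_of_ne, h2 p hp]
      rintro rfl; exact hjD (Finset.mem_union_left _ hp)
    · rcases Nat.lt_succ_iff_lt_or_eq.1 hy with hy | rfl
      · rw [Function.update_of_ne hy.ne]; exact h3 y hy
      · rw [Function.update_self]; exact hv1.1
    · refine (face_insert hv2).mono fun w hw => ?_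
      obtain ⟨p, hp, rfl⟩ := Finset.mem_image.1 hw
      rw [Finset.mem_Ico] at hp
      rcases Nat.lt_succ_iff_lt_or_eq.1 hp.2 with h | rfl
      · rw [Function.update_of_ne h.ne]
        exact Finset.mem_insert_of_mem (Finset.mem_image_of_mem _
          (Finset.mem_Ico.2 ⟨by omega, h⟩))
      · rw [Function.update_self]; exact Finset.mem_insert_self _ _

end valid

section finish
variable {n : ℕ} {k d : ℕ} {E : Finset (Finset (Fin n))} {D : Finset ℕ} {f : ℕ → Fin n}

theorem exists_matching_of_half {Y : Finset ℕ} {R : Finset (Fin n)} (hY : Y.Nonempty) (hYR : Y.card = R.card)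
    (r : ℕ → Fin n → Prop) [∀ y b, Decidable (r y b)]
    (hy : ∀ y ∈ Y, Y.card ≤ 2 * (R.filter (r y)).card)
    (hb : ∀ b ∈ R, 2 * (Y.filter fun y => ¬ r y b).card ≤ Y.card) :
    ∃ g : ℕ → Fin n, Set.InjOn g Y ∧ ∀ y ∈ Y, g y ∈ R ∧ r y (g y) := by
  obtain ⟨g, hg, hgr⟩ := (Finset.all_card_le_biUnion_card_iff_exists_injective
    (fun y : Y => R.filter (r y))).1 (fun S => by
      rcases S.eq_empty_or_nonempty with rfl | ⟨y₀, hy₀⟩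
      · simp
      by_cases hS : 2 * S.card ≤ Y.card
      · have h1 := hy y₀ y₀.2
        have h2 := Finset.card_le_card (Finset.subset_biUnion_of_mem
          (fun y : Y => R.filter (r y)) hy₀)
        omega
      · have hR : R ⊆ S.biUnion fun y : Y => R.filter (r y) := by
          intro b hbR
          by_contra hcon
          have h3 : (S.map (Function.Embedding.subtype _)) ⊆ Y.filter fun y => ¬ r y b := by
            intro y hyS
            obtain ⟨y', hy', rfl⟩ := Finset.mem_map.1 hyS
            refine Finset.mem_filter.2 ⟨y'.2, fun hr => hcon ?_⟩
            exact Finset.mem_biUnion.2 ⟨y', hy', Finset.mem_filter.2 ⟨hbR, hr⟩⟩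
          have h4 := Finset.card_le_card h3
          rw [Finset.card_map] at h4
          have := hb b hbR
          omega
        have h5 := Finset.card_le_card hR
        have h6 : S.card ≤ Y.card := (Finset.card_le_univ S).trans (by simp)
        omega)
  obtain ⟨y₀, hy₀⟩ := hY
  refine ⟨fun p => if h : p ∈ Y then g ⟨p, h⟩ else g ⟨y₀, hy₀⟩, fun a ha b hb' hab => ?_,
    fun y hyY => ?_⟩
  · simp only [Finset.mem_coe] at ha hb'
    simp only [ha, hb', dif_pos] at hab
    simpa using hg hab
  · simp only [hyY, dif_pos]
    exact Finset.mem_filter.1 (hgr ⟨y, hyY⟩)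

theorem Valid.finish (hv : Valid k d E D f) {Y : Finset ℕ} (hYD : Disjoint Y D)
    (hsep : ∀ s < n, d ∣ s → ∀ y ∈ Y, ∀ y' ∈ Y, y ∈ win n k s → y' ∈ win n k s → y = y')
    {g : ℕ → Fin n} (hg : Set.InjOn g Y) (hgD : ∀ y ∈ Y, g y ∉ D.image f)
    (hgf : ∀ y ∈ Y, ∀ s ∈ starts n k d y, Face E (Insert.insert (g y) ((win n k s ∩ D).image f))) :
    Valid k d E (D ∪ Y) (Y.piecewise g f) := by
  have hD : ∀ p ∈ D, p ∉ Y := fun p hp hpY => Finset.disjoint_left.1 hYD hpY hp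
  refine ⟨?_, fun s hs hds => ?_⟩
  · intro a ha b hb hab
    rw [Finset.mem_coe, Finset.mem_union] at ha hb
    by_cases haY : a ∈ Y <;> by_cases hbY : b ∈ Y
    · rw [Finset.piecewise_eq_of_mem _ _ _ haY, Finset.piecewise_eq_of_mem _ _ _ hbY] at hab
      exact hg haY hbY hab
    · rw [Finset.piecewise_eq_of_mem _ _ _ haY, Finset.piecewise_eq_of_notMem _ _ _ hbY] at hab
      exact (hgD a haY (hab ▸ Finset.mem_image_of_mem _ (hb.resolve_right hbY))).elim
    · rw [Finset.piecewise_eq_of_notMem _ _ _ haY, Finset.piecewise_eq_of_mem _ _ _ hbY] at hab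
      exact (hgD b hbY (hab ▸ Finset.mem_image_of_mem _ (ha.resolve_right haY))).elim
    · rw [Finset.piecewise_eq_of_notMem _ _ _ haY, Finset.piecewise_eq_of_notMem _ _ _ hbY] at hab
      exact hv.injOn (ha.resolve_right haY) (hb.resolve_right hbY) hab
  · by_cases hY : ∃ y ∈ Y, y ∈ win n k s
    · obtain ⟨y, hyY, hys⟩ := hY
      refine (hgf y hyY s (mem_starts.2 ⟨hs, hds, hys⟩)).mono fun w hw => ?_
      obtain ⟨p, hp, rfl⟩ := Finset.mem_image.1 hw
      rw [Finset.mem_inter, Finset.mem_union] at hp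
      by_cases hpY : p ∈ Y
      · rw [hsep s hs hds p hpY y hyY hp.1 hys, Finset.piecewise_eq_of_mem _ _ _ hyY]
        exact Finset.mem_insert_self _ _
      · rw [Finset.piecewise_eq_of_notMem _ _ _ hpY]
        exact Finset.mem_insert_of_mem (Finset.mem_image_of_mem _
          (Finset.mem_inter.2 ⟨hp.1, hp.2.resolve_right hpY⟩))
    · refine (hv.face s hs hds).mono fun w hw => ?_
      obtain ⟨p, hp, rfl⟩ := Finset.mem_image.1 hw
      rw [Finset.mem_inter, Finset.mem_union] at hp
      have hpY : p ∉ Y := fun h => hY ⟨p, h, hp.1⟩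
      rw [Finset.piecewise_eq_of_notMem _ _ _ hpY]
      exact Finset.mem_image_of_mem _ (Finset.mem_inter.2 ⟨hp.1, hp.2.resolve_right hpY⟩)

theorem Valid.hamCycle {l : ℕ} (hE : ∀ e ∈ E, e.card = k) (hn : 0 < n) (hkn : k ≤ n)
    (hdn : (k - l) ∣ n) (hv : Valid k (k - l) E (Finset.range n) f) : HamCycle k l E := by
  have : NeZero n := ⟨hn.ne'⟩
  have hinj : Function.Injective fun z : ZMod n => f z.val := fun a b hab =>
    ZMod.val_injective n (hv.injOn (by simpa using ZMod.val_lt a) (by simpa using ZMod.val_lt b) hab)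
  refine ⟨fun z => f z.val, (Fintype.bijective_iff_injective_and_card _).2
    ⟨hinj, by rw [ZMod.card, Fintype.card_fin]⟩, fun i => ?_⟩
  have hs : i * (k - l) % n < n := Nat.mod_lt _ hn
  have hds : (k - l) ∣ i * (k - l) % n := (Nat.dvd_mod_iff hdn).2 (Nat.dvd_mul_left _ _)
  have hface := hv.face _ hs hds
  rw [Finset.inter_eq_left.2 (fun p hp => Finset.mem_range.2 (mem_win.1 hp).1)] at hface
  have himg : (Finset.image (fun j : Fin k =>
      f ((((i * (k - l) + (j : ℕ)) : ℕ) : ZMod n)).val) Finset.univ) =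
      (win n k (i * (k - l) % n)).image f := by
    rw [win_eq_image hkn hs, Finset.image_image]
    congr 1
    funext j
    rw [ZMod.val_natCast]
    simp [Nat.mod_add_mod]
  rw [himg]
  refine hface.mem hE ?_
  rw [Finset.card_image_of_injOn, card_win hkn hs]
  exact hv.injOn.mono fun p hp => by
    simpa using (mem_win.1 hp).1

end finish

section triples
variable {n k d t s₀ π : ℕ} {E : Finset (Finset (Fin n))} {D : Finset ℕ} {f : ℕ → Fin n}

theorem exists_starts (hd : 1 ≤ d) (hdk : d ≤ k) {p : ℕ} (hp : p < n) :
    ∃ s, s ∈ starts n k d p := by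
  have h1 := Nat.div_add_mod p d
  have h2 := Nat.mod_lt p hd
  refine ⟨d * (p / d), mem_starts.2 ⟨by omega, dvd_mul_right _ _, mem_win.2 ⟨hp, ?_⟩⟩⟩
  omega

/-- The vertices of a list of triples. -/
def tripleVerts (L : List (Fin n × Fin n × Fin n)) : List (Fin n) :=
  L.flatMap fun x => [x.1, x.2.1, x.2.2]

/-- The positions `spec j, spec j + 1, spec (j + 1), spec (j + 2), …` reserved for `m` triples. -/
def triplePos (s₀ t : ℕ) : ℕ → ℕ → Finset ℕ
  | _, 0 => ∅
  | j, m + 1 => insert (spec s₀ t (j + 1)) (insert (spec s₀ t j + 1) (insert (spec s₀ t j)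
      (triplePos s₀ t (j + 2) m)))

theorem mem_triplePos {j m p : ℕ} : p ∈ triplePos s₀ t j m ↔
    ∃ i < m, p = spec s₀ t (j + 2 * i) ∨ p = spec s₀ t (j + 2 * i) + 1 ∨
      p = spec s₀ t (j + 2 * i + 1) := by
  induction m generalizing j with
  | zero => simp [triplePos]
  | succ m ih =>
    simp only [triplePos, Finset.mem_insert, ih]
    constructor
    · rintro (h | h | h | ⟨i, hi, h⟩)
      · exact ⟨0, by omega, Or.inr (Or.inr h)⟩
      · exact ⟨0, by omega, Or.inr (Or.inl h)⟩
      · exact ⟨0, by omega, Or.inl h⟩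
      · refine ⟨i + 1, by omega, ?_⟩
        rw [show j + 2 * (i + 1) = j + 2 + 2 * i by ring]
        exact h
    · rintro ⟨i, hi, h⟩
      rcases i with _ | i
      · rcases h with h | h | h
        · exact Or.inr (Or.inr (Or.inl h))
        · exact Or.inr (Or.inl h)
        · exact Or.inl h
      · refine Or.inr (Or.inr (Or.inr ⟨i, by omega, ?_⟩))
        rw [show j + 2 * (i + 1) = j + 2 + 2 * i by ring] at h
        exact h

theorem Valid.triple (h : Layout n k d t s₀ π) (hE : ∀ v, Face E {v}) (hv : Valid k d E D f)
    {j : ℕ} (hj : j + 1 < π)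
    (hsep : ∀ m, m = j ∨ m = j + 1 → ∀ s ∈ starts n k d (spec s₀ t m), win n k s ∩ D = ∅)
    {a b c : Fin n} (hab : a ≠ b) (hac : a ≠ c) (hbc : b ≠ c) (ha : a ∉ D.image f)
    (hb : b ∉ D.image f) (hc : c ∉ D.image f) (h1 : Face E {a, b}) (h2 : Face E {b, c}) :
    ∃ f', Valid k d E (Insert.insert (spec s₀ t (j + 1)) (Insert.insert (spec s₀ t j + 1)
      (Insert.insert (spec s₀ t j) D))) f' ∧ (∀ p ∈ D, f' p = f p) ∧ f' (spec s₀ t j) = a ∧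
      f' (spec s₀ t j + 1) = b ∧ f' (spec s₀ t (j + 1)) = c := by
  have hdk : d ≤ k := h.d_le.trans h.htk
  have ht := h.ht
  have hp1 := h.spec_lt (show j < π by omega)
  have hp3 := h.spec_lt hj
  have hp13 : spec s₀ t (j + 1) = spec s₀ t j + 1 * t := spec_add _ _ _ _
  have hnot : ∀ s p, s < n → d ∣ s → (spec s₀ t j ∈ win n k s ∨ spec s₀ t (j + 1) ∈ win n k s) →
      p ∈ win n k s → p ∉ D := by
    intro s p hs hds hor hp hpD
    have : win n k s ∩ D = ∅ := by
      rcases hor with hor | hor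
      · exact hsep j (Or.inl rfl) s (mem_starts.2 ⟨hs, hds, hor⟩)
      · exact hsep (j + 1) (Or.inr rfl) s (mem_starts.2 ⟨hs, hds, hor⟩)
    exact Finset.eq_empty_iff_forall_notMem.1 this p (Finset.mem_inter.2 ⟨hp, hpD⟩)
  have hD1 : spec s₀ t j ∉ D := by
    obtain ⟨s, hs⟩ := exists_starts h.hd hdk hp1
    rw [mem_starts] at hs
    exact hnot s _ hs.1 hs.2.1 (Or.inl hs.2.2) hs.2.2
  have hD2 : spec s₀ t j + 1 ∉ D := by
    obtain ⟨s, hs⟩ := exists_starts h.hd hdk (show spec s₀ t j + 1 < n by omega)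
    rw [mem_starts] at hs
    exact hnot s _ hs.1 hs.2.1 (h.spec_of_succ hs.1 hj hs.2.2) hs.2.2
  have hD3 : spec s₀ t (j + 1) ∉ D := by
    obtain ⟨s, hs⟩ := exists_starts h.hd hdk hp3
    rw [mem_starts] at hs
    exact hnot s _ hs.1 hs.2.1 (Or.inr hs.2.2) hs.2.2
  generalize hx1 : spec s₀ t j = x1 at *
  generalize hx3 : spec s₀ t (j + 1) = x3 at *
  have n12 : x1 + 1 ≠ x1 := by omega
  have n31 : x3 ≠ x1 := by omega
  have n32 : x3 ≠ x1 + 1 := by omega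
  have v1 := hv.insert hD1 ha fun s hs => by
    rw [mem_starts] at hs
    refine (hE a).mono fun w hw => ?_
    rcases Finset.mem_insert.1 hw with rfl | hw
    · simp
    · obtain ⟨p, hp, rfl⟩ := Finset.mem_image.1 hw
      rw [Finset.mem_inter] at hp
      exact (hnot s p hs.1 hs.2.1 (Or.inl hs.2.2) hp.1 hp.2).elim
  have hne : ∀ p ∈ D, p ≠ x1 := fun p hp he => hD1 (he ▸ hp)
  have hne2 : ∀ p ∈ D, p ≠ x1 + 1 := fun p hp he => hD2 (he ▸ hp)
  have hne3 : ∀ p ∈ D, p ≠ x3 := fun p hp he => hD3 (he ▸ hp)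
  have v2 := v1.insert (x := x1 + 1) (v := b) (by simp [hD2]) (by
    rw [Finset.image_insert, Function.update_self, Finset.mem_insert, not_or]
    refine ⟨hab.symm, fun hb' => hb ?_⟩
    obtain ⟨p, hp, hpb⟩ := Finset.mem_image.1 hb'
    rw [Function.update_of_ne (hne p hp)] at hpb
    exact Finset.mem_image.2 ⟨p, hp, hpb⟩) fun s hs => by
    rw [mem_starts] at hs
    refine h1.mono fun w hw => ?_
    rcases Finset.mem_insert.1 hw with rfl | hw
    · simp
    · obtain ⟨p, hp, rfl⟩ := Finset.mem_image.1 hw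
      rw [Finset.mem_inter, Finset.mem_insert] at hp
      rcases hp.2 with rfl | hpD
      · simp
      · refine (hnot s p hs.1 hs.2.1 ?_ hp.1 hpD).elim
        rw [← hx1, ← hx3]
        refine h.spec_of_succ hs.1 hj ?_
        rw [hx1]; exact hs.2.2
  have v3 := v2.insert (x := x3) (v := c) (by simp [hD3, n31, n32]) (by
    rw [Finset.image_insert, Function.update_self, Finset.image_insert,
      Function.update_of_ne n12.symm, Function.update_self, Finset.mem_insert, Finset.mem_insert,
      not_or, not_or]
    refine ⟨hbc.symm, hac.symm, fun hc' => hc ?_⟩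
    obtain ⟨p, hp, hpb⟩ := Finset.mem_image.1 hc'
    rw [Function.update_of_ne (hne2 p hp), Function.update_of_ne (hne p hp)] at hpb
    exact Finset.mem_image.2 ⟨p, hp, hpb⟩) fun s hs => by
    rw [mem_starts] at hs
    refine h2.mono fun w hw => ?_
    rcases Finset.mem_insert.1 hw with rfl | hw
    · simp
    · obtain ⟨p, hp, rfl⟩ := Finset.mem_image.1 hw
      rw [Finset.mem_inter, Finset.mem_insert, Finset.mem_insert] at hp
      rcases hp.2 with rfl | rfl | hpD
      · simp
      · exfalso
        have := h.spec_unique hs.1 hs.2.1 (i := j) (j := j + 1) (by omega) hj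
          (by rw [hx1]; exact hp.1) (by rw [hx3]; exact hs.2.2)
        omega
      · exact (hnot s p hs.1 hs.2.1 (Or.inr hs.2.2) hp.1 hpD).elim
  refine ⟨_, v3, fun p hp => ?_, ?_, ?_, ?_⟩
  · rw [Function.update_of_ne (hne3 p hp), Function.update_of_ne (hne2 p hp),
      Function.update_of_ne (hne p hp)]
  · rw [Function.update_of_ne n31.symm, Function.update_of_ne n12.symm, Function.update_self]
  · rw [Function.update_of_ne n32.symm, Function.update_self]
  · rw [Function.update_self]

theorem Valid.triples (h : Layout n k d t s₀ π) (hE : ∀ v, Face E {v})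
    (L : List (Fin n × Fin n × Fin n)) (hL : ∀ x ∈ L, Face E {x.1, x.2.1} ∧ Face E {x.2.1, x.2.2})
    (hn : (tripleVerts L).Nodup) {j : ℕ} (hv : Valid k d E D f) (hj : j + 2 * L.length ≤ π)
    (hsep : ∀ m, j ≤ m → m < j + 2 * L.length → ∀ s ∈ starts n k d (spec s₀ t m),
      win n k s ∩ D = ∅)
    (hD : ∀ v ∈ tripleVerts L, v ∉ D.image f) :
    ∃ f', Valid k d E (D ∪ triplePos s₀ t j L.length) f' ∧ (∀ p ∈ D, f' p = f p) ∧
      (triplePos s₀ t j L.length).image f' = (tripleVerts L).toFinset ∧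
      ∀ T : Finset (Fin n), (∀ x ∈ L, x.1 ∈ T ∧ x.2.2 ∈ T) →
        ∀ m, j ≤ m → m < j + 2 * L.length → f' (spec s₀ t m) ∈ T := by
  induction L generalizing j D f with
  | nil => exact ⟨f, by simpa [triplePos] using hv, fun _ _ => rfl, by simp [triplePos, tripleVerts],
      fun _ _ m h1 h2 => by simp at h2; omega⟩
  | cons x L ih =>
    obtain ⟨a, b, c⟩ := x
    have hx := hL _ (List.mem_cons_self)
    have htv : tripleVerts ((a, b, c) :: L) = a :: b :: c :: tripleVerts L := by
      simp [tripleVerts]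
    rw [htv] at hn hD
    rw [htv]
    simp only [List.nodup_cons, List.mem_cons, not_or] at hn
    simp only [List.length_cons] at hj hsep ⊢
    obtain ⟨⟨hab, hac, haL⟩, ⟨hbc, hbL⟩, hcL, hn⟩ := hn
    obtain ⟨f₁, v₁, e₁, ea, eb, ec⟩ := hv.triple h hE (j := j) (by omega)
      (fun m hm => hsep m (by omega) (by omega)) hab hac hbc (hD a (by simp)) (hD b (by simp))
      (hD c (by simp)) hx.1 hx.2
    have himg : (Insert.insert (spec s₀ t (j + 1)) (Insert.insert (spec s₀ t j + 1)
      (Insert.insert (spec s₀ t j) D))).image f₁ = {c, b, a} ∪ D.image f := by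
      rw [Finset.image_insert, Finset.image_insert, Finset.image_insert, ea, eb, ec,
        Finset.image_congr (g := f) fun p hp => e₁ p hp]
      ext v; simp
    obtain ⟨f₂, v₂, e₂, e₃, e₄⟩ := ih (fun x hx => hL x (List.mem_cons_of_mem _ hx)) hn v₁ (j := j + 2)
      (by omega) (fun m h1 h2 s hs => by
        have h3 := hsep m (by omega) (by omega) s hs
        have hs' := mem_starts.1 hs
        have key : ∀ i, i = j ∨ i = j + 1 → spec s₀ t i ∉ win n k s := fun i hi hw => by
          have := h.spec_unique hs'.1 hs'.2.1 (by omega) (by omega) hw hs'.2.2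
          omega
        rw [Finset.eq_empty_iff_forall_notMem] at h3 ⊢
        intro p hp
        rw [Finset.mem_inter, Finset.mem_insert, Finset.mem_insert, Finset.mem_insert] at hp
        obtain ⟨hpw, rfl | rfl | rfl | hpD⟩ := hp
        · exact key _ (Or.inr rfl) hpw
        · rcases h.spec_of_succ hs'.1 (by omega) hpw with hw | hw
          · exact key _ (Or.inl rfl) hw
          · exact key _ (Or.inr rfl) hw
        · exact key _ (Or.inl rfl) hpw
        · exact h3 p (Finset.mem_inter.2 ⟨hpw, hpD⟩)) (fun v hvL => by
        rw [himg, Finset.mem_union, not_or]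
        refine ⟨?_, hD v (by simp [hvL])⟩
        simp only [Finset.mem_insert, Finset.mem_singleton, not_or]
        exact ⟨fun h => hcL (h ▸ hvL), fun h => hbL (h ▸ hvL), fun h => haL (h ▸ hvL)⟩)
    refine ⟨f₂, ?_, fun p hp => ?_, ?_, fun T hT m h1 h2 => ?_⟩
    · convert v₂ using 1
      ext p; simp only [triplePos, Finset.mem_union, Finset.mem_insert]; tauto
    · rw [e₂ p (by simp [hp]), e₁ p hp]
    · rw [triplePos, Finset.image_insert, Finset.image_insert, Finset.image_insert, e₃,
        e₂ _ (by simp), e₂ _ (by simp), e₂ _ (by simp), ea, eb, ec]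
      ext v; simp; tauto
    · have hx := hT _ List.mem_cons_self
      rcases Nat.lt_or_ge m (j + 2) with h3 | h3
      · rcases (show m = j ∨ m = j + 1 by omega) with rfl | rfl
        · rw [e₂ _ (by simp), ea]; exact hx.1
        · rw [e₂ _ (by simp), ec]; exact hx.2
      · exact e₄ T (fun x hx => hT x (List.mem_cons_of_mem _ hx)) m h3 (by omega)

theorem card_tripleVerts (L : List (Fin n × Fin n × Fin n)) :
    (tripleVerts L).length = 3 * L.length := by
  induction L with
  | nil => rfl
  | cons x L ih => simp only [tripleVerts, List.flatMap_cons, List.length_append,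
      List.length_cons, List.length_nil] at *; omega

end triples

section gadgets
variable {n k d t s₀ π : ℕ} {E : Finset (Finset (Fin n))} {D : Finset ℕ} {f : ℕ → Fin n}

/-- The positions left open until the end. -/
def openPos (s₀ t g : ℕ) : Finset ℕ := (Finset.range g).image fun i => spec s₀ t (20 + 2 * i) + 1

/-- The special positions around the open positions. -/
def zone (s₀ t g : ℕ) : Finset ℕ := (Finset.Ico 10 (2 * g + 30)).image (spec s₀ t)

theorem mem_openPos {g y : ℕ} : y ∈ openPos s₀ t g ↔ ∃ i < g, y = spec s₀ t (20 + 2 * i) + 1 := by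
  simp only [openPos, Finset.mem_image, Finset.mem_range]
  exact ⟨fun ⟨i, h, e⟩ => ⟨i, h, e.symm⟩, fun ⟨i, h, e⟩ => ⟨i, h, e.symm⟩⟩

theorem mem_zone {g p : ℕ} : p ∈ zone s₀ t g ↔ ∃ j, 10 ≤ j ∧ j < 2 * g + 30 ∧ p = spec s₀ t j := by
  simp only [zone, Finset.mem_image, Finset.mem_Ico]
  exact ⟨fun ⟨i, h, e⟩ => ⟨i, h.1, h.2, e.symm⟩, fun ⟨i, h, h', e⟩ => ⟨i, ⟨h, h'⟩, e.symm⟩⟩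

theorem Layout.card_openPos (h : Layout n k d t s₀ π) (g : ℕ) : (openPos s₀ t g).card = g := by
  rw [openPos, Finset.card_image_of_injOn, Finset.card_range]
  intro i _ j _ hij
  have := h.spec_inj (Nat.succ_injective hij)
  omega

theorem Layout.card_zone (h : Layout n k d t s₀ π) (g : ℕ) : (zone s₀ t g).card = 2 * g + 20 := by
  rw [zone, Finset.card_image_of_injOn, Nat.card_Ico]
  · omega
  · intro i _ j _ hij
    exact h.spec_inj hij

/-- A partial placement around the open positions `openPos s₀ t g`. -/
structure Gadgets (n k d t s₀ π g : ℕ) (E : Finset (Finset (Fin n))) (A B : Finset (Fin n))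
    (D : Finset ℕ) (f : ℕ → Fin n) : Prop where
  valid : Valid k d E D f
  zone_sub : zone s₀ t g ⊆ D
  zone_mem : ∀ p ∈ zone s₀ t g, f p ∈ A
  rest_mem : ∀ p ∈ D, p ∉ zone s₀ t g → f p ∈ B
  open_disj : Disjoint (openPos s₀ t g) D
  win_sub : ∀ y ∈ openPos s₀ t g, ∀ s ∈ starts n k d y, ∀ p ∈ win n k s, p ∈ D ∨ p = y
  far : ∀ m < π, (m < 10 ∨ 2 * g + 30 ≤ m) → ∀ s ∈ starts n k d (spec s₀ t m), win n k s ∩ D = ∅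
  start_le : ∀ p ∈ D, s₀ + t ≤ p
  lt_of_mem : ∀ p ∈ D, p < n
  card_le : D.card ≤ 2 * g + 20 + g * (k * k)

theorem Layout.sep_spec (h : Layout n k d t s₀ π) {s i j : ℕ}
    (hi : i < π) (hs : s ∈ starts n k d (spec s₀ t i)) (hj : j < π)
    (hw : spec s₀ t j ∈ win n k s) : j = i := by
  have hs := mem_starts.1 hs
  exact h.spec_unique hs.1 hs.2.1 hj hi hw hs.2.2

theorem Layout.open_win (h : Layout n k d t s₀ π) {g y s : ℕ} (hg : 2 * g + 40 ≤ π)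
    (hy : y ∈ openPos s₀ t g) (hs : s < n) (hys : y ∈ win n k s) :
    ∃ p ∈ zone s₀ t g, p ∈ win n k s := by
  obtain ⟨i, hi, rfl⟩ := mem_openPos.1 hy
  rcases h.spec_of_succ hs (by omega) hys with hw | hw
  · exact ⟨_, mem_zone.2 ⟨_, by omega, by omega, rfl⟩, hw⟩
  · exact ⟨_, mem_zone.2 ⟨_, by omega, by omega, rfl⟩, hw⟩

theorem Layout.open_notMem_zone (h : Layout n k d t s₀ π) {g y : ℕ} 
    (hy : y ∈ openPos s₀ t g) : ∀ j, y ≠ spec s₀ t j := by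
  obtain ⟨i, hi, rfl⟩ := mem_openPos.1 hy
  intro j hj
  have h3 := h.ht
  rcases lt_trichotomy j (20 + 2 * i) with hl | rfl | hl
  · have := spec_mono (s₀ := s₀) (t := t) 1 (show j + 1 ≤ 20 + 2 * i by omega); omega
  · omega
  · have := spec_mono (s₀ := s₀) (t := t) 1 (show 20 + 2 * i + 1 ≤ j by omega); omega

theorem Layout.openPos_sep (h : Layout n k d t s₀ π) {g : ℕ} (hg : 2 * g + 40 ≤ π) :
    ∀ s < n, ∀ y ∈ openPos s₀ t g, ∀ y' ∈ openPos s₀ t g, y ∈ win n k s → y' ∈ win n k s →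
      y = y' := by
  intro s hs y hy y' hy' hw hw'
  obtain ⟨i, hi, rfl⟩ := mem_openPos.1 hy
  obtain ⟨j, hj, rfl⟩ := mem_openPos.1 hy'
  rcases lt_trichotomy i j with hl | rfl | hl
  · exact (h.succ_unique hs (show 20 + 2 * i + 2 ≤ 20 + 2 * j by omega) (by omega) hw hw').elim
  · rfl
  · exact (h.succ_unique hs (show 20 + 2 * j + 2 ≤ 20 + 2 * i by omega) (by omega) hw' hw).elim

theorem Layout.exists_gadgets (h : Layout n k d t s₀ π) (hE : ∀ v, Face E {v}) (hE0 : Face E ∅)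
    {A B : Finset (Fin n)} {μ g : ℕ} (hAB : Disjoint A B) (hst : Strong k E A B μ)
    (hg : 2 * g + 40 ≤ π) (hA : 2 * g + 20 ≤ A.card) (hB : g * (k * k) + k * μ ≤ B.card) :
    ∃ D f, Gadgets n k d t s₀ π g E A B D f := by
  have hkn := h.hkn
  have hn0 : 0 < n := by have := h.htk; have := h.ht; omega
  have v0 : Valid k d E ∅ (fun _ => (⟨0, hn0⟩ : Fin n)) :=
    ⟨by simp, fun s _ _ => by simpa using hE0⟩
  obtain ⟨f0, v1, -, hz⟩ := v0.place hE A (zone s₀ t g) (by simp) (by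
    intro x hx s hs p hp hpD
    rw [Finset.empty_union] at hpD
    obtain ⟨i, -, hi, rfl⟩ := mem_zone.1 hx
    obtain ⟨j, -, hj, rfl⟩ := mem_zone.1 hpD
    rw [h.sep_spec (by omega) hs (by omega) hp]) (by simpa [h.card_zone] using hA)
  rw [Finset.empty_union] at v1
  obtain ⟨N, hN⟩ : ∃ N, N = ((openPos s₀ t g).biUnion fun y => (starts n k d y).biUnion
    fun s => win n k s) \ (openPos s₀ t g ∪ zone s₀ t g) := ⟨_, rfl⟩
  have memN : ∀ p, p ∈ N ↔ (∃ y ∈ openPos s₀ t g, ∃ s ∈ starts n k d y, p ∈ win n k s) ∧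
      p ∉ openPos s₀ t g ∧ p ∉ zone s₀ t g := by
    intro p; rw [hN, Finset.mem_sdiff, Finset.mem_biUnion, Finset.mem_union, not_or]
    simp only [Finset.mem_biUnion]
  have hNc : N.card ≤ g * (k * k) := by
    have h1 : ∀ y ∈ openPos s₀ t g, ((starts n k d y).biUnion fun s => win n k s).card ≤ k * k :=
      fun y _ => (Finset.card_biUnion_le_card_mul _ _ k fun s hs => (card_win hkn (mem_starts.1 hs).1).le).trans
        (Nat.mul_le_mul_right _ (card_starts_le y hkn))
    have h2 := Finset.card_biUnion_le_card_mul _ _ _ h1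
    rw [h.card_openPos] at h2
    rw [hN]
    exact (Finset.card_le_card Finset.sdiff_subset).trans h2
  have himg : (zone s₀ t g).image f0 ⊆ A := by
    intro v hv
    obtain ⟨p, hp, rfl⟩ := Finset.mem_image.1 hv
    exact hz p hp
  have hBc : B \ (zone s₀ t g).image f0 = B :=
    Finset.sdiff_eq_self_of_disjoint (hAB.symm.mono_right himg)
  obtain ⟨f1, v2, e, hNB⟩ := v1.fill hkn hst N
    (by rw [Finset.disjoint_left]; exact fun p hp => ((memN p).1 hp).2.2) (by
      intro x hx s hs
      obtain ⟨⟨y, hy, s', hs', hxs'⟩, -, -⟩ := (memN x).1 hx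
      obtain ⟨i, hi, rfl⟩ := mem_openPos.1 hy
      have a1 := mem_starts.1 hs
      have a2 := mem_starts.1 hs'
      obtain ⟨m, hm, hmw⟩ := h.exists_spec a1.1 (h.le_of_near a2.1 a1.1 (j := 20 + 2 * i)
        (by omega) (by omega) a2.2.2 hxs' a1.2.2)
      obtain ⟨b1, b2⟩ := h.near (u := 10) (l := 2 * g + 20) a2.1 a1.1 le_rfl (by omega)
        (by omega) (by omega) hm a2.2.2 hxs' a1.2.2 hmw
      have hmz : spec s₀ t m ∈ zone s₀ t g := mem_zone.2 ⟨m, b1, by omega, rfl⟩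
      exact ⟨_, hmz, hmw, hz _ hmz⟩) (by rw [hBc]; omega)
  refine ⟨_, f1, v2, Finset.subset_union_left, fun p hp => e p hp ▸ hz p hp, ?_, ?_, ?_, ?_, ?_, ?_, ?_⟩
  · intro p hp hpz
    exact hNB p ((Finset.mem_union.1 hp).resolve_left hpz)
  · rw [Finset.disjoint_left]
    intro y hy hyD
    rcases Finset.mem_union.1 hyD with hz | hN
    · obtain ⟨j, -, -, hj⟩ := mem_zone.1 hz
      exact h.open_notMem_zone hy j hj
    · exact ((memN y).1 hN).2.1 hy
  · intro y hy s hs p hp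
    by_cases hpy : p ∈ openPos s₀ t g
    · have a1 := mem_starts.1 hs
      exact Or.inr (h.openPos_sep hg s a1.1 p hpy y hy hp a1.2.2)
    · left
      rw [Finset.mem_union, memN]
      by_cases hpz : p ∈ zone s₀ t g
      · exact Or.inl hpz
      · exact Or.inr ⟨⟨y, hy, s, hs, hp⟩, hpy, hpz⟩
  · intro m hm hm' s hs
    rw [Finset.eq_empty_iff_forall_notMem]
    intro p hp
    rw [Finset.mem_inter, Finset.mem_union] at hp
    obtain ⟨hpw, hp | hp⟩ := hp
    · obtain ⟨j, b1, b2, rfl⟩ := mem_zone.1 hp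
      have := h.sep_spec hm hs (by omega) hpw
      omega
    · obtain ⟨⟨y, hy, s', hs', hxs'⟩, -, -⟩ := (memN p).1 hp
      obtain ⟨i, hi, rfl⟩ := mem_openPos.1 hy
      have a1 := mem_starts.1 hs
      have a2 := mem_starts.1 hs'
      have := h.near (u := 10) (l := 2 * g + 20) a2.1 a1.1 le_rfl (by omega)
        (by omega) (by omega) hm a2.2.2 hxs' hpw a1.2.2
      omega
  · have h0 : spec s₀ t 0 = s₀ + (t - 1) := by simp [spec]
    have h3 := h.ht
    have h4 := h.d_le
    have h5 := h.hkt
    intro p hp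
    rw [Finset.mem_union] at hp
    obtain hp | hp := hp
    · obtain ⟨j, b1, b2, rfl⟩ := mem_zone.1 hp
      have := spec_mono (s₀ := s₀) (t := t) 10 (show 0 + 10 ≤ j by omega)
      omega
    · obtain ⟨⟨y, hy, s', hs', hxs'⟩, -, -⟩ := (memN p).1 hp
      obtain ⟨i, hi, rfl⟩ := mem_openPos.1 hy
      have a2 := mem_starts.1 hs'
      have c1 := spec_mono (s₀ := s₀) (t := t) 10 (show 0 + 10 ≤ 20 + 2 * i by omega)
      have c2 := spec_mono (s₀ := s₀) (t := t) 10 (show 20 + 2 * i + 10 ≤ π - 1 by omega)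
      have c3 := h.spec_lt (show π - 1 < π by omega)
      have c4 := a2.2.2
      rw [mem_win] at c4 hxs'
      omega
  · intro p hp
    rcases Finset.mem_union.1 hp with hp | hp
    · obtain ⟨j, b1, b2, rfl⟩ := mem_zone.1 hp
      exact h.spec_lt (by omega)
    · obtain ⟨⟨y, hy, s', hs', hxs'⟩, -, -⟩ := (memN p).1 hp
      exact (mem_win.1 hxs').1
  · refine (Finset.card_union_le _ _).trans ?_
    rw [h.card_zone]; omega

end gadgets

section spoiled
variable {n k d t s₀ π : ℕ} {E : Finset (Finset (Fin n))} {D : Finset ℕ} {f : ℕ → Fin n}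

/-- The vertex `b` can be placed at position `y`. -/
def Fits (n k d : ℕ) (E : Finset (Finset (Fin n))) (D : Finset ℕ) (f : ℕ → Fin n) (y : ℕ)
    (b : Fin n) : Prop :=
  ∀ s ∈ starts n k d y, Face E (insert b ((win n k s ∩ D).image f))

open Classical in
theorem Gadgets.card_not_fits {g μ : ℕ} {A B : Finset (Fin n)} (h : Layout n k d t s₀ π)
    (G : Gadgets n k d t s₀ π g E A B D f) (hst : Strong k E A B μ) (hg : 2 * g + 40 ≤ π)
    {y : ℕ} (hy : y ∈ openPos s₀ t g) :
    (B.filter fun b => ¬ Fits n k d E D f y b).card ≤ k * μ := by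
  have hkn := h.hkn
  refine le_trans (Finset.card_le_card ?_) (card_biUnion_starts_le (d := d) (μ := μ) hkn y
    (fun s => miss E ((win n k s ∩ D).image f) ∩ B) fun s hs => ?_)
  · intro b hb
    rw [Finset.mem_filter, Fits] at hb
    obtain ⟨hbB, hb⟩ := hb
    push Not at hb
    obtain ⟨s, hs, hb⟩ := hb
    exact Finset.mem_biUnion.2 ⟨s, hs, Finset.mem_inter.2 ⟨mem_miss.2 hb, hbB⟩⟩
  · have hs' := mem_starts.1 hs
    obtain ⟨p, hp, hpw⟩ := h.open_win hg hy hs'.1 hs'.2.2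
    refine hst (f p) (G.zone_mem p hp) _ (Finset.mem_image_of_mem _ (Finset.mem_inter.2
      ⟨hpw, G.zone_sub hp⟩)) (G.valid.face s hs'.1 hs'.2.1)
      (card_image_win_lt hkn (Finset.disjoint_left.1 G.open_disj hy) hs)

open Classical in
theorem Gadgets.card_spoiled {g μ : ℕ} {A B : Finset (Fin n)} (h : Layout n k d t s₀ π)
    (G : Gadgets n k d t s₀ π g E A B D f) (hst : Strong k E A B μ) (hg : 2 * g + 40 ≤ π) :
    (B.filter fun b => g < 2 * ((openPos s₀ t g).filter
      fun y => ¬ Fits n k d E D f y b).card).card ≤ 2 * (k * μ) := by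
  obtain ⟨X, hX⟩ : ∃ X, X = B.filter fun b => g < 2 * ((openPos s₀ t g).filter
      fun y => ¬ Fits n k d E D f y b).card := ⟨_, rfl⟩
  rw [← hX]
  have h1 := Finset.sum_card_bipartiteAbove_eq_sum_card_bipartiteBelow
    (s := openPos s₀ t g) (t := X) (fun y b => ¬ Fits n k d E D f y b)
  have h2 : ∑ y ∈ openPos s₀ t g, (X.filter fun b => ¬ Fits n k d E D f y b).card ≤ g * (k * μ) := by
    have h6 : ∀ y ∈ openPos s₀ t g, (X.filter fun b => ¬ Fits n k d E D f y b).card ≤ k * μ :=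
      fun y hy => le_trans (Finset.card_le_card fun b hb => by
        rw [Finset.mem_filter] at hb ⊢
        rw [hX, Finset.mem_filter] at hb
        exact ⟨hb.1.1, hb.2⟩) (G.card_not_fits h hst hg hy)
    have := Finset.sum_le_card_nsmul _ _ _ h6
    rwa [h.card_openPos, smul_eq_mul] at this
  have h3 : X.card * (g + 1) ≤ 2 * ∑ b ∈ X, ((openPos s₀ t g).filter
      fun y => ¬ Fits n k d E D f y b).card := by
    rw [Finset.mul_sum, ← smul_eq_mul]
    refine Finset.card_nsmul_le_sum _ _ _ fun b hb => ?_
    rw [hX, Finset.mem_filter] at hb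
    exact hb.2
  have h4 : X.card * (g + 1) ≤ 2 * (g * (k * μ)) :=
    h3.trans (Nat.mul_le_mul_left _ (h1.symm.le.trans h2))
  have h5 : 2 * (g * (k * μ)) ≤ 2 * (k * μ) * (g + 1) := by
    calc 2 * (g * (k * μ)) = 2 * (k * μ) * g := by ring
      _ ≤ _ := Nat.mul_le_mul_left _ (by omega)
  exact Nat.le_of_mul_le_mul_right (h4.trans h5) (by omega)

theorem exists_triples {A : Finset (Fin n)} (S : List (Fin n)) (hS : S.Nodup)
    (hSA : ∀ b ∈ S, b ∉ A) (U : Finset (Fin n))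
    (hd : ∀ b ∈ S, U.card + 2 * S.length ≤ (A \ miss E {b}).card) :
    ∃ L : List (Fin n × Fin n × Fin n), L.length = S.length ∧
      (∀ x ∈ L, Face E {x.1, x.2.1} ∧ Face E {x.2.1, x.2.2}) ∧ (tripleVerts L).Nodup ∧
      (∀ v, v ∈ tripleVerts L ↔ v ∈ S ∨ v ∈ tripleVerts L ∧ v ∈ A ∧ v ∉ U) ∧
      (∀ x ∈ L, x.1 ∈ A ∧ x.2.2 ∈ A) ∧
      ((tripleVerts L).toFinset ∩ A).card = 2 * S.length := by
  induction S generalizing U with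
  | nil => exact ⟨[], rfl, by simp, by simp [tripleVerts], by simp [tripleVerts], by simp,
      by simp [tripleVerts]⟩
  | cons b S ih =>
    have hb := hd b (by simp)
    rw [List.length_cons] at hb
    have h1 : 1 < ((A \ miss E {b}) \ U).card := by
      have := Finset.le_card_sdiff U (A \ miss E {b})
      omega
    obtain ⟨a, a', ha, ha', haa⟩ := Finset.one_lt_card_iff.1 h1
    simp only [Finset.mem_sdiff] at ha ha'
    rw [List.nodup_cons] at hS
    obtain ⟨L, l1, l2, l3, l4, l6, l5⟩ := ih hS.2 (fun x hx => hSA x (by simp [hx]))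
      (insert a (insert a' U)) (fun x hx => by
        have := hd x (by simp [hx])
        rw [List.length_cons] at this
        have h1 := Finset.card_insert_le a (insert a' U)
        have h2 := Finset.card_insert_le a' U
        omega)
    have hbA := hSA b (by simp)
    have key : ∀ v, v ∈ tripleVerts ((a, b, a') :: L) ↔ v = a ∨ v = b ∨ v = a' ∨ v ∈ tripleVerts L := by
      intro v; simp [tripleVerts]
    have haL : a ∉ tripleVerts L := by
      intro hh
      rcases (l4 a).1 hh with hh | hh
      · exact hSA a (by simp [hh]) ha.1.1
      · exact hh.2.2 (by simp)
    have haL' : a' ∉ tripleVerts L := by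
      intro hh
      rcases (l4 a').1 hh with hh | hh
      · exact hSA a' (by simp [hh]) ha'.1.1
      · exact hh.2.2 (by simp)
    refine ⟨(a, b, a') :: L, by simp [l1], ?_, ?_, ?_, fun x hx => ?_, ?_⟩
    · intro x hx
      rcases List.mem_cons.1 hx with rfl | hx
      · refine ⟨face_insert ha.1.2, ?_⟩
        have := face_insert ha'.1.2
        rwa [Finset.pair_comm] at this
      · exact l2 x hx
    · have hbL : b ∉ tripleVerts L := by
        intro hh
        rcases (l4 b).1 hh with hh | hh
        · exact hS.1 hh
        · exact hbA hh.2.1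
      have hab : a ≠ b := fun hh => hbA (hh ▸ ha.1.1)
      have hba : b ≠ a' := fun hh => hbA (hh ▸ ha'.1.1)
      have : tripleVerts ((a, b, a') :: L) = a :: b :: a' :: tripleVerts L := by simp [tripleVerts]
      rw [this]
      simp [haL, haL', hbL, hab, hba, haa, l3]
    · intro v
      rw [key, List.mem_cons]
      constructor
      · rintro (rfl | rfl | rfl | hv)
        · exact Or.inr ⟨Or.inl rfl, ha.1.1, ha.2⟩
        · exact Or.inl (Or.inl rfl)
        · exact Or.inr ⟨Or.inr (Or.inr (Or.inl rfl)), ha'.1.1, ha'.2⟩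
        · rcases (l4 v).1 hv with hh | hh
          · exact Or.inl (Or.inr hh)
          · exact Or.inr ⟨Or.inr (Or.inr (Or.inr hv)), hh.2.1, fun hU => hh.2.2 (by simp [hU])⟩
      · rintro ((rfl | hv) | hv)
        · exact Or.inr (Or.inl rfl)
        · exact Or.inr (Or.inr (Or.inr ((l4 v).2 (Or.inl hv))))
        · exact hv.1
    · rcases List.mem_cons.1 hx with rfl | hx
      · exact ⟨ha.1.1, ha'.1.1⟩
      · exact l6 x hx
    · have : (tripleVerts ((a, b, a') :: L)).toFinset ∩ A =
          insert a (insert a' ((tripleVerts L).toFinset ∩ A)) := by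
        ext v
        simp only [Finset.mem_inter, List.mem_toFinset, key, Finset.mem_insert]
        constructor
        · rintro ⟨rfl | rfl | rfl | hv, hA⟩
          · exact Or.inl rfl
          · exact (hbA hA).elim
          · exact Or.inr (Or.inl rfl)
          · exact Or.inr (Or.inr ⟨hv, hA⟩)
        · rintro (rfl | rfl | ⟨hv, hA⟩)
          · exact ⟨Or.inl rfl, ha.1.1⟩
          · exact ⟨Or.inr (Or.inr (Or.inl rfl)), ha'.1.1⟩
          · exact ⟨Or.inr (Or.inr (Or.inr hv)), hA⟩
      rw [this, Finset.card_insert_of_notMem, Finset.card_insert_of_notMem, l5, List.length_cons]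
      · ring
      · simp [haL']
      · simp [haL, haa]

end spoiled

section skeleton
variable {n k d t s₀ π : ℕ} {E : Finset (Finset (Fin n))}

open Classical in
/-- A partial placement using all of `A'` and all special positions. -/
structure Skeleton (n k d t s₀ π g K : ℕ) (E : Finset (Finset (Fin n))) (A' : Finset (Fin n))
    (D : Finset ℕ) (f : ℕ → Fin n) : Prop where
  valid : Valid k d E D f
  spec_mem : ∀ m < π, spec s₀ t m ∈ D
  spec_val : ∀ m < π, f (spec s₀ t m) ∈ A'
  sub_image : A' ⊆ D.image f
  open_disj : Disjoint (openPos s₀ t g) D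
  start_le : ∀ p ∈ D, s₀ + t ≤ p + 1
  card_le : (D.image f \ A').card ≤ K
  fits : ∀ b, b ∉ A' → b ∉ D.image f → 2 * ((openPos s₀ t g).filter
      fun y => ¬ Fits n k d E D f y b).card ≤ g
  not_fits : ∀ y ∈ openPos s₀ t g, 2 * ((A'ᶜ).filter fun b => ¬ Fits n k d E D f y b).card ≤ g
  lt_of_mem : ∀ p ∈ D, p < n
  win_sub : ∀ y ∈ openPos s₀ t g, ∀ s ∈ starts n k d y, ∀ p ∈ win n k s, p ∈ D ∨ p = y

theorem fits_congr {D D' : Finset ℕ} {f f' : ℕ → Fin n} {y : ℕ} {b : Fin n}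
    (hD : ∀ s ∈ starts n k d y, ∀ p ∈ win n k s, p ∈ D ↔ p ∈ D') (hf : ∀ p ∈ D, f' p = f p) :
    Fits n k d E D' f' y b ↔ Fits n k d E D f y b := by
  refine forall₂_congr fun s hs => ?_
  have h1 : win n k s ∩ D' = win n k s ∩ D := by
    ext p; rw [Finset.mem_inter, Finset.mem_inter]
    exact and_congr_right fun hp => (hD s hs p hp).symm
  rw [h1, Finset.image_congr (g := f) fun p hp => hf p (Finset.mem_inter.1 hp).2]

theorem Layout.exists_skeleton (h : Layout n k d t s₀ π) (hE : ∀ v, Face E {v}) (hE0 : Face E ∅)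
    {A A' : Finset (Fin n)} {μ g c : ℕ} (hA : A ⊆ A') (hst : Strong k E A A'ᶜ μ)
    (hA' : A'.card = π + c) (hdeg : ∀ b ∈ A'ᶜ, 2 * g + 20 + 3 * c + 4 * (k * μ) ≤ (A \ miss E {b}).card)
    (C : List (Fin n × Fin n × Fin n)) (hC : C.length = c)
    (hCf : ∀ x ∈ C, Face E {x.1, x.2.1} ∧ Face E {x.2.1, x.2.2}) (hCn : (tripleVerts C).Nodup)
    (hCA : ∀ v ∈ tripleVerts C, v ∈ A') (hCA' : ∀ x ∈ C, x.1 ∈ A' ∧ x.2.2 ∈ A')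
    (hμg : 2 * (k * μ) ≤ g) (hAc : 2 * g + 20 + 3 * c ≤ A.card)
    (hπ : 2 * g + 40 + 2 * (2 * (k * μ) + c) ≤ π)
    (hB : 2 * g + 20 + g * (k * k) + 2 * (k * μ) ≤ (A'ᶜ).card) :
    ∃ D f, Skeleton n k d t s₀ π g (2 * g + 20 + g * (k * k) + 2 * (k * μ)) E A' D f := by
  classical
  have hkn := h.hkn
  have e3 := h.ht
  obtain ⟨V, hV⟩ : ∃ V, V = (tripleVerts C).toFinset := ⟨_, rfl⟩
  have hVc : V.card = 3 * c := by rw [hV, List.toFinset_card_of_nodup hCn, card_tripleVerts, hC]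
  have hVA : V ⊆ A' := fun v hv => hCA v (by rwa [hV, List.mem_toFinset] at hv)
  obtain ⟨D₁, f₁, G⟩ := h.exists_gadgets (g := g) (μ := μ) (A := A \ V) (B := A'ᶜ) hE hE0
    (Finset.disjoint_left.2 fun v hv hv' => Finset.mem_compl.1 hv' (hA (Finset.mem_sdiff.1 hv).1))
    (fun a ha => hst a (Finset.mem_sdiff.1 ha).1) (by omega)
    (by have := Finset.le_card_sdiff V A; omega) (by omega)
  have hst' : Strong k E (A \ V) A'ᶜ μ := fun a ha => hst a (Finset.mem_sdiff.1 ha).1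
  have hImA : ∀ v ∈ D₁.image f₁, v ∈ A' → ∃ p ∈ zone s₀ t g, f₁ p = v := by
    intro v hv hvA
    obtain ⟨p, hp, rfl⟩ := Finset.mem_image.1 hv
    by_cases hz : p ∈ zone s₀ t g
    · exact ⟨p, hz, rfl⟩
    · exact (Finset.mem_compl.1 (G.rest_mem p hp hz) hvA).elim
  have hZ : D₁.image f₁ ∩ A' = (zone s₀ t g).image f₁ := by
    ext v
    rw [Finset.mem_inter, Finset.mem_image (s := zone s₀ t g)]
    constructor
    · exact fun hv => hImA v hv.1 hv.2
    · rintro ⟨p, hp, rfl⟩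
      exact ⟨Finset.mem_image_of_mem _ (G.zone_sub hp), hA (Finset.mem_sdiff.1 (G.zone_mem p hp)).1⟩
  have hZc : (D₁.image f₁ ∩ A').card = 2 * g + 20 := by
    rw [hZ, Finset.card_image_of_injOn (G.valid.injOn.mono (by exact_mod_cast G.zone_sub)),
      h.card_zone]
  obtain ⟨X, hX⟩ : ∃ X, X = A'ᶜ.filter fun b => g < 2 * ((openPos s₀ t g).filter
      fun y => ¬ Fits n k d E D₁ f₁ y b).card := ⟨_, rfl⟩
  have hXc : X.card ≤ 2 * (k * μ) := hX ▸ G.card_spoiled h hst' (by omega)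
  have hIB : ((D₁.image f₁)).card ≤ 2 * g + 20 + g * (k * k) := Finset.card_image_le.trans G.card_le
  obtain ⟨S, hXS, hSB, hSc⟩ := Finset.exists_subsuperset_card_eq (s := X \ D₁.image f₁)
    (t := A'ᶜ \ D₁.image f₁) (n := 2 * (k * μ))
    (Finset.sdiff_subset_sdiff (hX ▸ Finset.filter_subset _ _) le_rfl)
    ((Finset.card_le_card Finset.sdiff_subset).trans hXc)
    (by have := Finset.le_card_sdiff (D₁.image f₁) A'ᶜ; omega)
  have hSl : S.toList.length = 2 * (k * μ) := by rw [Finset.length_toList, hSc]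
  have hSA : ∀ b ∈ S, b ∉ A' ∧ b ∉ D₁.image f₁ := fun b hb => by
    have := hSB hb
    rwa [Finset.mem_sdiff, Finset.mem_compl] at this
  obtain ⟨L, l1, l2, l3, l4, l5, l6⟩ := exists_triples (E := E) (A := A) S.toList S.nodup_toList
    (fun b hb hbA => (hSA b (Finset.mem_toList.1 hb)).1 (hA hbA)) ((D₁.image f₁ ∩ A') ∪ V)
    (fun b hb => by
      have h1 := hdeg b (Finset.mem_compl.2 (hSA b (Finset.mem_toList.1 hb)).1)
      have h2 := Finset.card_union_le (D₁.image f₁ ∩ A') V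
      omega)
  simp only [Finset.mem_toList, Finset.mem_union, Finset.mem_inter, not_or] at l4
  have htv : ∀ v, v ∈ tripleVerts (L ++ C) ↔ v ∈ tripleVerts L ∨ v ∈ tripleVerts C := by
    intro v; simp only [tripleVerts, List.flatMap_append, List.mem_append]
  have hVm : ∀ v, v ∈ V ↔ v ∈ tripleVerts C := by intro v; rw [hV, List.mem_toFinset]
  have hlen : (L ++ C).length = 2 * (k * μ) + c := by rw [List.length_append, l1, hSl, hC]
  obtain ⟨f₂, v₂, a₂, i₂, s₂⟩ := G.valid.triples h hE (L ++ C) (by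
      intro x hx
      rcases List.mem_append.1 hx with hx | hx
      · exact l2 x hx
      · exact hCf x hx) (by
      have : tripleVerts (L ++ C) = tripleVerts L ++ tripleVerts C := by simp [tripleVerts]
      rw [this, List.nodup_append]
      refine ⟨l3, hCn, fun a ha b hb hab => ?_⟩
      subst hab
      rcases (l4 a).1 ha with hS | hS
      · exact (hSA a hS).1 (hCA a hb)
      · exact hS.2.2.2 ((hVm a).2 hb)) (j := 2 * g + 30) (by omega)
    (fun m h1 h2 => G.far m (by omega) (by omega)) (by
      intro v hv hvD
      rcases (htv v).1 hv with hv | hv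
      · rcases (l4 v).1 hv with hS | hS
        · exact (hSA v hS).2 hvD
        · exact hS.2.2.1 ⟨hvD, hA hS.2.1⟩
      · obtain ⟨p, hp, rfl⟩ := hImA v hvD (hCA v hv)
        exact (Finset.mem_sdiff.1 (G.zone_mem p hp)).2 ((hVm _).2 hv))
  rw [hlen] at v₂ i₂ s₂
  obtain ⟨M, hM⟩ : ∃ M, M = 2 * (k * μ) + c := ⟨_, rfl⟩
  rw [← hM] at v₂ i₂ s₂
  obtain ⟨T, hT⟩ : ∃ T, T = triplePos s₀ t (2 * g + 30) M := ⟨_, rfl⟩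
  rw [← hT] at v₂ i₂
  have hTs : ∀ m, 2 * g + 30 ≤ m → m < 2 * g + 30 + 2 * M → spec s₀ t m ∈ T := by
    intro m h1 h2
    rw [hT, mem_triplePos]
    refine ⟨(m - (2 * g + 30)) / 2, by omega, ?_⟩
    rcases Nat.even_or_odd' (m - (2 * g + 30)) with ⟨q, hq | hq⟩
    · exact Or.inl (congrArg _ (by omega))
    · exact Or.inr (Or.inr (congrArg _ (by omega)))
  have hTw : ∀ p ∈ T, ∀ s < n, p ∈ win n k s → ∃ m, 2 * g + 30 ≤ m ∧ m < 2 * g + 30 + 2 * M ∧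
      spec s₀ t m ∈ win n k s := by
    intro p hp s hs hw
    rw [hT, mem_triplePos] at hp
    obtain ⟨i, hi, rfl | rfl | rfl⟩ := hp
    · exact ⟨_, by omega, by omega, hw⟩
    · rcases h.spec_of_succ hs (by omega) hw with hw | hw
      · exact ⟨_, by omega, by omega, hw⟩
      · exact ⟨_, by omega, by omega, hw⟩
    · exact ⟨_, by omega, by omega, hw⟩
  obtain ⟨I, hI⟩ : ∃ I, I = Finset.range 10 ∪ Finset.Ico (2 * g + 30 + 2 * M) π := ⟨_, rfl⟩
  have memI : ∀ m, m ∈ I ↔ m < 10 ∨ 2 * g + 30 + 2 * M ≤ m ∧ m < π := by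
    intro m; rw [hI, Finset.mem_union, Finset.mem_range, Finset.mem_Ico]
  have hIc : I.card = 10 + (π - (2 * g + 30 + 2 * M)) := by
    rw [hI, Finset.card_union_of_disjoint, Finset.card_range, Nat.card_Ico]
    rw [Finset.disjoint_left]; intro m; rw [Finset.mem_range, Finset.mem_Ico]; omega
  have memR : ∀ p, p ∈ I.image (spec s₀ t) ↔ ∃ m, (m < 10 ∨ 2 * g + 30 + 2 * M ≤ m ∧ m < π) ∧
      p = spec s₀ t m := by
    intro p; rw [Finset.mem_image]
    exact ⟨fun ⟨m, h1, h2⟩ => ⟨m, (memI m).1 h1, h2.symm⟩,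
      fun ⟨m, h1, h2⟩ => ⟨m, (memI m).2 h1, h2.symm⟩⟩
  have hsep : ∀ x ∈ I.image (spec s₀ t), ∀ s ∈ starts n k d x, ∀ p ∈ win n k s,
      p ∈ (D₁ ∪ T) ∪ I.image (spec s₀ t) → p = x := by
    intro x hx s hs p hp hpD
    obtain ⟨m, hm, rfl⟩ := (memR x).1 hx
    have hs' := mem_starts.1 hs
    rw [Finset.mem_union, Finset.mem_union] at hpD
    rcases hpD with (hpD | hpD) | hpD
    · have := G.far m (by omega) (by omega) s hs
      exact absurd (Finset.mem_inter.2 ⟨hp, hpD⟩) (by rw [this]; simp)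
    · obtain ⟨m', h1, h2, h3⟩ := hTw p hpD s hs'.1 hp
      have := h.sep_spec (by omega) hs (by omega) h3
      omega
    · obtain ⟨m', hm', rfl⟩ := (memR p).1 hpD
      rw [h.sep_spec (by omega) hs (by omega) hp]
  have hRD : Disjoint (I.image (spec s₀ t)) (D₁ ∪ T) := by
    rw [Finset.disjoint_left]
    intro x hx hxD
    obtain ⟨m, hm, rfl⟩ := (memR x).1 hx
    obtain ⟨s, hs⟩ := exists_starts h.hd (h.d_le.trans h.htk) (h.spec_lt (show m < π by omega))
    have hs' := mem_starts.1 hs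
    rcases Finset.mem_union.1 hxD with hpD | hpD
    · have := G.far m (by omega) (by omega) s hs
      exact absurd (Finset.mem_inter.2 ⟨hs'.2.2, hpD⟩) (by rw [this]; simp)
    · obtain ⟨m', h1, h2, h3⟩ := hTw _ hpD s hs'.1 hs'.2.2
      have := h.sep_spec (by omega) hs (by omega) h3
      omega
  have hRc : (I.image (spec s₀ t)).card = I.card :=
    Finset.card_image_of_injective _ fun i j hij => h.spec_inj hij
  have him : (D₁ ∪ T).image f₂ = D₁.image f₁ ∪ (tripleVerts (L ++ C)).toFinset := by
    rw [Finset.image_union, i₂, Finset.image_congr (s := D₁) (g := f₁) fun p hp => a₂ p hp]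
  have hcount : (A' \ (D₁ ∪ T).image f₂).card = I.card := by
    have h1 : A' ∩ (D₁ ∪ T).image f₂ =
        (D₁.image f₁ ∩ A') ∪ (((tripleVerts L).toFinset ∩ A) ∪ V) := by
      ext v
      rw [him]
      simp only [Finset.mem_inter, Finset.mem_union, List.mem_toFinset, htv, hVm]
      constructor
      · rintro ⟨hvA, hv | hv | hv⟩
        · exact Or.inl ⟨hv, hvA⟩
        · rcases (l4 v).1 hv with hS | hS
          · exact ((hSA v hS).1 hvA).elim
          · exact Or.inr (Or.inl ⟨hv, hS.2.1⟩)
        · exact Or.inr (Or.inr hv)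
      · rintro (⟨h1, h2⟩ | ⟨h1, h2⟩ | h1)
        · exact ⟨h2, Or.inl h1⟩
        · exact ⟨hA h2, Or.inr (Or.inl h1)⟩
        · exact ⟨hCA v h1, Or.inr (Or.inr h1)⟩
    have h2 : (A' ∩ (D₁ ∪ T).image f₂).card = 2 * g + 20 + (2 * (2 * (k * μ)) + 3 * c) := by
      rw [h1, Finset.card_union_of_disjoint, Finset.card_union_of_disjoint, hZc, l6, hSl, hVc]
      · rw [Finset.disjoint_left]
        intro v hv hvV
        rw [Finset.mem_inter, List.mem_toFinset] at hv
        rcases (l4 v).1 hv.1 with hS | hS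
        · exact (hSA v hS).1 (hA hv.2)
        · exact hS.2.2.2 hvV
      · rw [Finset.disjoint_left]
        intro v hv hvV
        rcases Finset.mem_union.1 hvV with hvV | hvV
        · rw [Finset.mem_inter, List.mem_toFinset] at hvV
          rcases (l4 v).1 hvV.1 with hS | hS
          · exact (hSA v hS).1 (hA hvV.2)
          · exact hS.2.2.1 (Finset.mem_inter.1 hv)
        · rw [Finset.mem_inter] at hv
          obtain ⟨p, hp, rfl⟩ := hImA v hv.1 hv.2
          exact (Finset.mem_sdiff.1 (G.zone_mem p hp)).2 hvV
    have h3 := Finset.card_sdiff_add_card_inter A' ((D₁ ∪ T).image f₂)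
    omega
  obtain ⟨f₃, v₃, a₃, t₃⟩ := v₂.place hE A' _ hRD hsep (by rw [hcount, hRc])
  obtain ⟨R, hR⟩ : ∃ R, R = I.image (spec s₀ t) := ⟨_, rfl⟩
  rw [← hR] at v₃ t₃ hRD memR hRc hsep
  have hDR : (D₁ ∪ T).image f₃ = (D₁ ∪ T).image f₂ := Finset.image_congr fun p hp => a₃ p hp
  have hsubR : A' \ (D₁ ∪ T).image f₂ = R.image f₃ := by
    symm
    apply Finset.eq_of_subset_of_card_le
    · intro v hv
      obtain ⟨p, hp, rfl⟩ := Finset.mem_image.1 hv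
      refine Finset.mem_sdiff.2 ⟨t₃ p hp, fun hv => ?_⟩
      rw [← hDR] at hv
      obtain ⟨q, hq, hpq⟩ := Finset.mem_image.1 hv
      have := v₃.injOn (Finset.mem_coe.2 (Finset.mem_union_left _ hq))
        (Finset.mem_coe.2 (Finset.mem_union_right _ hp)) hpq
      exact Finset.disjoint_left.1 hRD hp (this ▸ hq)
    · rw [hcount, ← hRc, Finset.card_image_of_injOn]
      exact v₃.injOn.mono (by rw [Finset.coe_union]; exact Set.subset_union_right)
  have himg : (D₁ ∪ T ∪ R).image f₃ =
      (D₁.image f₁ ∪ (tripleVerts (L ++ C)).toFinset) ∪ (A' \ (D₁ ∪ T).image f₂) := by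
    rw [hsubR, Finset.image_union, hDR, him]
  have hopT : ∀ y ∈ openPos s₀ t g, y ∉ T ∪ R := by
    intro y hy hyT
    rcases Finset.mem_union.1 hyT with hyT | hyT
    · rw [hT, mem_triplePos] at hyT
      obtain ⟨i, hi, e | e | e⟩ := hyT
      · exact h.open_notMem_zone hy _ e
      · obtain ⟨i', hi', e'⟩ := mem_openPos.1 hy
        have := h.spec_inj (show spec s₀ t (2 * g + 30 + 2 * i) = spec s₀ t (20 + 2 * i') by omega)
        omega
      · exact h.open_notMem_zone hy _ e
    · obtain ⟨m, -, e⟩ := (memR y).1 hyT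
      exact h.open_notMem_zone hy m e
  have hopen : Disjoint (openPos s₀ t g) (D₁ ∪ T ∪ R) := by
    rw [Finset.disjoint_left]
    intro y hy hyD
    rw [Finset.union_assoc, Finset.mem_union] at hyD
    exact hyD.elim (Finset.disjoint_left.1 G.open_disj hy) (hopT y hy)
  have hfits : ∀ y ∈ openPos s₀ t g, ∀ b,
      Fits n k d E (D₁ ∪ T ∪ R) f₃ y b ↔ Fits n k d E D₁ f₁ y b := by
    intro y hy b
    refine fits_congr (fun s hs p hp => ⟨fun hpD => Finset.mem_union_left _
      (Finset.mem_union_left _ hpD), fun hpD => ?_⟩) fun p hp => ?_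
    · rcases G.win_sub y hy s hs p hp with hp | rfl
      · exact hp
      · exact (Finset.disjoint_left.1 hopen hy hpD).elim
    · rw [a₃ p (Finset.mem_union_left _ hp), a₂ p hp]
  have hspec : ∀ m < π, m ∈ Finset.Ico 10 (2 * g + 30) ∨
      (2 * g + 30 ≤ m ∧ m < 2 * g + 30 + 2 * M) ∨ spec s₀ t m ∈ R := by
    intro m hm
    rw [Finset.mem_Ico]
    by_cases h1 : 10 ≤ m ∧ m < 2 * g + 30
    · exact Or.inl h1
    by_cases h2 : 2 * g + 30 ≤ m ∧ m < 2 * g + 30 + 2 * M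
    · exact Or.inr (Or.inl h2)
    exact Or.inr (Or.inr ((memR _).2 ⟨m, by omega, rfl⟩))
  have hzone : ∀ m ∈ Finset.Ico 10 (2 * g + 30), spec s₀ t m ∈ zone s₀ t g := fun m hm =>
    Finset.mem_image_of_mem _ hm
  have hlow : ∀ m, s₀ + t ≤ spec s₀ t m + 1 := by
    intro m; simp only [spec]; omega
  refine ⟨D₁ ∪ T ∪ R, f₃, v₃, fun m hm => ?_, fun m hm => ?_, ?_, hopen, ?_, ?_, ?_, ?_, ?_, ?_⟩
  · rw [Finset.mem_union, Finset.mem_union]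
    rcases hspec m hm with hm | hm | hm
    · exact Or.inl (Or.inl (G.zone_sub (hzone m hm)))
    · exact Or.inl (Or.inr (hTs m hm.1 hm.2))
    · exact Or.inr hm
  · rcases hspec m hm with hm | hm | hm
    · have h1 := hzone m hm
      have h2 := G.zone_sub h1
      rw [a₃ _ (Finset.mem_union_left _ h2), a₂ _ h2]
      exact hA (Finset.mem_sdiff.1 (G.zone_mem _ h1)).1
    · rw [a₃ _ (Finset.mem_union_right _ (hTs m hm.1 hm.2))]
      refine s₂ A' (fun x hx => ?_) m hm.1 hm.2
      rcases List.mem_append.1 hx with hx | hx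
      · exact ⟨hA (l5 x hx).1, hA (l5 x hx).2⟩
      · exact hCA' x hx
    · exact t₃ _ hm
  · intro v hv
    rw [himg, ← him, Finset.mem_union, Finset.mem_sdiff]
    tauto
  · intro p hp
    rw [Finset.mem_union, Finset.mem_union] at hp
    rcases hp with (hp | hp) | hp
    · have := G.start_le p hp
      omega
    · rw [hT, mem_triplePos] at hp
      obtain ⟨i, hi, rfl | rfl | rfl⟩ := hp
      · exact hlow _
      · exact (hlow (2 * g + 30 + 2 * i)).trans (by omega)
      · exact hlow _
    · obtain ⟨m, -, rfl⟩ := (memR p).1 hp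
      exact hlow _
  · have h1 : (D₁ ∪ T ∪ R).image f₃ \ A' ⊆ D₁.image f₁ ∪ S := by
      intro v hv
      rw [himg, Finset.mem_sdiff] at hv
      simp only [Finset.mem_union, List.mem_toFinset, htv, Finset.mem_sdiff] at hv ⊢
      obtain ⟨(hv | hv | hv) | hv, hvA⟩ := hv
      · exact Or.inl hv
      · rcases (l4 v).1 hv with hS | hS
        · exact Or.inr hS
        · exact (hvA (hA hS.2.1)).elim
      · exact (hvA (hCA v hv)).elim
      · exact (hvA hv.1).elim
    have h2 := (Finset.card_le_card h1).trans (Finset.card_union_le _ _)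
    omega
  · intro b hbA hb
    rw [himg, Finset.mem_union, Finset.mem_union, not_or, not_or, List.mem_toFinset] at hb
    have hbX : b ∉ X := by
      intro hbX
      have hbS : b ∈ S := hXS (Finset.mem_sdiff.2 ⟨hbX, hb.1.1⟩)
      exact hb.1.2 ((htv b).2 (Or.inl ((l4 b).2 (Or.inl hbS))))
    rw [hX, Finset.mem_filter, not_and, not_lt] at hbX
    refine le_trans (le_of_eq ?_) (hbX (Finset.mem_compl.2 hbA))
    congr 2
    exact Finset.filter_congr fun y hy => not_congr (hfits y hy b)
  · intro y hy
    have h1 := G.card_not_fits h hst' (by omega) hy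
    have h2 : (A'ᶜ.filter fun b => ¬ Fits n k d E (D₁ ∪ T ∪ R) f₃ y b) =
        A'ᶜ.filter fun b => ¬ Fits n k d E D₁ f₁ y b :=
      Finset.filter_congr fun b _ => not_congr (hfits y hy b)
    rw [h2]
    omega
  · intro p hp
    rw [Finset.mem_union, Finset.mem_union] at hp
    rcases hp with (hp | hp) | hp
    · exact G.lt_of_mem p hp
    · rw [hT, mem_triplePos] at hp
      obtain ⟨i, hi, rfl | rfl | rfl⟩ := hp
      · exact h.spec_lt (by omega)
      · have := h.spec_lt (show 2 * g + 30 + 2 * i + 1 < π by omega)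
        have := spec_mono (s₀ := s₀) (t := t) 1 (show 2 * g + 30 + 2 * i + 1 ≤ 2 * g + 30 + 2 * i + 1 by omega)
        omega
      · exact h.spec_lt (by omega)
    · obtain ⟨m, hm, rfl⟩ := (memR p).1 hp
      exact h.spec_lt (by omega)
  · intro y hy s hs p hp
    rcases G.win_sub y hy s hs p hp with hp | hp
    · exact Or.inl (Finset.mem_union_left _ (Finset.mem_union_left _ hp))
    · exact Or.inr hp

end skeleton

section completion
variable {n k d t s₀ π : ℕ} {E : Finset (Finset (Fin n))}

theorem card_compl_sdiff_image {A' : Finset (Fin n)} {D D' : Finset ℕ} {f f' : ℕ → Fin n}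
    {K m : ℕ} (hK : (D.image f \ A').card ≤ K) (hD : D'.card ≤ m) (hf : ∀ p ∈ D, f' p = f p) :
    (A'ᶜ).card ≤ (A'ᶜ \ (D ∪ D').image f').card + K + m := by
  have h1 : A'ᶜ ⊆ (A'ᶜ \ (D ∪ D').image f') ∪ ((D.image f \ A') ∪ D'.image f') := by
    intro v hv
    by_cases hv' : v ∈ (D ∪ D').image f'
    · refine Finset.mem_union_right _ ?_
      rw [Finset.image_union, Finset.image_congr (s := D) (g := f) fun p hp => hf p hp] at hv'
      rcases Finset.mem_union.1 hv' with h | h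
      · exact Finset.mem_union_left _ (Finset.mem_sdiff.2 ⟨h, Finset.mem_compl.1 hv⟩)
      · exact Finset.mem_union_right _ h
    · exact Finset.mem_union_left _ (Finset.mem_sdiff.2 ⟨hv, hv'⟩)
  have h2 := Finset.card_le_card h1
  have h3 := Finset.card_union_le (A'ᶜ \ (D ∪ D').image f') ((D.image f \ A') ∪ D'.image f')
  have h4 := Finset.card_union_le (D.image f \ A') (D'.image f')
  have h5 : (D'.image f').card ≤ D'.card := Finset.card_image_le
  omega

theorem Skeleton.hamCycle {l g K : ℕ} {A A' : Finset (Fin n)} {D : Finset ℕ} {f : ℕ → Fin n}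
    (h : Layout n k (k - l) t s₀ π) (hE : ∀ e ∈ E, e.card = k) (hE0 : Face E ∅)
    (hdn : (k - l) ∣ n)
    (G : Skeleton n k (k - l) t s₀ π g K E A' D f) {μ ν ω τ : ℕ}
    (hst : Strong k E A A'ᶜ μ) (hwk : Strong k E A' A'ᶜ ν) (hω : (A' \ A).card ≤ ω)
    (hτ : ∀ σ, Face E σ → σ.card < k → (miss E σ).card ≤ τ)
    (hg : 0 < g) (hμ : k * μ ≤ g) (hgπ : 2 * g + 40 ≤ π)
    (h1 : s₀ + t + τ + k * ν + K ≤ (A'ᶜ).card)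
    (h2 : s₀ + t + ω * (k * k) + k * ν + K ≤ (A'ᶜ).card) : HamCycle k l E := by
  classical
  have hkn := h.hkn
  have e3 := h.ht
  have e4 := h.htk
  obtain ⟨f₄, v₄, a₄, -⟩ := G.valid.stretch (A := A') (B := A'ᶜ) (μ := ν) (τ := τ)
    (m := s₀ + t - 1) (by omega) hkn hwk
    (by have h1 := h.hn; have h2 := Nat.le_mul_of_pos_left t h.hπ; omega) hE0 hτ
    (fun x hx hxD => by have := G.start_le x hxD; omega) (fun x hx s hs => by
      by_cases hs' : s₀ + t ≤ s + k
      · obtain ⟨j, hj, hjw⟩ := h.exists_spec (mem_starts.1 hs).1 hs'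
        exact Or.inr ⟨_, G.spec_mem j hj, hjw, G.spec_val j hj⟩
      · left; omega) (by
      have := card_compl_sdiff_image (D' := ∅) (m := 0) (f' := f) G.card_le (by simp)
        (fun _ _ => rfl)
      rw [Finset.union_empty] at this
      omega)
  obtain ⟨D₄, hD₄⟩ : ∃ D₄, D₄ = D ∪ Finset.range (s₀ + t - 1) := ⟨_, rfl⟩
  have hc₄ := card_compl_sdiff_image (D' := Finset.range (s₀ + t - 1)) (f' := f₄) G.card_le le_rfl a₄
  rw [Finset.card_range] at hc₄
  rw [← hD₄] at v₄ hc₄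
  have hD4 : D ⊆ D₄ := hD₄ ▸ Finset.subset_union_left
  have hspec : ∀ x ∉ D₄, ∀ s ∈ starts n k (k - l) x,
      ∃ p ∈ D₄, p ∈ win n k s ∧ f₄ p ∈ A' := by
    intro x hx s hs
    have hs' := mem_starts.1 hs
    have hx' : ¬ x < s₀ + t - 1 := fun hx' => hx (hD₄ ▸ Finset.mem_union_right _
      (Finset.mem_range.2 hx'))
    have hw := mem_win.1 hs'.2.2
    obtain ⟨j, hj, hjw⟩ := h.exists_spec hs'.1 (by omega)
    exact ⟨_, hD4 (G.spec_mem j hj), hjw, a₄ _ (G.spec_mem j hj) ▸ G.spec_val j hj⟩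
  obtain ⟨Q, hQ⟩ : ∃ Q, Q = D₄.filter fun p => f₄ p ∈ A' \ A := ⟨_, rfl⟩
  have hQc : Q.card ≤ ω := by
    refine (Finset.card_le_card_of_injOn f₄ (fun p hp => ?_) (v₄.injOn.mono ?_)).trans hω
    · rw [hQ] at hp; exact (Finset.mem_filter.1 hp).2
    · rw [hQ]; exact_mod_cast Finset.filter_subset _ _
  obtain ⟨W, hW⟩ : ∃ W, W = (Q.biUnion fun q => (starts n k (k - l) q).biUnion
    fun s => win n k s) \ (D₄ ∪ openPos s₀ t g) := ⟨_, rfl⟩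
  have memW : ∀ p, p ∈ W ↔ (∃ q ∈ Q, ∃ s ∈ starts n k (k - l) q, p ∈ win n k s) ∧
      p ∉ D₄ ∧ p ∉ openPos s₀ t g := by
    intro p; rw [hW, Finset.mem_sdiff, Finset.mem_biUnion, Finset.mem_union, not_or]
    simp only [Finset.mem_biUnion]
  have hWc : W.card ≤ ω * (k * k) := by
    have h1 : ∀ y ∈ Q, ((starts n k (k - l) y).biUnion fun s => win n k s).card ≤ k * k :=
      fun y _ => (Finset.card_biUnion_le_card_mul _ _ k fun s hs =>
        (card_win hkn (mem_starts.1 hs).1).le).trans (Nat.mul_le_mul_right _ (card_starts_le y hkn))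
    have h2 := Finset.card_biUnion_le_card_mul _ _ _ h1
    rw [hW]
    exact (Finset.card_le_card Finset.sdiff_subset).trans (h2.trans (Nat.mul_le_mul_right _ hQc))
  obtain ⟨f₅, v₅, a₅, -⟩ := v₄.fill hkn hwk W
    (Finset.disjoint_left.2 fun p hp => ((memW p).1 hp).2.1)
    (fun x hx s hs => hspec x ((memW x).1 hx).2.1 s hs) (by omega)
  obtain ⟨Z, hZ⟩ : ∃ Z, Z = Finset.range n \ (D₄ ∪ W ∪ openPos s₀ t g) := ⟨_, rfl⟩
  have memZ : ∀ p, p ∈ Z ↔ p < n ∧ p ∉ D₄ ∧ p ∉ W ∧ p ∉ openPos s₀ t g := by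
    intro p; rw [hZ, Finset.mem_sdiff, Finset.mem_range, Finset.mem_union, Finset.mem_union]; tauto
  have hopn : ∀ y ∈ openPos s₀ t g, y < n := by
    intro y hy
    obtain ⟨i, hi, rfl⟩ := mem_openPos.1 hy
    have := h.spec_lt (show 20 + 2 * i + 1 < π by omega)
    have := spec_mono (s₀ := s₀) (t := t) 1 (le_refl (20 + 2 * i + 1))
    omega
  have hop4 : Disjoint (openPos s₀ t g) D₄ := by
    rw [hD₄, Finset.disjoint_union_right]
    refine ⟨G.open_disj, Finset.disjoint_left.2 fun y hy hy' => ?_⟩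
    obtain ⟨i, hi, rfl⟩ := mem_openPos.1 hy
    rw [Finset.mem_range] at hy'
    simp only [spec] at hy'
    omega
  have hopW : Disjoint (openPos s₀ t g) W :=
    Finset.disjoint_left.2 fun y hy hyW => ((memW y).1 hyW).2.2 hy
  have hop5 : Disjoint (openPos s₀ t g) (D₄ ∪ W) := Finset.disjoint_union_right.2 ⟨hop4, hopW⟩
  have hD4n : ∀ p ∈ D₄, p < n := by
    intro p hp
    rw [hD₄, Finset.mem_union, Finset.mem_range] at hp
    rcases hp with hp | hp
    · exact G.lt_of_mem p hp
    · have h1 := h.hn; have h2 := Nat.le_mul_of_pos_left t h.hπ; omega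
  have hWn : ∀ p ∈ W, p < n := by
    intro p hp
    obtain ⟨⟨q, -, s, -, hw⟩, -⟩ := (memW p).1 hp
    exact (mem_win.1 hw).1
  have hsub : D₄ ∪ W ∪ openPos s₀ t g ⊆ Finset.range n := by
    intro p hp
    rw [Finset.mem_union, Finset.mem_union] at hp
    rw [Finset.mem_range]
    rcases hp with (hp | hp) | hp
    · exact hD4n p hp
    · exact hWn p hp
    · exact hopn p hp
  have hZc : Z.card + ((D₄ ∪ W).card + g) = n := by
    have h1 := Finset.card_sdiff_add_card_eq_card hsub
    rw [Finset.card_range, Finset.card_union_of_disjoint hop5.symm, h.card_openPos] at h1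
    rw [hZ]; exact h1
  have hA5 : A' ⊆ (D₄ ∪ W).image f₅ := by
    intro v hv
    obtain ⟨p, hp, rfl⟩ := Finset.mem_image.1 (G.sub_image hv)
    have := a₅ p (hD4 hp)
    rw [a₄ p hp] at this
    rw [← this]
    exact Finset.mem_image_of_mem _ (Finset.mem_union_left _ (hD4 hp))
  have hfree : (D₄ ∪ W).card + (A'ᶜ \ (D₄ ∪ W).image f₅).card = n := by
    have h1 : A'ᶜ \ (D₄ ∪ W).image f₅ = ((D₄ ∪ W).image f₅)ᶜ := by
      ext v
      rw [Finset.mem_sdiff, Finset.mem_compl, Finset.mem_compl]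
      exact ⟨fun hv => hv.2, fun hv => ⟨fun hvA => hv (hA5 hvA), hv⟩⟩
    rw [h1, ← Finset.card_image_of_injOn v₅.injOn, Finset.card_add_card_compl, Fintype.card_fin]
  obtain ⟨f₆, v₆, a₆, -⟩ := v₅.fill hkn hst Z
    (Finset.disjoint_left.2 fun p hp => by
      rw [Finset.mem_union, not_or]; exact ⟨((memZ p).1 hp).2.1, ((memZ p).1 hp).2.2.1⟩)
    (fun x hx s hs => by
      obtain ⟨hxn, hx4, hxW, hxo⟩ := (memZ x).1 hx
      obtain ⟨p, hp, hpw, hpA⟩ := hspec x hx4 s hs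
      refine ⟨p, Finset.mem_union_left _ hp, hpw, ?_⟩
      rw [a₅ p hp]
      by_contra hpA'
      have hs' := mem_starts.1 hs
      refine hxW ((memW x).2 ⟨⟨p, ?_, s, mem_starts.2 ⟨hs'.1, hs'.2.1, hpw⟩, hs'.2.2⟩, hx4, hxo⟩)
      rw [hQ, Finset.mem_filter, Finset.mem_sdiff]
      exact ⟨hp, hpA, hpA'⟩) (by omega)
  obtain ⟨D₆, hD₆⟩ : ∃ D₆, D₆ = D₄ ∪ W ∪ Z := ⟨_, rfl⟩
  rw [← hD₆] at v₆
  have hop6 : Disjoint (openPos s₀ t g) D₆ := by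
    rw [hD₆, Finset.disjoint_union_right]
    exact ⟨hop5, Finset.disjoint_left.2 fun y hy hyZ => ((memZ y).1 hyZ).2.2.2 hy⟩
  have hall : D₆ ∪ openPos s₀ t g = Finset.range n := by
    ext p
    rw [Finset.mem_range, hD₆]
    refine ⟨fun hp => ?_, fun hp => ?_⟩
    · rw [Finset.mem_union, Finset.mem_union, Finset.mem_union] at hp
      rcases hp with ((hp | hp) | hp) | hp
      · exact hD4n p hp
      · exact hWn p hp
      · exact ((memZ p).1 hp).1
      · exact hopn p hp
    · rw [Finset.mem_union, Finset.mem_union, Finset.mem_union, memZ]; tauto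
  have hD6c : D₆.card + g = n := by
    have := congrArg Finset.card hall
    rwa [Finset.card_union_of_disjoint hop6.symm, h.card_openPos, Finset.card_range] at this
  have ha : ∀ p ∈ D, f₆ p = f p := fun p hp => by
    rw [a₆ p (Finset.mem_union_left _ (hD4 hp)), a₅ p (hD4 hp), a₄ p hp]
  have hD6 : D ⊆ D₆ := hD₆ ▸ hD4.trans (Finset.subset_union_left.trans Finset.subset_union_left)
  have himD : ∀ b, b ∉ D₆.image f₆ → b ∉ D.image f := by
    intro b hb hbD
    obtain ⟨p, hp, rfl⟩ := Finset.mem_image.1 hbD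
    exact hb (ha p hp ▸ Finset.mem_image_of_mem _ (hD6 hp))
  have hRA : ∀ b ∈ (D₆.image f₆)ᶜ, b ∉ A' := fun b hb hbA =>
    himD b (Finset.mem_compl.1 hb) (G.sub_image hbA)
  have hRc : ((D₆.image f₆)ᶜ).card = g := by
    have := Finset.card_add_card_compl (D₆.image f₆)
    rw [Finset.card_image_of_injOn v₆.injOn, Fintype.card_fin] at this
    omega
  obtain ⟨φ, hφ, hφr⟩ := exists_matching_of_half (Y := openPos s₀ t g) (R := (D₆.image f₆)ᶜ)
    (Finset.card_pos.1 (by rw [h.card_openPos]; exact hg)) (by rw [hRc, h.card_openPos])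
    (fun y b => Fits n k (k - l) E D f y b) (fun y hy => by
      rw [h.card_openPos]
      have h1 := G.not_fits y hy
      have h2 : ((D₆.image f₆)ᶜ.filter fun b => ¬ Fits n k (k - l) E D f y b).card ≤
          (A'ᶜ.filter fun b => ¬ Fits n k (k - l) E D f y b).card :=
        Finset.card_le_card (Finset.filter_subset_filter _ fun b hb =>
          Finset.mem_compl.2 (hRA b hb))
      have h3 := Finset.card_filter_add_card_filter_not (s := (D₆.image f₆)ᶜ)
        (fun b => Fits n k (k - l) E D f y b)
      omega) (fun b hb => by
      rw [h.card_openPos]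
      exact G.fits b (hRA b hb) (himD b (Finset.mem_compl.1 hb)))
  have v₇ := v₆.finish hop6 (fun s hs _ => h.openPos_sep hgπ s hs) hφ
    (fun y hy => Finset.mem_compl.1 (hφr y hy).1) (fun y hy s hs => by
      refine (fits_congr (D := D) (D' := D₆) (f := f) (f' := f₆) (fun s hs p hp =>
        ⟨fun hpD => hD6 hpD, fun hpD => ?_⟩) ha).2 (hφr y hy).2 s hs
      rcases G.win_sub y hy s hs p hp with hp | rfl
      · exact hp
      · exact (Finset.disjoint_left.1 hop6 hy hpD).elim)
  rw [hall] at v₇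
  exact v₇.hamCycle hE (by omega) hkn hdn

end completion

section extremal
variable {n k t : ℕ} {E : Finset (Finset (Fin n))}

theorem mem_miss_comm {a b : Fin n} : a ∈ miss E {b} ↔ b ∈ miss E {a} := by
  rw [mem_miss, mem_miss, Finset.pair_comm]

theorem card_miss_sdiff {A σ : Finset (Fin n)} {a : Fin n} (ha : a ∈ σ) {x y : ℝ}
    (h1 : ((miss E σ).card : ℝ) ≤ x) (h2 : y ≤ ((miss E {a} ∩ A).card : ℝ)) :
    ((miss E σ \ A).card : ℝ) ≤ x - y := by
  have h3 := Finset.card_sdiff_add_card_inter (miss E σ) A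
  have h4 : (miss E {a} ∩ A).card ≤ (miss E σ ∩ A).card :=
    Finset.card_le_card (Finset.inter_subset_inter_right
      (miss_mono (Finset.singleton_subset_iff.2 ha)))
  have h3' : ((miss E σ \ A).card : ℝ) + ((miss E σ ∩ A).card : ℝ) = ((miss E σ).card : ℝ) := by
    exact_mod_cast h3
  have h4' : ((miss E {a} ∩ A).card : ℝ) ≤ ((miss E σ ∩ A).card : ℝ) := by exact_mod_cast h4
  linarith

theorem card_mul_le_of_inter {S A : Finset (Fin n)} (hSA : Disjoint S A) {y z : ℝ}
    (hS : ∀ w ∈ S, y ≤ ((miss E {w} ∩ A).card : ℝ))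
    (hA : ∀ a ∈ A, ((miss E {a} \ A).card : ℝ) ≤ z) : (S.card : ℝ) * y ≤ A.card * z := by
  classical
  have h1 := Finset.sum_card_bipartiteAbove_eq_sum_card_bipartiteBelow
    (s := S) (t := A) (fun w a => a ∈ miss E {w})
  have h2 : (S.card : ℝ) * y ≤ ∑ w ∈ S, ((A.filter fun a => a ∈ miss E {w}).card : ℝ) := by
    rw [← nsmul_eq_mul]
    refine Finset.card_nsmul_le_sum _ _ _ fun w hw => (hS w hw).trans ?_
    rw [Finset.filter_mem_eq_inter, Finset.inter_comm]
  have h3 : ∑ a ∈ A, ((S.filter fun w => a ∈ miss E {w}).card : ℝ) ≤ A.card * z := by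
    rw [← nsmul_eq_mul]
    refine Finset.sum_le_card_nsmul _ _ _ fun a ha => le_trans ?_ (hA a ha)
    exact_mod_cast Finset.card_le_card fun w hw => by
      rw [Finset.mem_filter] at hw
      exact Finset.mem_sdiff.2 ⟨mem_miss_comm.1 hw.2, Finset.disjoint_left.1 hSA hw.1⟩
  refine h2.trans (le_trans (le_of_eq ?_) h3)
  exact_mod_cast h1

/-- The structure of an extremal example: `A'` is nearly independent of size about `x`. -/
structure Extremal (k : ℕ) (E : Finset (Finset (Fin n))) (x P Q : ℝ) (A A' : Finset (Fin n)) :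
    Prop where
  sub : A ⊆ A'
  le_card : x - P ≤ (A.card : ℝ)
  card_le : (A.card : ℝ) ≤ x - 2
  card_sdiff : ((A' \ A).card : ℝ) ≤ 4 * P
  strong : ∀ a ∈ A, ∀ σ, a ∈ σ → Face E σ → σ.card < k → ((miss E σ ∩ A'ᶜ).card : ℝ) ≤ 2 * P
  weak : ∀ a ∈ A', ∀ σ, a ∈ σ → Face E σ → σ.card < k → ((miss E σ ∩ A'ᶜ).card : ℝ) ≤ Q
  mem : ∀ a ∈ A', x - Q ≤ ((miss E {a} ∩ A).card : ℝ)
  notMem : ∀ b ∉ A', Q - P ≤ ((A \ miss E {b}).card : ℝ)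

theorem exists_extremal (hk : 3 ≤ k) {x P Q : ℝ} (hE : ∀ v, Face E {v})
    (hmiss : ∀ σ, Face E σ → σ.card < k → ((miss E σ).card : ℝ) ≤ x - 2) (hP : 0 < P) (hPQ : 2 * P ≤ Q)
    (hQx : 2 * Q ≤ x) {v : Fin n}
    (hv : x - P ≤ ((denseCore E (x - P) v).card : ℝ)) : ∃ A A', Extremal k E x P Q A A' := by
  classical
  obtain ⟨A, hA⟩ : ∃ A, A = denseCore E (x - P) v := ⟨_, rfl⟩
  rw [← hA] at hv
  have hAv : A ⊆ miss E {v} := hA ▸ Finset.filter_subset _ _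
  have hm1 : ∀ w, ((miss E {w}).card : ℝ) ≤ x - 2 := fun w =>
    hmiss _ (hE w) (by rw [Finset.card_singleton]; omega)
  have hAc : (A.card : ℝ) ≤ x - 2 :=
    le_trans (by exact_mod_cast Finset.card_le_card hAv) (hm1 v)
  have hin : ∀ a ∈ A, x - 2 * P ≤ ((miss E {a} ∩ A).card : ℝ) := by
    intro a ha
    have h1 : x - P ≤ ((miss E {a} ∩ miss E {v}).card : ℝ) := by
      rw [hA, denseCore, Finset.mem_filter] at ha; exact ha.2
    have h2 : (miss E {a} ∩ miss E {v}).card ≤ (miss E {a} ∩ A).card + (miss E {v} \ A).card := by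
      refine (Finset.card_le_card fun w hw => ?_).trans (Finset.card_union_le _ _)
      rw [Finset.mem_inter] at hw
      rw [Finset.mem_union, Finset.mem_inter, Finset.mem_sdiff]
      tauto
    have h3 := Finset.card_sdiff_add_card_eq_card hAv
    have h2' : ((miss E {a} ∩ miss E {v}).card : ℝ) ≤
        ((miss E {a} ∩ A).card : ℝ) + ((miss E {v} \ A).card : ℝ) := by exact_mod_cast h2
    have h3' : ((miss E {v} \ A).card : ℝ) + (A.card : ℝ) = ((miss E {v}).card : ℝ) := by
      exact_mod_cast h3
    linarith [hm1 v]
  obtain ⟨A', hA'⟩ : ∃ A', A' = Finset.univ.filter fun w => x - Q ≤ ((miss E {w} ∩ A).card : ℝ) :=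
    ⟨_, rfl⟩
  have memA' : ∀ w, w ∈ A' ↔ x - Q ≤ ((miss E {w} ∩ A).card : ℝ) := by
    intro w; rw [hA', Finset.mem_filter]; simp
  have hsub : A ⊆ A' := fun a ha => (memA' a).2 (by linarith [hin a ha])
  have hcompl : ∀ σ : Finset (Fin n), ((miss E σ ∩ A'ᶜ).card : ℝ) ≤ ((miss E σ \ A).card : ℝ) := by
    intro σ
    exact_mod_cast Finset.card_le_card fun w hw => by
      rw [Finset.mem_inter, Finset.mem_compl] at hw
      exact Finset.mem_sdiff.2 ⟨hw.1, fun hwA => hw.2 (hsub hwA)⟩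
  refine ⟨A, A', hsub, hv, hAc, ?_, ?_, ?_, fun a ha => (memA' a).1 ha, ?_⟩
  · have h1 := card_mul_le_of_inter (E := E) (S := A' \ A) (A := A) (y := x - Q) (z := 2 * P)
      Finset.sdiff_disjoint (fun w hw => (memA' w).1 (Finset.mem_sdiff.1 hw).1)
      (fun a ha => (card_miss_sdiff (Finset.mem_singleton_self a) (hm1 a) (hin a ha)).trans
        (by linarith))
    have h2 : (A.card : ℝ) * (2 * P) ≤ x * (2 * P) :=
      mul_le_mul_of_nonneg_right (by linarith) (by linarith)
    have h3 : ((A' \ A).card : ℝ) * (x / 2) ≤ ((A' \ A).card : ℝ) * (x - Q) :=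
      mul_le_mul_of_nonneg_left (by linarith) (Nat.cast_nonneg _)
    have hx : 0 < x := by linarith
    have h4 : ((A' \ A).card : ℝ) * (x / 2) ≤ 4 * P * (x / 2) := by linarith
    exact le_of_mul_le_mul_right h4 (by linarith)
  · intro a ha σ haσ hσ hσk
    refine (hcompl σ).trans ((card_miss_sdiff haσ (hmiss σ hσ hσk) (hin a ha)).trans ?_)
    linarith
  · intro a ha σ haσ hσ hσk
    refine (hcompl σ).trans ((card_miss_sdiff haσ (hmiss σ hσ hσk) ((memA' a).1 ha)).trans ?_)
    linarith
  · intro b hb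
    rw [memA', not_le] at hb
    have h1 := Finset.card_sdiff_add_card_inter A (miss E {b})
    rw [Finset.inter_comm] at h1
    have h1' : ((A \ miss E {b}).card : ℝ) + ((miss E {b} ∩ A).card : ℝ) = (A.card : ℝ) := by
      exact_mod_cast h1
    linarith

end extremal

section cherries
variable {n k t : ℕ} {E : Finset (Finset (Fin n))}

theorem exists_cherries {A' : Finset (Fin n)} {c Δ : ℕ}
    (hmin : ∀ w ∈ A', c + 2 ≤ (A' \ miss E {w}).card) (hmax : ∀ w ∈ A', (A' \ miss E {w}).card ≤ Δ)
    (hbig : 3 * c + 3 * Δ < A'.card) (m : ℕ) (hm : m ≤ c) :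
    ∃ C : List (Fin n × Fin n × Fin n), C.length = m ∧
      (∀ x ∈ C, Face E {x.1, x.2.1} ∧ Face E {x.2.1, x.2.2}) ∧ (tripleVerts C).Nodup ∧
      (∀ v ∈ tripleVerts C, v ∈ A') ∧ ∀ x ∈ C, x.1 ∈ A' ∧ x.2.2 ∈ A' := by
  classical
  induction m with
  | zero => exact ⟨[], rfl, by simp, by simp [tripleVerts], by simp [tripleVerts], by simp⟩
  | succ m ih =>
    obtain ⟨C, c1, c2, c3, c4, c5⟩ := ih (by omega)
    obtain ⟨U, hU⟩ : ∃ U, U = (tripleVerts C).toFinset := ⟨_, rfl⟩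
    have memU : ∀ v, v ∈ U ↔ v ∈ tripleVerts C := fun v => by rw [hU, List.mem_toFinset]
    have hUc : U.card = 3 * m := by rw [hU, List.toFinset_card_of_nodup c3, card_tripleVerts, c1]
    have hUA : U ⊆ A' := fun v hv => c4 v ((memU v).1 hv)
    have hw : ∃ w ∈ A' \ U, 1 < (((A' \ miss E {w}) \ U).erase w).card := by
      by_contra! hcon
      have h1 := Finset.sum_card_bipartiteAbove_eq_sum_card_bipartiteBelow
        (s := A' \ U) (t := U) (fun w u => u ∉ miss E {w})
      have h2 : (A' \ U).card * c ≤ ∑ w ∈ A' \ U, (U.filter fun u => u ∉ miss E {w}).card := by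
        rw [← smul_eq_mul]
        refine Finset.card_nsmul_le_sum _ _ _ fun w hw => ?_
        have e1 := hmin w (Finset.mem_sdiff.1 hw).1
        have e2 := hcon w hw
        have e3 : (A' \ miss E {w}) ⊆ insert w (((A' \ miss E {w}) \ U).erase w ∪
            U.filter fun u => u ∉ miss E {w}) := by
          intro u hu
          rw [Finset.mem_insert, Finset.mem_union, Finset.mem_erase, Finset.mem_filter,
            Finset.mem_sdiff (s := A' \ miss E {w})]
          have := (Finset.mem_sdiff.1 hu).2
          tauto
        have e4 := (Finset.card_le_card e3).trans (Finset.card_insert_le _ _)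
        have e5 := Finset.card_union_le (((A' \ miss E {w}) \ U).erase w)
          (U.filter fun u => u ∉ miss E {w})
        omega
      have h3 : ∑ u ∈ U, ((A' \ U).filter fun w => u ∉ miss E {w}).card ≤ U.card * Δ := by
        rw [← smul_eq_mul]
        refine Finset.sum_le_card_nsmul _ _ _ fun u hu => le_trans ?_ (hmax u (hUA hu))
        refine Finset.card_le_card fun w hw => ?_
        rw [Finset.mem_filter, Finset.mem_sdiff] at hw
        exact Finset.mem_sdiff.2 ⟨hw.1.1, fun h => hw.2 (mem_miss_comm.1 h)⟩
      have h4 : (A' \ U).card * c ≤ 3 * m * Δ := by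
        rw [hUc] at h3
        exact h2.trans ((le_of_eq h1).trans h3)
      have h5 := Finset.card_sdiff_add_card_eq_card hUA
      have h6 : (3 * Δ + 1) * c ≤ (A' \ U).card * c := Nat.mul_le_mul_right _ (by omega)
      have h7 : 3 * m * Δ ≤ 3 * Δ * c := by
        calc 3 * m * Δ = 3 * Δ * m := by ring
          _ ≤ _ := Nat.mul_le_mul_left _ (by omega)
      rw [Nat.add_mul] at h6
      omega
    obtain ⟨w, hwU, hw⟩ := hw
    obtain ⟨a, a', ha, ha', haa⟩ := Finset.one_lt_card_iff.1 hw
    rw [Finset.mem_erase, Finset.mem_sdiff, Finset.mem_sdiff, memU] at ha ha'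
    rw [Finset.mem_sdiff, memU] at hwU
    have htv : tripleVerts ((a, w, a') :: C) = a :: w :: a' :: tripleVerts C := by simp [tripleVerts]
    refine ⟨(a, w, a') :: C, by simp [c1], ?_, ?_, ?_, ?_⟩
    · intro x hx
      rcases List.mem_cons.1 hx with rfl | hx
      · refine ⟨face_insert ha.2.1.2, ?_⟩
        have := face_insert ha'.2.1.2
        rwa [Finset.pair_comm] at this
      · exact c2 x hx
    · rw [htv]
      simp [c3, ha.2.2, ha'.2.2, hwU.2, ha.1, ha'.1.symm, haa]
    · rw [htv]
      simp only [List.mem_cons]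
      rintro v (rfl | rfl | rfl | hv)
      · exact ha.2.1.1
      · exact hwU.1
      · exact ha'.2.1.1
      · exact c4 v hv
    · intro x hx
      rcases List.mem_cons.1 hx with rfl | hx
      · exact ⟨ha.2.1.1, ha'.2.1.1⟩
      · exact c5 x hx

end cherries

section combine
variable {n k t l : ℕ} {E : Finset (Finset (Fin n))}

set_option maxHeartbeats 2000000 in
theorem Extremal.hamCycle {P Q : ℝ} {A A' : Finset (Fin n)} (hk : 3 ≤ k) (hl : 1 ≤ k - l)
    (ht : t = k / (k - l) * (k - l)) (ht3 : 3 ≤ t) (hG : Good k t E) (hdn : (k - l) ∣ n)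
    (hX : Extremal k E (n / t) P Q A A') (hPQ : 1000 * (k : ℝ) ^ 2 * P ≤ Q)
    (hQn : 100 * (k : ℝ) ^ 2 * Q ≤ n) (hP : 1000 * (k : ℝ) ≤ P) : HamCycle k l E := by
  classical
  have htk : t ≤ k := ht ▸ Nat.div_mul_le_self _ _
  have hkt : k < t + (k - l) := by
    have h1 := Nat.div_add_mod k (k - l)
    have h2 := Nat.mod_lt k (show 0 < k - l by omega)
    rw [Nat.mul_comm, ← ht] at h1
    omega
  have hkr : (3 : ℝ) ≤ k := by exact_mod_cast hk
  have htr : (3 : ℝ) ≤ t := by exact_mod_cast ht3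
  have htkr : (t : ℝ) ≤ k := by exact_mod_cast htk
  obtain ⟨x, hx⟩ : ∃ x : ℝ, x = n / t := ⟨_, rfl⟩
  rw [← hx] at hX
  have htx : t * x = n := by rw [hx]; field_simp
  have hP0 : 0 < P := by linarith
  have b1 : 3 * P ≤ k * P := mul_le_mul_of_nonneg_right hkr hP0.le
  have b2 : 3 * (k * P) ≤ k ^ 2 * P := by nlinarith
  have hQ0 : 0 < Q := by nlinarith
  have b3 : 3 * Q ≤ k * Q := mul_le_mul_of_nonneg_right hkr hQ0.le
  have b4 : 3 * (k * Q) ≤ k ^ 2 * Q := by nlinarith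
  have hx0 : 0 ≤ x := hx ▸ by positivity
  have b5 : 100 * (k * Q) ≤ x := by
    have h1 : (k : ℝ) * (100 * (k * Q)) ≤ k * x := by nlinarith
    exact le_of_mul_le_mul_left h1 (by linarith)
  have b6 : 3 * x ≤ n := by nlinarith
  have b7 : (t : ℝ) * P ≤ k * P := mul_le_mul_of_nonneg_right htkr hP0.le
  have hmiss : ∀ σ, Face E σ → σ.card < k → ((miss E σ).card : ℝ) ≤ x - 2 := fun σ h1 h2 =>
    hx ▸ hG.miss_le (by omega) h1 h2
  obtain ⟨p, hp⟩ : ∃ p, p = n / t := ⟨_, rfl⟩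
  have hp1 : (p : ℝ) ≤ x := by rw [hp, hx]; exact Nat.cast_div_le
  have hp2 : x < p + 1 := by
    rw [hx, div_lt_iff₀ (by linarith), mul_comm]
    exact_mod_cast hp ▸ Nat.lt_mul_div_succ n (show 0 < t by omega)
  obtain ⟨μ, hμ⟩ : ∃ μ, μ = ⌊2 * P⌋₊ := ⟨_, rfl⟩
  obtain ⟨ν, hν⟩ : ∃ ν, ν = ⌊Q⌋₊ := ⟨_, rfl⟩
  obtain ⟨ω, hω⟩ : ∃ ω, ω = ⌊4 * P⌋₊ := ⟨_, rfl⟩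
  obtain ⟨g, hg⟩ : ∃ g, g = ⌊Q / 16⌋₊ := ⟨_, rfl⟩
  have hμ1 : (μ : ℝ) ≤ 2 * P := hμ ▸ Nat.floor_le (by linarith)
  have hν1 : (ν : ℝ) ≤ Q := hν ▸ Nat.floor_le (by linarith)
  have hω1 : (ω : ℝ) ≤ 4 * P := hω ▸ Nat.floor_le (by linarith)
  have hg1 : (g : ℝ) ≤ Q / 16 := hg ▸ Nat.floor_le (by linarith)
  have hg2 : Q / 16 < g + 1 := hg ▸ Nat.lt_floor_add_one _
  have c1 : (k : ℝ) * μ ≤ 2 * (k * P) := by nlinarith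
  have c2 : (k : ℝ) * ν ≤ k * Q := by nlinarith
  have c3 : (g : ℝ) * (k * k) ≤ k ^ 2 * Q / 16 := by nlinarith
  have c4 : (ω : ℝ) * (k * k) ≤ 4 * (k ^ 2 * P) := by nlinarith
  have hst : Strong k E A A'ᶜ μ := fun a ha σ h1 h2 h3 => hμ ▸ Nat.le_floor (hX.strong a ha σ h1 h2 h3)
  have hwk : Strong k E A' A'ᶜ ν := fun a ha σ h1 h2 h3 => hν ▸ Nat.le_floor (hX.weak a ha σ h1 h2 h3)
  have hAA : (A' \ A).card ≤ ω := hω ▸ Nat.le_floor hX.card_sdiff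
  have hα : (A'.card : ℝ) = (A' \ A).card + A.card := by
    exact_mod_cast (Finset.card_sdiff_add_card_eq_card hX.sub).symm
  have hα1 : x - P ≤ A'.card := hX.le_card.trans (by exact_mod_cast Finset.card_le_card hX.sub)
  have hα2 : (A'.card : ℝ) ≤ x + 4 * P - 2 := by
    have := hX.card_le; have := hX.card_sdiff; linarith
  have hco : (A'.card : ℝ) + (A'ᶜ).card = n := by
    have := Finset.card_add_card_compl A'
    rw [Fintype.card_fin] at this
    exact_mod_cast this
  have hE := hG.face_singleton
  have hnpos : 0 < n := by
    have : (0 : ℝ) < n := by nlinarith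
    exact_mod_cast this
  have hE0 := hG.face_empty hnpos
  obtain ⟨π, hπ⟩ : ∃ π, π = min A'.card p := ⟨_, rfl⟩
  obtain ⟨c, hc⟩ : ∃ c, A'.card = π + c := ⟨A'.card - π, by omega⟩
  have hπp : π ≤ p := by omega
  have hπ1 : x - P - 1 ≤ π := by
    rcases min_choice A'.card p with h | h <;> rw [hπ, h] <;> linarith
  have hc1 : (c : ℝ) ≤ 4 * P := by
    have h1 : (A'.card : ℝ) = π + c := by exact_mod_cast hc
    rcases min_choice A'.card p with h | h
    · rw [hπ, h] at h1; linarith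
    · rw [hπ, h] at h1; linarith
  have htp : t * p ≤ n := hp ▸ Nat.mul_div_le n t
  have hπt : π * t ≤ n := by
    have := Nat.mul_le_mul_left t hπp
    rw [Nat.mul_comm]; omega
  obtain ⟨s₀, hs₀⟩ : ∃ s₀, n = s₀ + π * t := ⟨n - π * t, by omega⟩
  have hs1 : (s₀ : ℝ) ≤ k * P + k := by
    have h1 : (n : ℝ) = s₀ + π * t := by exact_mod_cast hs₀
    have h2 : (t : ℝ) * (x - P - 1) ≤ t * π := mul_le_mul_of_nonneg_left hπ1 (by linarith)
    nlinarith
  have hdt : (k - l) ∣ t := ht ▸ Dvd.intro_left _ rfl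
  have hds : (k - l) ∣ s₀ := by
    have h1 : (k - l) ∣ s₀ + π * t := hs₀ ▸ hdn
    exact (Nat.dvd_add_left (hdt.mul_left π)).1 h1
  have hL : Layout n k (k - l) t s₀ π := by
    refine ⟨hl, ?_, ht3, hdt, htk, hkt, hds, hs₀, ?_⟩
    · have : (0 : ℝ) < π := by linarith
      exact_mod_cast this
    · have : (k : ℝ) ≤ n := by linarith
      exact_mod_cast this
  obtain ⟨C, hC, hCf, hCn, hCA, hCA'⟩ : ∃ C : List (Fin n × Fin n × Fin n), C.length = c ∧
      (∀ x ∈ C, Face E {x.1, x.2.1} ∧ Face E {x.2.1, x.2.2}) ∧ (tripleVerts C).Nodup ∧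
      (∀ v ∈ tripleVerts C, v ∈ A') ∧ ∀ x ∈ C, x.1 ∈ A' ∧ x.2.2 ∈ A' := by
    rcases Nat.eq_zero_or_pos c with h0 | h0
    · exact ⟨[], by simp [h0], by simp, by simp [tripleVerts], by simp [tripleVerts], by simp⟩
    · obtain ⟨Δ, hΔ⟩ : ∃ Δ, Δ = ⌊Q + 4 * P⌋₊ := ⟨_, rfl⟩
      have hΔ1 : (Δ : ℝ) ≤ Q + 4 * P := hΔ ▸ Nat.floor_le (by linarith)
      refine exists_cherries (Δ := Δ) (fun w _ => ?_) (fun w hw => ?_) ?_ c le_rfl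
      · have h1 := hG.card_miss {w} (hE w) (by rw [Finset.card_singleton]; omega)
        have h2 : (miss E {w}).card + 2 ≤ p := by
          rw [hp, Nat.le_div_iff_mul_le (by omega), Nat.mul_comm]; exact h1
        have h3 := Finset.le_card_sdiff (miss E {w}) A'
        omega
      · rw [hΔ]
        refine Nat.le_floor ?_
        have h1 := hX.mem w hw
        have h2 : (miss E {w} ∩ A).card ≤ (A' ∩ miss E {w}).card :=
          Finset.card_le_card fun v hv => by
            rw [Finset.mem_inter] at hv ⊢
            exact ⟨hX.sub hv.2, hv.1⟩
        have h3 : ((miss E {w} ∩ A).card : ℝ) ≤ (A' ∩ miss E {w}).card := by exact_mod_cast h2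
        have h4 : ((A' \ miss E {w}).card : ℝ) + (A' ∩ miss E {w}).card = A'.card := by
          exact_mod_cast Finset.card_sdiff_add_card_inter A' (miss E {w})
        linarith
      · have : 3 * (c : ℝ) + 3 * Δ < A'.card := by linarith
        exact_mod_cast this
  have hA1 := hX.le_card
  obtain ⟨D, f, S⟩ := hL.exists_skeleton (g := g) hE hE0 hX.sub hst hc (fun b hb => by
      have h1 := hX.notMem b (Finset.mem_compl.1 hb)
      have : 2 * (g : ℝ) + 20 + 3 * c + 4 * (k * μ) ≤ (A \ miss E {b}).card := by linarith
      exact_mod_cast this) C hC hCf hCn hCA hCA'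
    (by
      have : 2 * ((k : ℝ) * μ) ≤ g := by linarith
      exact_mod_cast this)
    (by
      have : 2 * (g : ℝ) + 20 + 3 * c ≤ A.card := by linarith
      exact_mod_cast this)
    (by
      have : 2 * (g : ℝ) + 40 + 2 * (2 * (k * μ) + c) ≤ π := by linarith
      exact_mod_cast this)
    (by
      have : 2 * (g : ℝ) + 20 + g * (k * k) + 2 * (k * μ) ≤ (A'ᶜ).card := by linarith
      exact_mod_cast this)
  refine S.hamCycle (μ := μ) (ν := ν) (ω := ω) (τ := p) hL hG.card_eq hE0 hdn hst hwk hAA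
    (fun σ h1 h2 => ?_) ?_ ?_ ?_ ?_ ?_
  · have := hmiss σ h1 h2
    have : ((miss E σ).card : ℝ) < p + 1 := by linarith
    exact Nat.lt_succ_iff.1 (by exact_mod_cast this)
  · have : (0 : ℝ) < g := by linarith
    exact_mod_cast this
  · have : (k : ℝ) * μ ≤ g := by linarith
    exact_mod_cast this
  · have : 2 * (g : ℝ) + 40 ≤ π := by linarith
    exact_mod_cast this
  · have : (s₀ : ℝ) + t + p + k * ν + (2 * (g : ℝ) + 20 + g * (k * k) + 2 * (k * μ)) ≤
        (A'ᶜ).card := by linarith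
    exact_mod_cast this
  · have : (s₀ : ℝ) + t + ω * (k * k) + k * ν + (2 * (g : ℝ) + 20 + g * (k * k) + 2 * (k * μ)) ≤
        (A'ᶜ).card := by linarith
    exact_mod_cast this

end combine

theorem three_le_div_mul {k d : ℕ} (hk : 3 ≤ k) (hd : 1 ≤ d) (hdk : d ≤ k - 1)
    (hne : ¬(k = 3 ∧ d = 2)) : 3 ≤ k / d * d := by
  have h1 := Nat.div_add_mod k d
  have h2 := Nat.mod_lt k hd
  have h3 : d * 1 ≤ d * (k / d) := Nat.mul_le_mul_left d (Nat.div_pos (by omega) hd)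
  rw [Nat.mul_comm d (k / d)] at h1 h3
  rcases (by omega : d = 1 ∨ d = 2 ∨ 3 ≤ d) with rfl | rfl | h <;> omega

/-- For `k ≥ 3`, `ℓ ∈ [k-1]` with `(k,ℓ) ≠ (3,1)` and `t = ⌊k/(k-ℓ)⌋(k-ℓ)`,
every sufficiently large `n`-vertex `k`-graph (with `(k-ℓ) ∣ n`) without isolated
vertices and with minimum supported co-degree at least `(1 - 1/t)n - (k-3)`
contains a Hamilton ℓ-cycle. -/
theorem hamilton_ell_cycle_supported_codegree
    (k l t : ℕ) (hk : 3 ≤ k) (hl : 1 ≤ l) (hlk : l ≤ k - 1)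
    (hne : ¬(k = 3 ∧ l = 1)) (ht : t = k / (k - l) * (k - l)) :
    ∃ n₀ : ℕ, ∀ n : ℕ, n₀ ≤ n → (k - l) ∣ n →
      ∀ E : Finset (Finset (Fin n)),
        (∀ e ∈ E, e.card = k) →
        (∀ v : Fin n, ∃ e ∈ E, v ∈ e) →
        (∀ S : Finset (Fin n), S.card = k - 1 → (∃ e ∈ E, S ⊆ e) →
          (1 - 1 / (t : ℝ)) * (n : ℝ) - ((k : ℝ) - 3) ≤
            ((E.filter fun e => S ⊆ e).card : ℝ)) →
        HamCycle k l E := by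
  have ht3 : 3 ≤ t := ht ▸ three_le_div_mul hk (by omega) (by omega) (by omega)
  have htk : t ≤ k := ht ▸ Nat.div_mul_le_self _ _
  have hkr : (3 : ℝ) ≤ k := by exact_mod_cast hk
  have htr : (3 : ℝ) ≤ t := by exact_mod_cast ht3
  have htkr : (t : ℝ) ≤ k := by exact_mod_cast htk
  obtain ⟨ρ, hρ⟩ : ∃ ρ : ℝ, ρ = 1 / (100000 * k ^ 4) := ⟨_, rfl⟩
  have hρ0 : 0 < ρ := hρ ▸ by positivity
  have hρt : ρ ≤ 1 / t := by
    rw [hρ]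
    refine one_div_le_one_div_of_le (by linarith) ?_
    have h1 : (1 : ℝ) ≤ k ^ 3 := one_le_pow₀ (by linarith)
    nlinarith
  obtain ⟨N, hN⟩ := exists_cycleList_of_nonextremal k (k - l) t hk (by omega) (by omega) ht ht3 hρ0 hρt
  refine ⟨max N (100000000 * k ^ 5), fun n hn hdn E hE hv hS => ?_⟩
  have hn5 : 100000000 * k ^ 5 ≤ n := le_trans (le_max_right _ _) hn
  have hn5r : 100000000 * (k : ℝ) ^ 5 ≤ n := by exact_mod_cast hn5
  have hkn : k ≤ n := by
    have := Nat.le_self_pow (show 5 ≠ 0 by omega) k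
    omega
  have hG := good_of_codegree hk (by omega) hE hv hS
  by_cases h : ∀ v, ((denseCore E ((1 / t - ρ) * n) v).card : ℝ) < (1 / t - ρ) * n
  · obtain ⟨L, hL⟩ := hN n (le_trans (le_max_left _ _) hn) E hG h
    exact hL.hamCycle (by omega) hkn (by omega) hdn
  · push Not at h
    obtain ⟨v, hv'⟩ := h
    obtain ⟨Q, hQ⟩ : ∃ Q : ℝ, Q = n / (100 * k ^ 2) := ⟨_, rfl⟩
    have hn0 : (0 : ℝ) < n := by exact_mod_cast (by omega : 0 < n)
    have e1 : 1000 * (k : ℝ) ^ 2 * (ρ * n) = Q := by rw [hρ, hQ]; field_simp; norm_num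
    have e2 : 100 * (k : ℝ) ^ 2 * Q = n := by rw [hQ]; field_simp
    have e3 : 1000 * (k : ℝ) ≤ ρ * n := by
      rw [hρ, one_div, inv_mul_eq_div, le_div_iff₀ (by positivity)]
      linarith
    have e4 : (1 / (t : ℝ) - ρ) * n = n / t - ρ * n := by ring
    rw [e4] at hv'
    have hP0 : 0 < ρ * n := by positivity
    have hk2 : (9 : ℝ) ≤ k ^ 2 := by nlinarith
    have hQ0 : 0 < Q := by rw [hQ]; positivity
    obtain ⟨A, A', hX⟩ := exists_extremal (Q := Q) hk hG.face_singleton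
      (fun σ h1 h2 => hG.miss_le (by omega) h1 h2) hP0 (by nlinarith) (by
        rw [le_div_iff₀ (by linarith), ← e2]
        have h1 : 2 * (t : ℝ) ≤ 100 * k ^ 2 := by nlinarith
        linarith [mul_le_mul_of_nonneg_right h1 hQ0.le]) hv'
    exact hX.hamCycle hk (by omega) ht ht3 hG hdn e1.le e2.le e3
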